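/- Fix n ≥ 2. Suppose that for every d ≤ n, every stable lattice x ∈ ℒ_d that is a local maximum of the function covrad: ℒ_d → ℝ satisfies covrad(x) ≤ √d/2. Then every unimodular lattice x in ℝⁿ satisfies sup_{u∈ℝⁿ} inf_{v∈x} |∏_{i=1}^n (u_i − v_i)| ≤ 2^{−n}. -/

import Mathlib

open scoped BigOperators
open Matrix Topology Filter

noncomputable section

namespace SW

/-! ### Euclidean structure on `Fin n → ℝ` -/

/-- The standard Euclidean inner product on `Fin n → ℝ`. -/
def einner {n : ℕ} (v w : Fin n → ℝ) : ℝ := ∑ i, v i * w i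

/-- The Euclidean norm on `Fin n → ℝ`. -/
def enorm {n : ℕ} (v : Fin n → ℝ) : ℝ := Real.sqrt (∑ i, v i ^ 2)

lemma einner_add_left {n : ℕ} (u v w : Fin n → ℝ) :
    einner (u + v) w = einner u w + einner v w := by
  simp [einner, add_mul, Finset.sum_add_distrib]

lemma einner_neg_left {n : ℕ} (u w : Fin n → ℝ) : einner (-u) w = -einner u w := by
  simp [einner]

lemma einner_smul_left {n : ℕ} (c : ℝ) (u w : Fin n → ℝ) :
    einner (c • u) w = c * einner u w := by
  simp [einner, Finset.mul_sum, mul_assoc]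

/-! ### Covolume, rank, lattices, stability -/

/-- `√(det Gram)` of a finite family of vectors: the covolume of the ℤ-span of the family
(in the span of the family) when the family is linearly independent. -/
def gvol {n r : ℕ} (v : Fin r → (Fin n → ℝ)) : ℝ :=
  Real.sqrt (Matrix.det (Matrix.of fun i j => einner (v i) (v j)))

/-- `c` is the covolume of `Λ` in its real span, as computed from some ℤ-basis of `Λ` which is
linearly independent over `ℝ`. -/
def covolSpec {n : ℕ} (Λ : AddSubgroup (Fin n → ℝ)) (c : ℝ) : Prop :=
  ∃ (r : ℕ) (v : Fin r → (Fin n → ℝ)), LinearIndependent ℝ v ∧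
    Λ = AddSubgroup.closure (Set.range v) ∧ c = gvol v

/-- The covolume of a discrete subgroup `Λ ⊆ ℝⁿ` inside its real span (with `covol ⊥ = 1`). -/
def covol {n : ℕ} (Λ : AddSubgroup (Fin n → ℝ)) : ℝ := sInf {c | covolSpec Λ c}

/-- The rank of a discrete subgroup of `ℝⁿ`: the dimension of its real span. -/
def rk {n : ℕ} (Λ : AddSubgroup (Fin n → ℝ)) : ℕ :=
  Module.finrank ℝ (Submodule.span ℝ (Λ : Set (Fin n → ℝ)))

/-- A lattice in `ℝⁿ`: a discrete subgroup spanning `ℝⁿ` (equivalently, cocompact). -/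
def IsLattice {n : ℕ} (L : AddSubgroup (Fin n → ℝ)) : Prop :=
  DiscreteTopology ↥L ∧ Submodule.span ℝ (L : Set (Fin n → ℝ)) = ⊤

/-- A unimodular lattice: a lattice of covolume one. -/
def IsUnimodularLattice {n : ℕ} (L : AddSubgroup (Fin n → ℝ)) : Prop :=
  IsLattice L ∧ covol L = 1

/-- A stable lattice: a unimodular lattice all of whose subgroups have covolume at least one. -/
def IsStable {n : ℕ} (L : AddSubgroup (Fin n → ℝ)) : Prop :=
  IsUnimodularLattice L ∧ ∀ Λ : AddSubgroup (Fin n → ℝ), Λ ≤ L → 1 ≤ covol Λ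

/-! ### Matrices: the diagonal group `A`, `SL_n(ℤ)`, lattices from matrices -/

/-- The group `A` of positive diagonal matrices of determinant one (as a set of matrices). -/
def Apos (n : ℕ) : Set (Matrix (Fin n) (Fin n) ℝ) :=
  {a | ∃ d : Fin n → ℝ, (∀ i, 0 < d i) ∧ (∏ i, d i) = 1 ∧ a = Matrix.diagonal d}

/-- `SL_n(ℤ)` viewed as a set of real matrices. -/
def Gam (n : ℕ) : Set (Matrix (Fin n) (Fin n) ℝ) :=
  {γ | γ.det = 1 ∧ ∀ i j, ∃ m : ℤ, γ i j = (m : ℝ)}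

/-- The lattice `g·ℤⁿ` associated to a matrix `g`. -/
def latticeOf {n : ℕ} (g : Matrix (Fin n) (Fin n) ℝ) : AddSubgroup (Fin n → ℝ) :=
  AddSubgroup.closure (Set.range fun m : Fin n → ℤ => g.mulVec fun i => (m i : ℝ))

/-- The image `g·L` of a lattice under a matrix. -/
def mapLat {n : ℕ} (g : Matrix (Fin n) (Fin n) ℝ) (L : AddSubgroup (Fin n → ℝ)) :
    AddSubgroup (Fin n → ℝ) :=
  AddSubgroup.map (Matrix.mulVecLin g).toAddMonoidHom L

/-- The full preimage `A·g·Γ` in `SL_n(ℝ)` of the orbit `A·[g] ⊆ ℒ_n`; a point `[h] ∈ ℒ_n`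
lies in the closure of `A·[g]` iff `h ∈ closure (AOrbit g)`. -/
def AOrbit {n : ℕ} (g : Matrix (Fin n) (Fin n) ℝ) : Set (Matrix (Fin n) (Fin n) ℝ) :=
  {p | ∃ a ∈ Apos n, ∃ γ ∈ Gam n, p = a * g * γ}

/-- The orbit `A·[g] ⊆ ℒ_n` is bounded (has compact closure). -/
def HasBoundedAOrbit {n : ℕ} (g : Matrix (Fin n) (Fin n) ℝ) : Prop :=
  ∃ K : Set (Matrix (Fin n) (Fin n) ℝ), IsCompact K ∧
    ∀ a ∈ Apos n, ∃ γ ∈ Gam n, a * g * γ ∈ K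

/-! ### `α`, `Min_δ`, `V_δ`, `dim_δ` -/

/-- `α(x) = min { |Λ|^{1/r(Λ)} : Λ a nonzero subgroup of x }`. -/
def alpha {n : ℕ} (x : AddSubgroup (Fin n → ℝ)) : ℝ :=
  sInf {c | ∃ Λ : AddSubgroup (Fin n → ℝ), Λ ≤ x ∧ Λ ≠ ⊥ ∧ c = covol Λ ^ ((rk Λ : ℝ)⁻¹)}

/-- `α_k(x) = min { |Λ|^{1/k} : Λ a rank-`k` subgroup of x }`. -/
def alphak {n : ℕ} (k : ℕ) (x : AddSubgroup (Fin n → ℝ)) : ℝ :=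
  sInf {c | ∃ Λ : AddSubgroup (Fin n → ℝ), Λ ≤ x ∧ rk Λ = k ∧ c = covol Λ ^ ((k : ℝ)⁻¹)}

/-- `Min_δ(x)`: nonzero subgroups nearly attaining `α(x)`. -/
def MinSet {n : ℕ} (δ : ℝ) (x : AddSubgroup (Fin n → ℝ)) : Set (AddSubgroup (Fin n → ℝ)) :=
  {Λ | Λ ≤ x ∧ Λ ≠ ⊥ ∧ covol Λ ^ ((rk Λ : ℝ)⁻¹) < (1 + δ) * alpha x}

/-- `V_δ(x)`: the span of the subgroups in `Min_δ(x)`. -/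
def Vdelta {n : ℕ} (δ : ℝ) (x : AddSubgroup (Fin n → ℝ)) : Submodule ℝ (Fin n → ℝ) :=
  Submodule.span ℝ (⋃ Λ ∈ MinSet δ x, (Λ : Set (Fin n → ℝ)))

/-- `dim_δ(x) = dim V_δ(x)`. -/
def dimdelta {n : ℕ} (δ : ℝ) (x : AddSubgroup (Fin n → ℝ)) : ℕ :=
  Module.finrank ℝ (Vdelta δ x)

/-- `U_k^{x,ε} ⊆ A`: those `a` for which `δ ↦ dim_δ(ax)` equals `k` near `kε`. -/
def Uset {n : ℕ} (x : AddSubgroup (Fin n → ℝ)) (ε : ℝ) (k : ℕ) :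
    Set (Matrix (Fin n) (Fin n) ℝ) :=
  {a | a ∈ Apos n ∧ ∃ s ∈ 𝓝 ((k : ℝ) * ε), ∀ δ ∈ s, dimdelta δ (mapLat a x) = k}

/-- Logarithmic coordinates on the diagonal group. -/
def logCoord {n : ℕ} (a : Matrix (Fin n) (Fin n) ℝ) : Fin n → ℝ := fun i => Real.log (a i i)

/-! ### Covering radius -/

/-- The covering radius `covrad(L) = sup_u inf_{v ∈ L} ‖u - v‖`. -/
def covrad {n : ℕ} (L : AddSubgroup (Fin n → ℝ)) : ℝ :=
  ⨆ u : Fin n → ℝ, ⨅ v : L, enorm (u - (v : Fin n → ℝ))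

/-- `[g]` is a local maximum of `covrad : ℒ_d → ℝ` (phrased via the open quotient
`SL_d(ℝ) → ℒ_d`). -/
def IsLocalMaxCovrad {d : ℕ} (g : Matrix (Fin d) (Fin d) ℝ) : Prop :=
  ∃ W ∈ 𝓝 g, ∀ g' ∈ W, Matrix.det g' = 1 → covrad (latticeOf g') ≤ covrad (latticeOf g)

/-! ### Block upper triangular form -/

/-- Offset of the `i`-th diagonal block. -/
def off {k : ℕ} (ns : Fin k → ℕ) (i : Fin k) : ℕ :=
  ∑ j ∈ Finset.univ.filter (fun j => j < i), ns j

lemma off_add_lt {k : ℕ} (ns : Fin k → ℕ) (i : Fin k) (a : Fin (ns i)) :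
    off ns i + (a : ℕ) < ∑ j, ns j := by
  unfold off
  have hins : i ∉ Finset.univ.filter (fun j => j < i) := by simp
  have h2 : ∑ j ∈ insert i (Finset.univ.filter (fun j => j < i)), ns j ≤ ∑ j, ns j :=
    Finset.sum_le_sum_of_subset (Finset.subset_univ _)
  rw [Finset.sum_insert hins] at h2
  have := a.isLt
  omega

/-- The position, in `Fin n`, of the `a`-th coordinate of the `i`-th block. -/
def blockEmb {n k : ℕ} (ns : Fin k → ℕ) (hsum : (∑ j, ns j) = n) (i : Fin k)
    (a : Fin (ns i)) : Fin n :=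
  ⟨off ns i + (a : ℕ), hsum ▸ off_add_lt ns i a⟩

/-- `g` is block upper triangular with diagonal blocks `G i` (block sizes `ns`). -/
def IsBlockUT {n k : ℕ} (ns : Fin k → ℕ) (hsum : (∑ j, ns j) = n)
    (g : Matrix (Fin n) (Fin n) ℝ) (G : ∀ i, Matrix (Fin (ns i)) (Fin (ns i)) ℝ) : Prop :=
  (∀ (i : Fin k) (a b : Fin (ns i)),
      g (blockEmb ns hsum i a) (blockEmb ns hsum i b) = G i a b) ∧
  (∀ (i j : Fin k) (a : Fin (ns i)) (b : Fin (ns j)), j < i →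
      g (blockEmb ns hsum i a) (blockEmb ns hsum j b) = 0)

/-! ### Mordell constant -/

/-- The symmetric box `[-a₁,a₁] × ⋯ × [-aₙ,aₙ]` is admissible for `L`: its interior contains
no nonzero point of `L`. -/
def IsAdmissibleBox {n : ℕ} (L : AddSubgroup (Fin n → ℝ)) (a : Fin n → ℝ) : Prop :=
  (∀ i, 0 < a i) ∧ ∀ v ∈ L, v ≠ 0 → ∃ i, a i ≤ |v i|

/-- The Mordell constant `κ(L) = 2⁻ⁿ sup { Vol(B) : B admissible symmetric box for L }`. -/
def mordellConst {n : ℕ} (L : AddSubgroup (Fin n → ℝ)) : ℝ :=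
  (1 / 2 ^ n) * sSup {V | ∃ a : Fin n → ℝ, IsAdmissibleBox L a ∧ V = ∏ i, 2 * a i}

/-! ### Hermite constant -/

/-- Length of a shortest nonzero vector of `L`. -/
def shortest {m : ℕ} (L : AddSubgroup (Fin m → ℝ)) : ℝ :=
  sInf {t | ∃ w ∈ L, w ≠ 0 ∧ t = enorm w}

/-- The Hermite constant `γ_m`. -/
def hermiteConst (m : ℕ) : ℝ :=
  sSup {c | ∃ L : AddSubgroup (Fin m → ℝ), IsUnimodularLattice L ∧ c = shortest L ^ 2}

/-! ### Korkine–Zolotarev reduction -/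

/-- `v 0, …, v (n-1)` is a Korkine–Zolotarev reduced basis of `x`: it is a ℤ-basis, and for
each `i` the orthogonal projection of `v i` onto `span(v 0, …, v (i-1))^⊥` is shortest among the
nonzero such projections of vectors of `x` (projection lengths are expressed through Gram
determinants: the projection of `w` has length `gvol (v 0, …, v (i-1), w) / gvol (v 0, …, v (i-1))`). -/
def IsKZBasis {n : ℕ} (x : AddSubgroup (Fin n → ℝ)) (v : ℕ → (Fin n → ℝ)) : Prop :=
  LinearIndependent ℝ (fun j : Fin n => v (j : ℕ)) ∧
  x = AddSubgroup.closure (v '' Set.Iio n) ∧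
  ∀ i < n, ∀ w ∈ x, w ∉ Submodule.span ℝ (v '' Set.Iio i) →
    gvol (Fin.snoc (fun j : Fin i => v (j : ℕ)) (v i)) ≤
      gvol (Fin.snoc (fun j : Fin i => v (j : ℕ)) w)

/-- `A 0, …, A (n-1)` are the diagonal Korkine–Zolotarev coefficients of `x`: the lengths of
the successive orthogonal projections in a KZ reduced basis, i.e.
`A i = gvol (v 0, …, v i) / gvol (v 0, …, v (i-1))`. -/
def HasKZCoeffs {n : ℕ} (x : AddSubgroup (Fin n → ℝ)) (A : ℕ → ℝ) : Prop :=
  ∃ v : ℕ → (Fin n → ℝ), IsKZBasis x v ∧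
    ∀ i < n, A i * gvol (fun j : Fin i => v (j : ℕ)) = gvol (fun j : Fin (i + 1) => v (j : ℕ))

/-! ### Orthogonal complements and projections of lattices -/

/-- The orthogonal complement of a subspace `V ⊆ ℝⁿ`. -/
def orthoC {n : ℕ} (V : Submodule ℝ (Fin n → ℝ)) : Submodule ℝ (Fin n → ℝ) where
  carrier := {w | ∀ v ∈ V, einner w v = 0}
  zero_mem' := by intro v hv; simp [einner]
  add_mem' := by intro a b ha hb v hv; rw [einner_add_left, ha v hv, hb v hv, add_zero]
  smul_mem' := by intro c w hw v hv; rw [einner_smul_left, hw v hv, mul_zero]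

/-- The image `π(x)` of `x` under the orthogonal projection `π : ℝⁿ → V^⊥`:
`p = π(u)` iff `p ⊥ V` and `u - p ∈ V`. -/
def projLat {n : ℕ} (V : Submodule ℝ (Fin n → ℝ)) (x : AddSubgroup (Fin n → ℝ)) :
    AddSubgroup (Fin n → ℝ) where
  carrier := {p | (∀ v ∈ V, einner p v = 0) ∧ ∃ u ∈ x, u - p ∈ V}
  zero_mem' := ⟨by intro v hv; simp [einner], 0, x.zero_mem, by rw [sub_zero]; exact V.zero_mem⟩
  add_mem' := by
    rintro p q ⟨hp1, u1, hu1, hp2⟩ ⟨hq1, u2, hu2, hq2⟩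
    refine ⟨fun v hv => by rw [einner_add_left, hp1 v hv, hq1 v hv, add_zero],
      u1 + u2, x.add_mem hu1 hu2, ?_⟩
    have h : u1 + u2 - (p + q) = u1 - p + (u2 - q) := by abel
    rw [h]; exact V.add_mem hp2 hq2
  neg_mem' := by
    rintro p ⟨hp1, u, hu, hp2⟩
    refine ⟨fun v hv => by rw [einner_neg_left, hp1 v hv, neg_zero],
      -u, x.neg_mem hu, ?_⟩
    have h : -u - -p = -(u - p) := by abel
    rw [h]; exact V.neg_mem hp2

end SW

namespace Brouwer
open MeasureTheory

variable {E : Type*} [NormedAddCommGroup E] [InnerProductSpace ℝ E] [FiniteDimensional ℝ E]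

lemma exists_det_polynomial (A : E →L[ℝ] E) :
    ∃ p : Polynomial ℝ, p.degree < (Module.finrank ℝ E + 1 : ℕ) ∧
      ∀ s : ℝ, p.eval s = (ContinuousLinearMap.id ℝ E + s • A).det := by
  set b := Module.finBasis ℝ E
  set M := LinearMap.toMatrix b b (A : E →ₗ[ℝ] E) with hM
  refine ⟨((Polynomial.X : Polynomial ℝ) • M.map Polynomial.C +
    (1 : Matrix (Fin (Module.finrank ℝ E)) (Fin (Module.finrank ℝ E)) ℝ).map Polynomial.C).det,
    ?_, ?_⟩
  · have h := Polynomial.natDegree_det_X_add_C_le M 1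
    rw [Fintype.card_fin] at h
    refine lt_of_le_of_lt Polynomial.degree_le_natDegree ?_
    exact_mod_cast Nat.lt_succ_of_le h
  · intro s
    have h1 : (ContinuousLinearMap.id ℝ E + s • A).det = (1 + s • M).det := by
      rw [ContinuousLinearMap.det, ← LinearMap.det_toMatrix b]
      congr 1
      simp [hM, ContinuousLinearMap.coe_id]
    rw [h1, ← Polynomial.coe_evalRingHom, RingHom.map_det]
    congr 1
    ext i j
    by_cases hij : i = j <;> simp [Matrix.add_apply, hij] <;> ring

lemma det_pos_of_small {A : E →L[ℝ] E} {K s : ℝ} (hA : ‖A‖ ≤ K) (hs : 0 ≤ s) (hsK : s * K < 1) :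
    0 < (ContinuousLinearMap.id ℝ E + s • A).det := by
  have hne : ∀ t ∈ Set.Icc 0 s, (ContinuousLinearMap.id ℝ E + t • A).det ≠ 0 := by
    intro t ht h0
    rw [ContinuousLinearMap.det] at h0
    have := LinearMap.bot_lt_ker_of_det_eq_zero h0
    obtain ⟨v, hv, hv0⟩ := (Submodule.ne_bot_iff _).1 this.ne'
    have hv' : v + t • A v = 0 := by simpa using hv
    have h1 : ‖v‖ = t * ‖A v‖ := by
      conv_lhs => rw [eq_neg_of_add_eq_zero_left hv', norm_neg, norm_smul, Real.norm_of_nonneg ht.1]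
    have h2 : ‖A v‖ ≤ K * ‖v‖ := (A.le_opNorm v).trans (by gcongr)
    have hvp : 0 < ‖v‖ := norm_pos_iff.2 hv0
    have hK : 0 ≤ K := (norm_nonneg _).trans hA
    have : t * ‖A v‖ ≤ s * (K * ‖v‖) := by
      have := ht.2
      have := ht.1
      gcongr
    nlinarith
  have hcont : ContinuousOn (fun t : ℝ => (ContinuousLinearMap.id ℝ E + t • A).det)
      (Set.Icc 0 s) := by
    have : Continuous (fun t : ℝ => (ContinuousLinearMap.id ℝ E + t • A)) := by fun_prop
    exact (ContinuousLinearMap.continuous_det.comp this).continuousOn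
  by_contra hneg
  have h0 : (ContinuousLinearMap.id ℝ E + (0:ℝ) • A).det = 1 := by
    rw [zero_smul, add_zero]
    exact LinearMap.det_id
  have := intermediate_value_Icc' hs hcont
  obtain ⟨t, ht, ht0⟩ := this (show (0:ℝ) ∈ Set.Icc _ _ from ⟨not_lt.1 hneg, by rw [h0]; norm_num⟩)
  exact hne t ht ht0

/-- There is no `C¹` map of norm `ρ` everywhere fixing the sphere of radius `ρ`. -/
theorem no_retraction [Nontrivial E] {ρ : ℝ} (hρ : 0 < ρ) (r : E → E) (hr : ContDiff ℝ 1 r)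
    (hn : ∀ x, ‖r x‖ = ρ) (hid : ∀ x, ‖x‖ = ρ → r x = x) : False := by
  borelize E
  set h : E → E := fun x => r x - x with hh
  have hhC : ContDiff ℝ 1 h := hr.sub contDiff_id
  have hhd : Differentiable ℝ h := hhC.differentiable (by norm_num)
  have hD : Continuous (fderiv ℝ h) := hhC.continuous_fderiv (by norm_num)
  obtain ⟨K, hK⟩ : ∃ K : ℝ, ∀ x ∈ Metric.closedBall (0:E) ρ, ‖fderiv ℝ h x‖ ≤ K :=
    (isCompact_closedBall (0:E) ρ).exists_bound_of_continuousOn hD.continuousOn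
  have hK0 : 0 ≤ K := (norm_nonneg _).trans (hK 0 (by simp [hρ.le]))
  have hlip1 : ∀ x ∈ Metric.closedBall (0:E) ρ, ∀ y ∈ Metric.closedBall (0:E) ρ,
      ‖h y - h x‖ ≤ K * ‖y - x‖ := fun x hx y hy =>
    Convex.norm_image_sub_le_of_norm_fderiv_le (𝕜 := ℝ) (fun z _ => hhd z) hK
      (convex_closedBall 0 ρ) hx hy
  set H : E → E := fun x => if ‖x‖ ≤ ρ then h x else 0 with hH
  have hHin : ∀ x, ‖x‖ ≤ ρ → H x = h x := fun x hx => by simp [hH, hx]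
  have hHout : ∀ x, ρ ≤ ‖x‖ → H x = 0 := fun x hx => by
    by_cases hx' : ‖x‖ ≤ ρ
    · rw [hHin x hx', hh]
      simp [hid x (le_antisymm hx' hx)]
    · simp [hH, hx']
  have hcross : ∀ x y : E, ‖x‖ ≤ ρ → ρ ≤ ‖y‖ → ‖H x - H y‖ ≤ K * ‖x - y‖ := by
    intro x y hx hy
    have hc : ContinuousOn (fun t : ℝ => ‖x + t • (y - x)‖) (Set.Icc 0 1) := by fun_prop
    obtain ⟨t, ht, hteq⟩ := intermediate_value_Icc (zero_le_one) hc
      (show ρ ∈ Set.Icc _ _ from ⟨by simpa using hx, by simpa using hy⟩)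
    simp only at hteq
    set z := x + t • (y - x)
    have hz : H z = 0 := hHout z hteq.ge
    rw [hHout y hy, ← hz, hHin x hx, hHin z hteq.le]
    refine (hlip1 z (by simp [hteq]) x (by simpa using hx)).trans ?_
    gcongr
    have : x - z = t • (x - y) := by simp only [z, smul_sub]; abel
    rw [this, norm_smul, Real.norm_of_nonneg ht.1]
    exact mul_le_of_le_one_left (norm_nonneg _) ht.2
  have hlip : ∀ x y : E, ‖H x - H y‖ ≤ K * ‖x - y‖ := by
    intro x y
    rcases le_total ‖x‖ ρ with hx | hx <;> rcases le_total ‖y‖ ρ with hy | hy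
    · rw [hHin x hx, hHin y hy]
      exact hlip1 y (by simpa using hy) x (by simpa using hx)
    · exact hcross x y hx hy
    · rw [norm_sub_rev, norm_sub_rev x]
      exact hcross y x hy hx
    · rw [hHout x hx, hHout y hy]
      simp; positivity
  set B := Metric.ball (0:E) ρ with hB
  -- the volume identity for small `s`
  have hvol : ∀ s : ℝ, 0 ≤ s → s * K < 1 →
      IntegrableOn (fun x => (ContinuousLinearMap.id ℝ E + s • fderiv ℝ h x).det) B ∧
      ∫ x in B, (ContinuousLinearMap.id ℝ E + s • fderiv ℝ h x).det = volume.real B := by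
    intro s hs hsK
    set g : E → E := fun x => x + s • H x with hg
    have happ : ApproximatesLinearOn g ((ContinuousLinearEquiv.refl ℝ E : E ≃L[ℝ] E) : E →L[ℝ] E)
        Set.univ (Real.toNNReal (s * K)) := by
      intro x _ y _
      have : g x - g y - ((ContinuousLinearEquiv.refl ℝ E : E ≃L[ℝ] E) : E →L[ℝ] E) (x - y)
          = s • (H x - H y) := by simp [hg, smul_sub]; abel
      rw [this, norm_smul, Real.norm_of_nonneg hs, Real.coe_toNNReal _ (by positivity), mul_assoc]
      gcongr
      exact hlip x y
    have hc : Subsingleton E ∨ Real.toNNReal (s * K) <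
        ‖(((ContinuousLinearEquiv.refl ℝ E : E ≃L[ℝ] E).symm : E ≃L[ℝ] E) : E →L[ℝ] E)‖₊⁻¹ := by
      right
      have : ‖(((ContinuousLinearEquiv.refl ℝ E : E ≃L[ℝ] E).symm : E ≃L[ℝ] E) : E →L[ℝ] E)‖₊
          = 1 := by
        ext
        simp
      rw [this, inv_one]
      rw [← Real.toNNReal_one]
      exact (Real.toNNReal_lt_toNNReal_iff one_pos).2 hsK
    have hbij : Function.Bijective g := by
      have := (happ.toHomeomorph g hc).bijective
      exact this
    have hgout : ∀ x, ρ ≤ ‖x‖ → g x = x := fun x hx => by simp [hg, hHout x hx]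
    have himg : g '' B = B := by
      apply Set.Subset.antisymm
      · rintro _ ⟨x, hx, rfl⟩
        by_contra hcon
        have h1 : ρ ≤ ‖g x‖ := by simpa [hB] using hcon
        have h2 := hbij.1 (hgout _ h1)
        rw [h2] at h1
        have : ‖x‖ < ρ := by simpa [hB] using hx
        linarith
      · intro y hy
        obtain ⟨x, rfl⟩ := hbij.2 y
        refine ⟨x, ?_, rfl⟩
        by_contra hcon
        have h1 : ρ ≤ ‖x‖ := by simpa [hB] using hcon
        rw [hgout x h1] at hy
        exact hcon hy
    have hder : ∀ x ∈ B, HasFDerivWithinAt g (ContinuousLinearMap.id ℝ E + s • fderiv ℝ h x) B x := by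
      intro x hx
      have h1 : HasFDerivAt (fun x => x + s • h x)
          (ContinuousLinearMap.id ℝ E + s • fderiv ℝ h x) x :=
        (hasFDerivAt_id x).add ((hhd x).hasFDerivAt.const_smul s)
      refine h1.hasFDerivWithinAt.congr (fun y hy => ?_) ?_
      · have : ‖y‖ < ρ := by simpa [hB] using hy
        simp [hg, hHin y this.le]
      · have : ‖x‖ < ρ := by simpa [hB] using hx
        simp [hg, hHin x this.le]
    have key := lintegral_abs_det_fderiv_eq_addHaar_image (volume : Measure E)
      Metric.isOpen_ball.measurableSet hder hbij.1.injOn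
    rw [himg] at key
    have hpos : ∀ x ∈ B, 0 < (ContinuousLinearMap.id ℝ E + s • fderiv ℝ h x).det := fun x hx =>
      det_pos_of_small (hK x (Metric.ball_subset_closedBall hx)) hs hsK
    have hcontd : Continuous (fun x => (ContinuousLinearMap.id ℝ E + s • fderiv ℝ h x).det) :=
      ContinuousLinearMap.continuous_det.comp (by fun_prop)
    have hae : 0 ≤ᵐ[volume.restrict B]
        (fun x => (ContinuousLinearMap.id ℝ E + s • fderiv ℝ h x).det) := by
      filter_upwards [ae_restrict_mem Metric.isOpen_ball.measurableSet] with x hx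
      exact (hpos x hx).le
    refine ⟨(hcontd.continuousOn.integrableOn_compact
      (isCompact_closedBall (0:E) ρ)).mono_set Metric.ball_subset_closedBall, ?_⟩
    rw [integral_eq_lintegral_of_nonneg_ae hae hcontd.aestronglyMeasurable, Measure.real, ← key]
    congr 1
    refine lintegral_congr_ae ?_
    filter_upwards [hae] with x hx
    rw [abs_of_nonneg hx]
  -- interpolation
  set N := Module.finrank ℝ E + 1 with hN
  set v : ℕ → ℝ := fun k => k / ((N + 1) * (K + 1)) with hv
  have hvinj : Set.InjOn v (Finset.range N) := by
    intro a _ b _ hab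
    have : ((N:ℝ) + 1) * (K + 1) ≠ 0 := by positivity
    simp only [hv] at hab
    field_simp at hab
    exact_mod_cast hab
  have hvs : ∀ k ∈ Finset.range N, 0 ≤ v k ∧ v k * K < 1 := by
    intro k hk
    have hk' : (k:ℝ) < N := by exact_mod_cast Finset.mem_range.1 hk
    refine ⟨by positivity, ?_⟩
    simp only [hv]
    rw [div_mul_eq_mul_div, div_lt_one (by positivity)]
    have : (0:ℝ) ≤ k := by positivity
    nlinarith
  have hzero : ∀ x, (ContinuousLinearMap.id ℝ E + (1:ℝ) • fderiv ℝ h x).det = 0 := by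
    intro x
    have hrd : DifferentiableAt ℝ r x := (hr.differentiable (by norm_num)) x
    have e1 : ContinuousLinearMap.id ℝ E + (1:ℝ) • fderiv ℝ h x = fderiv ℝ r x := by
      have : fderiv ℝ h x = fderiv ℝ r x - ContinuousLinearMap.id ℝ E := by
        rw [hh, fderiv_fun_sub hrd differentiableAt_fun_id, fderiv_fun_id]
      rw [this]; simp
    rw [e1]
    by_contra hne
    rw [ContinuousLinearMap.det] at hne
    have hsurj : Function.Surjective (fderiv ℝ r x) :=
      (LinearMap.equivOfDetNeZero _ hne).surjective
    obtain ⟨w, hw⟩ := hsurj (r x)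
    have h1 : HasFDerivAt (fun y => inner ℝ (r y) (r y)) _ x :=
      hrd.hasFDerivAt.inner ℝ hrd.hasFDerivAt
    have h2 : (fun y => inner ℝ (r y) (r y)) = fun _ => ρ ^ 2 := by
      ext y; rw [real_inner_self_eq_norm_sq, hn]
    rw [h2] at h1
    have h3 := h1.unique (hasFDerivAt_const (ρ^2) x)
    have h4 := congrArg (fun L => L w) h3
    simp [hw, hn] at h4
    exact hρ.ne' h4
  have hpt : ∀ x, (ContinuousLinearMap.id ℝ E + (1:ℝ) • fderiv ℝ h x).det =
      ∑ k ∈ Finset.range N, (Lagrange.basis (Finset.range N) v k).eval 1 *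
        (ContinuousLinearMap.id ℝ E + v k • fderiv ℝ h x).det := by
    intro x
    obtain ⟨p, hp, hpe⟩ := exists_det_polynomial (fderiv ℝ h x)
    have := Lagrange.eq_interpolate (s := Finset.range N) (f := p) hvinj (by rw [Finset.card_range]; exact hp)
    rw [← hpe 1]
    conv_lhs => rw [this]
    rw [Lagrange.interpolate_apply, Polynomial.eval_finsetSum]
    refine Finset.sum_congr rfl fun k _ => ?_
    rw [Polynomial.eval_mul, Polynomial.eval_C, hpe, mul_comm]
  have hintegral : ∫ x in B, (ContinuousLinearMap.id ℝ E + (1:ℝ) • fderiv ℝ h x).det = volume.real B := by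
    simp_rw [hpt]
    rw [integral_finsetSum]
    · simp_rw [integral_const_mul]
      rw [Finset.sum_congr rfl fun k hk => by rw [(hvol (v k) (hvs k hk).1 (hvs k hk).2).2],
        ← Finset.sum_mul]
      have := congrArg (Polynomial.eval (1:ℝ)) (Lagrange.sum_basis hvinj ⟨0, by simp [hN]⟩)
      rw [Polynomial.eval_finsetSum, Polynomial.eval_one] at this
      rw [this, one_mul]
    · intro k hk
      exact (hvol (v k) (hvs k hk).1 (hvs k hk).2).1.const_mul _
  simp_rw [hzero] at hintegral
  rw [integral_zero] at hintegral
  have hpos : 0 < volume.real B := by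
    rw [Measure.real]
    exact ENNReal.toReal_pos (Metric.measure_ball_pos _ _ hρ).ne' measure_ball_lt_top.ne
  linarith

/-- A continuous vector field on a ball either vanishes somewhere or points inward at some point of
the boundary sphere. -/
theorem exists_zero_or_inward {R : ℝ} (hR : 0 < R) (f : E → E) (hf : Continuous f) :
    ∃ x, ‖x‖ ≤ R ∧ (f x = 0 ∨ (‖x‖ = R ∧ ∃ κ : ℝ, 0 ≤ κ ∧ f x = -κ • x)) := by
  rcases subsingleton_or_nontrivial E with hE | hE
  · exact ⟨0, by simp [hR.le], Or.inl (Subsingleton.elim _ _)⟩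
  by_contra hcon
  push Not at hcon
  -- clipped radial projection
  set τ : E → ℝ := fun x => max 0 (min 1 ((‖x‖ - R) / R)) with hτ
  set F : E → E := fun x => (1 - τ x) • f ((R / max R ‖x‖) • x) + τ x • x with hF
  have hmax : ∀ x : E, max R ‖x‖ ≠ 0 := fun x => (lt_of_lt_of_le hR (le_max_left _ _)).ne'
  have hcq : Continuous fun x : E => (R / max R ‖x‖) • x :=
    (continuous_const.div (continuous_const.max continuous_norm) hmax).smul continuous_id
  have hcτ : Continuous τ := by
    refine continuous_const.max (continuous_const.min ?_)
    exact (continuous_norm.sub continuous_const).div_const _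
  have hFc : Continuous F :=
    ((continuous_const.sub hcτ).smul (hf.comp hcq)).add (hcτ.smul continuous_id)
  have hFout : ∀ x, 2 * R ≤ ‖x‖ → F x = x := by
    intro x hx
    have : τ x = 1 := by
      simp only [hτ]
      rw [min_eq_left, max_eq_right zero_le_one]
      rw [le_div_iff₀ hR]; linarith
    simp [hF, this]
  have hFne : ∀ x, F x ≠ 0 := by
    intro x hx0
    rcases le_or_gt ‖x‖ R with hx | hx
    · have h1 : τ x = 0 := by
        simp only [hτ]
        rw [max_eq_left]
        exact (min_le_right _ _).trans (div_nonpos_of_nonpos_of_nonneg (by linarith) hR.le)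
      have h2 : R / max R ‖x‖ = 1 := by rw [max_eq_left hx, div_self hR.ne']
      simp only [hF, h1, h2] at hx0
      exact (hcon x hx).1 (by simpa using hx0)
    · have hx' : 0 < ‖x‖ := hR.trans hx
      have h2 : R / max R ‖x‖ = R / ‖x‖ := by rw [max_eq_right hx.le]
      set y := (R / ‖x‖) • x with hy
      have hyn : ‖y‖ = R := by
        rw [hy, norm_smul, Real.norm_of_nonneg (by positivity)]; field_simp
      have hxy : x = (‖x‖ / R) • y := by
        rw [hy, smul_smul]
        have : ‖x‖ / R * (R / ‖x‖) = 1 := by field_simp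
        rw [this, one_smul]
      simp only [hF, h2] at hx0
      rw [← hy] at hx0
      have hτ0 : 0 ≤ τ x := le_max_left _ _
      have hτ1 : τ x ≤ 1 := max_le zero_le_one (min_le_left _ _)
      rcases hτ1.lt_or_eq with hlt | heq
      · refine (hcon y hyn.le).2 hyn ((τ x / (1 - τ x)) * (‖x‖ / R)) ?_ ?_
        · have : 0 < 1 - τ x := by linarith
          positivity
        · have hne : 1 - τ x ≠ 0 := by linarith
          have h3 : (1 - τ x) • f y = - (τ x • x) := eq_neg_of_add_eq_zero_left hx0
          have h4 : f y = (1 - τ x)⁻¹ • ((1 - τ x) • f y) := by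
            rw [smul_smul, inv_mul_cancel₀ hne, one_smul]
          have h5 : τ x • x = (τ x * (‖x‖ / R)) • y := by
            rw [mul_smul, ← hxy]
          rw [h4, h3, h5, ← neg_smul, smul_smul]
          congr 1
          rw [div_eq_inv_mul]
          ring
      · rw [heq] at hx0
        simp at hx0
        rw [hx0] at hx'
        simp at hx'
  obtain ⟨G, hGC, hGa, hGe, -⟩ := hFc.exists_contDiff_approx_and_eqOn 1
    (ε := fun x => ‖F x‖) (continuous_norm.comp hFc) (fun x => norm_pos_iff.2 (hFne x))
    (S := {x | 3 * R ≤ ‖x‖}) (U := {x | 2 * R < ‖x‖})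
    (isClosed_le continuous_const continuous_norm)
    (by
      rw [(isOpen_lt continuous_const continuous_norm).mem_nhdsSet]
      intro x hx
      simp only [Set.mem_ofPred_eq] at hx ⊢
      linarith)
    (contDiffOn_id.congr fun x hx => hFout x (le_of_lt hx))
  have hGne : ∀ x, G x ≠ 0 := by
    intro x h0
    have := hGa x
    rw [h0, dist_zero_left] at this
    exact lt_irrefl _ this
  refine no_retraction (ρ := 3 * R) (by positivity) (fun x => (3 * R / ‖G x‖) • G x) ?_ ?_ ?_
  · have h1 : ContDiff ℝ 1 fun x => ‖G x‖ := hGC.norm ℝ hGne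
    exact (contDiff_const.div h1 fun x => norm_ne_zero_iff.2 (hGne x)).smul hGC
  · intro x
    have := norm_pos_iff.2 (hGne x)
    rw [norm_smul, Real.norm_of_nonneg (by positivity)]
    field_simp
  · intro x hx
    have : G x = x := by
      rw [hGe (show x ∈ {x : E | 3 * R ≤ ‖x‖} from hx.ge)]
      exact hFout x (by linarith)
    simp only [this, hx]
    rw [div_self (by positivity), one_smul]

end Brouwer

namespace SW
set_option linter.unusedSectionVars false

section Gram
variable {m k l a b c : Type*} [Fintype m] [Fintype k] [DecidableEq k] [Fintype l] [DecidableEq l]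
  [Fintype a] [DecidableEq a] [Fintype b] [DecidableEq b] [Fintype c] [DecidableEq c]

/-- The Gram determinant of the columns of `X`. -/
def gramDet (X : Matrix m k ℝ) : ℝ := (Xᵀ * X).det

lemma posSemidef_transpose_mul_self (X : Matrix m k ℝ) : (Xᵀ * X).PosSemidef := by
  simpa [Matrix.conjTranspose_eq_transpose_of_trivial] using
    Matrix.posSemidef_conjTranspose_mul_self X

lemma gramDet_nonneg (X : Matrix m k ℝ) : 0 ≤ gramDet X :=
  (posSemidef_transpose_mul_self X).det_nonneg

lemma gramDet_posDef {X : Matrix m k ℝ} (h : gramDet X ≠ 0) : (Xᵀ * X).PosDef :=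
  (posSemidef_transpose_mul_self X).posDef_iff_det_ne_zero.2 h

lemma gramDet_eq_zero_iff (X : Matrix m k ℝ) :
    gramDet X = 0 ↔ ∃ v : k → ℝ, v ≠ 0 ∧ X *ᵥ v = 0 := by
  rw [gramDet, ← Matrix.exists_mulVec_eq_zero_iff]
  constructor
  · rintro ⟨v, hv, h⟩
    refine ⟨v, hv, ?_⟩
    rw [← dotProduct_self_eq_zero, Matrix.dotProduct_mulVec, ← Matrix.mulVec_transpose,
      Matrix.mulVec_mulVec, h, zero_dotProduct]
  · rintro ⟨v, hv, h⟩
    exact ⟨v, hv, by rw [← Matrix.mulVec_mulVec, h, Matrix.mulVec_zero]⟩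

lemma gramDet_ne_zero_iff_linearIndependent (X : Matrix m k ℝ) :
    gramDet X ≠ 0 ↔ LinearIndependent ℝ X.col := by
  rw [Ne, gramDet_eq_zero_iff, ← Matrix.mulVec_injective_iff,
    ← Matrix.coe_mulVecLin, ← LinearMap.ker_eq_bot, LinearMap.ker_eq_bot']
  push Not
  exact ⟨fun h v hv => by_contra fun hne => h v hne hv, fun h v hne hv => hne (h v hv)⟩

lemma gramDet_mul (X : Matrix m k ℝ) (U : Matrix k k ℝ) :
    gramDet (X * U) = gramDet X * U.det ^ 2 := by
  rw [gramDet, Matrix.transpose_mul, Matrix.mul_assoc, ← Matrix.mul_assoc Xᵀ, Matrix.det_mul,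
    Matrix.det_mul, Matrix.det_transpose, gramDet]
  ring

lemma gramDet_submatrix_col (X : Matrix m k ℝ) (e : l ≃ k) :
    gramDet (X.submatrix id e) = gramDet X := by
  have : (X.submatrix id e)ᵀ * X.submatrix id e = (Xᵀ * X).submatrix e e := by
    ext i j; simp [Matrix.mul_apply]
  rw [gramDet, this, Matrix.det_submatrix_equiv_self, gramDet]

lemma gramDet_square (X : Matrix k k ℝ) : gramDet X = X.det ^ 2 := by
  rw [gramDet, Matrix.det_mul, Matrix.det_transpose, sq]

lemma gramDet_mul_left_of_orthogonal [DecidableEq m] {O : Matrix l m ℝ} (hO : Oᵀ * O = 1)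
    (X : Matrix m k ℝ) : gramDet (O * X) = gramDet X := by
  rw [gramDet, Matrix.transpose_mul, Matrix.mul_assoc, ← Matrix.mul_assoc Oᵀ, hO, Matrix.one_mul,
    gramDet]

lemma one_le_det_one_add {Z : Matrix k k ℝ} (hZ : Z.PosSemidef) : 1 ≤ (1 + Z).det := by
  have h := congrArg (Polynomial.eval (-1 : ℝ)) hZ.isHermitian.charpoly_eq
  rw [Matrix.eval_charpoly, Polynomial.eval_prod] at h
  have h1 : Matrix.scalar k (-1 : ℝ) - Z = -(1 + Z) := by
    ext i j
    by_cases hij : i = j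
    · simp [Matrix.sub_apply, Matrix.add_apply, hij]
      ring
    · simp [Matrix.sub_apply, Matrix.add_apply, hij]
  rw [h1, Matrix.det_neg] at h
  have h2 : ∏ i, Polynomial.eval (-1 : ℝ)
      (Polynomial.X - Polynomial.C ((hZ.isHermitian.eigenvalues i : ℝ) : ℝ)) =
      (-1) ^ Fintype.card k * ∏ i, (1 + hZ.isHermitian.eigenvalues i) := by
    rw [← Finset.card_univ, ← Finset.prod_const, ← Finset.prod_mul_distrib]
    refine Finset.prod_congr rfl fun i _ => ?_
    simp; ring
  have h3 : (1 + Z).det = ∏ i, (1 + hZ.isHermitian.eigenvalues i) := by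
    have h4 := h.trans h2
    exact mul_left_cancel₀ (pow_ne_zero _ (by norm_num)) h4
  rw [h3]
  calc (1 : ℝ) = ∏ _i : k, (1 : ℝ) := by simp
    _ ≤ _ := Finset.prod_le_prod (fun _ _ => zero_le_one) fun i _ => by
      have := hZ.eigenvalues_nonneg i
      linarith

lemma det_le_det_add_gram {G : Matrix k k ℝ} (hG : G.PosDef) (Y : Matrix m k ℝ) :
    G.det ≤ (G + Yᵀ * Y).det := by
  classical
  have hu : IsUnit G.det := hG.det_pos.ne'.isUnit
  have h1 : G + Yᵀ * Y = G * (1 + (G⁻¹ * Yᵀ) * Y) := by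
    rw [Matrix.mul_add, Matrix.mul_one, ← Matrix.mul_assoc, ← Matrix.mul_assoc,
      Matrix.mul_nonsing_inv _ hu, Matrix.one_mul]
  rw [h1, Matrix.det_mul, Matrix.det_one_add_mul_comm]
  have h2 : (Y * (G⁻¹ * Yᵀ)).PosSemidef := by
    have := hG.inv.posSemidef.conjTranspose_mul_mul_same Yᵀ
    rw [Matrix.conjTranspose_eq_transpose_of_trivial, Matrix.transpose_transpose,
      Matrix.mul_assoc] at this
    exact this
  exact le_mul_of_one_le_right hG.det_pos.le (one_le_det_one_add h2)

lemma gramDet_le_det_add (X : Matrix l k ℝ) (Y : Matrix m k ℝ) :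
    gramDet X ≤ (Xᵀ * X + Yᵀ * Y).det := by
  by_cases h : gramDet X = 0
  · rw [h]
    exact ((posSemidef_transpose_mul_self X).add (posSemidef_transpose_mul_self Y)).det_nonneg
  · exact det_le_det_add_gram (gramDet_posDef h) Y

/-- Orthogonal projection away from the columns of `W`. -/
def projAway [DecidableEq m] (W : Matrix m c ℝ) : Matrix m m ℝ := 1 - W * (Wᵀ * W)⁻¹ * Wᵀ

lemma projAway_gram [DecidableEq m] {W : Matrix m c ℝ} (hW : gramDet W ≠ 0) :
    (projAway W)ᵀ * projAway W = projAway W := by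
  have hu : IsUnit (Wᵀ * W).det := (show (Wᵀ * W).det ≠ 0 from hW).isUnit
  have ht : (projAway W)ᵀ = projAway W := by
    simp [projAway, Matrix.transpose_mul, Matrix.transpose_nonsing_inv, Matrix.mul_assoc]
  have h1 : (W * (Wᵀ * W)⁻¹ * Wᵀ) * (W * (Wᵀ * W)⁻¹ * Wᵀ) = W * (Wᵀ * W)⁻¹ * Wᵀ := by
    calc _ = W * (((Wᵀ * W)⁻¹ * (Wᵀ * W)) * (Wᵀ * W)⁻¹) * Wᵀ := by
          simp only [Matrix.mul_assoc]
      _ = _ := by rw [Matrix.nonsing_inv_mul _ hu, Matrix.one_mul]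
  rw [ht]
  unfold projAway
  rw [Matrix.sub_mul, Matrix.mul_sub, Matrix.mul_sub, h1]
  simp

lemma gramDet_fromCols [DecidableEq m] {W : Matrix m c ℝ} (hW : gramDet W ≠ 0) (A : Matrix m a ℝ) :
    gramDet (Matrix.fromCols W A) = gramDet W * gramDet (projAway W * A) := by
  have hu : IsUnit (Wᵀ * W).det := (show (Wᵀ * W).det ≠ 0 from hW).isUnit
  let _ : Invertible (Wᵀ * W) := Matrix.invertibleOfIsUnitDet _ hu
  rw [gramDet, Matrix.transpose_fromCols, Matrix.fromRows_mul_fromCols, Matrix.det_fromBlocks₁₁]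
  have : (projAway W * A)ᵀ * (projAway W * A) = Aᵀ * A - Aᵀ * W * ⅟(Wᵀ * W) * (Wᵀ * A) := by
    rw [Matrix.transpose_mul, Matrix.mul_assoc, ← Matrix.mul_assoc _ _ A, projAway_gram hW, projAway,
      Matrix.invOf_eq_nonsing_inv, Matrix.sub_mul, Matrix.mul_sub, Matrix.one_mul]
    simp only [Matrix.mul_assoc]
  rw [← this, gramDet, gramDet]

lemma gramDet_projAway_le [DecidableEq m] {W : Matrix m c ℝ} (hW : gramDet W ≠ 0)
    (A : Matrix m a ℝ) : gramDet (projAway W * A) ≤ gramDet A := by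
  have hu : IsUnit (Wᵀ * W).det := (show (Wᵀ * W).det ≠ 0 from hW).isUnit
  have h1 : (1 - projAway W)ᵀ * (1 - projAway W) = 1 - projAway W := by
    have ht : (projAway W)ᵀ = projAway W := by
      simp [projAway, Matrix.transpose_mul, Matrix.transpose_nonsing_inv, Matrix.mul_assoc]
    have h2 := projAway_gram hW
    rw [ht] at h2
    rw [Matrix.transpose_sub, Matrix.transpose_one, ht, Matrix.sub_mul, Matrix.mul_sub,
      Matrix.mul_sub, h2]
    simp
  refine (gramDet_le_det_add (projAway W * A) ((1 - projAway W) * A)).trans_eq ?_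
  rw [gramDet]
  congr 1
  rw [Matrix.transpose_mul, Matrix.transpose_mul, Matrix.mul_assoc, ← Matrix.mul_assoc _ _ A,
    projAway_gram hW, Matrix.mul_assoc, ← Matrix.mul_assoc _ (1 - projAway W) A, h1,
    ← Matrix.mul_add, ← Matrix.add_mul]
  simp

lemma gramDet_fromCols_eq_zero {W : Matrix m c ℝ} (hW : gramDet W = 0) (A : Matrix m a ℝ) :
    gramDet (Matrix.fromCols W A) = 0 := by
  rw [gramDet_eq_zero_iff] at hW ⊢
  obtain ⟨v, hv, h⟩ := hW
  refine ⟨Sum.elim v 0, fun h0 => hv ?_, ?_⟩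
  · ext i
    simpa using congrFun h0 (Sum.inl i)
  · rw [Matrix.fromCols_mulVec]
    simp [Function.comp_def, h]
    ext i; simp [Matrix.mulVec, dotProduct]

/-- Fischer's inequality. -/
lemma gramDet_fromCols_le (A : Matrix m a ℝ) (B : Matrix m b ℝ) :
    gramDet (Matrix.fromCols A B) ≤ gramDet A * gramDet B := by
  classical
  by_cases h : gramDet A = 0
  · rw [gramDet_fromCols_eq_zero h, h, zero_mul]
  · rw [gramDet_fromCols h]
    exact mul_le_mul_of_nonneg_left (gramDet_projAway_le h B) (gramDet_nonneg A)

/-- Koteljanskii's inequality for Gram determinants. -/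
lemma gramDet_submodular (W : Matrix m c ℝ) (A : Matrix m a ℝ) (B : Matrix m b ℝ) :
    gramDet W * gramDet (Matrix.fromCols W (Matrix.fromCols A B)) ≤
      gramDet (Matrix.fromCols W A) * gramDet (Matrix.fromCols W B) := by
  classical
  by_cases h : gramDet W = 0
  · rw [h, zero_mul]
    exact mul_nonneg (gramDet_nonneg _) (gramDet_nonneg _)
  · rw [gramDet_fromCols h, gramDet_fromCols h, gramDet_fromCols h, Matrix.mul_fromCols]
    have := gramDet_fromCols_le (projAway W * A) (projAway W * B)
    have h0 := gramDet_nonneg W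
    calc _ = gramDet W * gramDet W * gramDet ((projAway W * A).fromCols (projAway W * B)) := by ring
      _ ≤ gramDet W * gramDet W * (gramDet (projAway W * A) * gramDet (projAway W * B)) := by gcongr
      _ = _ := by ring

/-- The maximal minor of `X` with rows selected by `f`. -/
def minor {R : Type*} [CommRing R] (X : Matrix m k R) (f : k → m) : R := (X.submatrix f id).det

lemma det_mul_expand {R : Type*} [CommRing R] (A : Matrix k m R) (Y : Matrix m k R) :
    (A * Y).det = ∑ f : k → m, (∏ i, A i (f i)) * minor Y f := by
  classical
  have h := (Matrix.detRowAlternating (n := k) (R := R)).toMultilinearMap.map_sum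
    (fun (i : k) (j : m) => A i j • Y j)
  have h1 : (fun i => ∑ j, A i j • Y j) = A * Y := by
    ext i x
    simp [Matrix.mul_apply]
  rw [h1] at h
  refine h.trans (Finset.sum_congr rfl fun f _ => ?_)
  exact (Matrix.detRowAlternating (n := k) (R := R)).toMultilinearMap.map_smul_univ _ _

lemma minor_mul_expand {R : Type*} [CommRing R] (A : Matrix l m R) (Y : Matrix m k R) (J : k → l) :
    minor (A * Y) J = ∑ f : k → m, (∏ i, A (J i) (f i)) * minor Y f := by
  rw [minor, show (A * Y).submatrix J id = A.submatrix J id * Y from rfl, det_mul_expand]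
  rfl

lemma exists_minor_ne_zero {X : Matrix m k ℝ} (h : gramDet X ≠ 0) : ∃ f, minor X f ≠ 0 := by
  by_contra hcon
  push Not at hcon
  refine h ?_
  rw [gramDet, det_mul_expand]
  simp [hcon]

lemma minor_sq_le (X : Matrix m k ℝ) (f : k → m) : minor X f ^ 2 ≤ gramDet X := by
  classical
  by_cases hf : Function.Injective f
  · rw [minor, ← gramDet_square]
    set Y : Matrix {i // i ∉ Set.range f} k ℝ := X.submatrix Subtype.val id
    refine (gramDet_le_det_add (X.submatrix f id) Y).trans_eq ?_
    rw [gramDet]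
    congr 1
    ext s t
    simp only [Matrix.add_apply, Matrix.mul_apply, Matrix.transpose_apply, Matrix.submatrix_apply, id,
      Y]
    rw [← Fintype.sum_subtype_add_sum_subtype (fun i => i ∈ Set.range f)
      (fun i => X i s * X i t)]
    congr 1
    convert (Equiv.ofInjective f hf).sum_comp (fun i : Set.range f => X i s * X i t) <;> rfl
  · have : minor X f = 0 := by
      rw [Function.not_injective_iff] at hf
      obtain ⟨i, j, hij, hne⟩ := hf
      refine Matrix.det_zero_of_row_eq hne ?_
      ext x
      simp [hij]
    rw [this]
    simpa using gramDet_nonneg X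

lemma minor_diagonal_mul [DecidableEq m] (d : m → ℝ) (X : Matrix m k ℝ) (f : k → m) :
    minor (Matrix.diagonal d * X) f = (∏ i, d (f i)) * minor X f := by
  have : (Matrix.diagonal d * X).submatrix f id = Matrix.diagonal (d ∘ f) * X.submatrix f id := by
    ext i j
    simp [Matrix.diagonal_mul]
  rw [minor, this, Matrix.det_mul, Matrix.det_diagonal, minor]
  rfl

end Gram

section Integer
variable {ι k l : Type*} [Fintype ι] [DecidableEq ι] [Fintype k] [DecidableEq k] [Fintype l]
  [DecidableEq l]

/-- An integer matrix viewed as a real matrix. -/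
abbrev castM {ι k : Type*} (M : Matrix ι k ℤ) : Matrix ι k ℝ := M.map (Int.cast : ℤ → ℝ)

/-- An integer vector viewed as a real vector. -/
abbrev castV {ι : Type*} (v : ι → ℤ) : ι → ℝ := fun i => (v i : ℝ)

lemma castM_mulVec (M : Matrix ι k ℤ) (v : k → ℤ) : castM M *ᵥ castV v = castV (M *ᵥ v) := by
  ext i
  simp [Matrix.mulVec, dotProduct, castV]

lemma castM_mul (M : Matrix ι k ℤ) (U : Matrix k l ℤ) : castM (M * U) = castM M * castM U := by
  ext i j
  simp [Matrix.mul_apply]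

lemma castM_det (U : Matrix k k ℤ) : (castM U).det = (U.det : ℝ) := by
  rw [Int.cast_det]

lemma castM_minor (M : Matrix ι k ℤ) (f : k → ι) : minor (castM M) f = ((minor M f : ℤ) : ℝ) := by
  rw [minor, minor, ← castM_det]; rfl

lemma castV_injective : Function.Injective (castV : (ι → ℤ) → ι → ℝ) := fun v w h => by
  ext i
  exact_mod_cast congrFun h i

lemma gramDet_castM_eq_zero_iff (M : Matrix ι k ℤ) :
    gramDet (castM M) = 0 ↔ ∃ v : k → ℤ, v ≠ 0 ∧ M *ᵥ v = 0 := by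
  constructor
  · intro h
    have h1 : gramDet (castM M) = ((Mᵀ * M).det : ℝ) := by
      rw [← castM_det, gramDet, castM_mul]; rfl
    rw [h1] at h
    have h2 : (Mᵀ * M).det = 0 := by exact_mod_cast h
    obtain ⟨v, hv, h3⟩ := Matrix.exists_mulVec_eq_zero_iff.2 h2
    refine ⟨v, hv, ?_⟩
    rw [← dotProduct_self_eq_zero, Matrix.dotProduct_mulVec, ← Matrix.mulVec_transpose,
      Matrix.mulVec_mulVec, h3, zero_dotProduct]
  · rintro ⟨v, hv, h⟩
    rw [gramDet_eq_zero_iff]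
    refine ⟨castV v, fun h0 => hv (castV_injective ?_), ?_⟩
    · rw [h0]; ext; simp [castV]
    · rw [castM_mulVec, h]; ext; simp [castV]

lemma gramDet_mul_left_eq_zero_iff {g : Matrix ι ι ℝ} (hg : g.det ≠ 0) (X : Matrix ι k ℝ) :
    gramDet (g * X) = 0 ↔ gramDet X = 0 := by
  rw [gramDet_eq_zero_iff, gramDet_eq_zero_iff]
  refine exists_congr fun v => and_congr_right fun _ => ?_
  rw [← Matrix.mulVec_mulVec]
  refine ⟨fun h => Matrix.eq_zero_of_mulVec_eq_zero hg h, fun h => by rw [h, Matrix.mulVec_zero]⟩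

/-- The columns of `M` form a `ℤ`-basis of `N`. -/
def IsBasisMat (M : Matrix ι k ℤ) (N : Submodule ℤ (ι → ℤ)) : Prop :=
  Function.Injective M.mulVec ∧ ∀ x, x ∈ N ↔ ∃ v, M *ᵥ v = x

lemma IsBasisMat.gramDet_ne_zero {M : Matrix ι k ℤ} {N : Submodule ℤ (ι → ℤ)}
    (h : IsBasisMat M N) : gramDet (castM M) ≠ 0 := by
  rw [Ne, gramDet_castM_eq_zero_iff]
  rintro ⟨v, hv, h0⟩
  exact hv (h.1 (by rw [h0, Matrix.mulVec_zero]))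

lemma IsBasisMat.col_mem {M : Matrix ι k ℤ} {N : Submodule ℤ (ι → ℤ)}
    (h : IsBasisMat M N) (j : k) : (fun i => M i j) ∈ N :=
  (h.2 _).2 ⟨Pi.single j 1, by simp; rfl⟩

/-- The equivalence given by a basis matrix. -/
def IsBasisMat.equiv {M : Matrix ι k ℤ} {N : Submodule ℤ (ι → ℤ)} (h : IsBasisMat M N) :
    (k → ℤ) ≃ₗ[ℤ] N :=
  LinearEquiv.ofBijective (M.mulVecLin.codRestrict N fun v => (h.2 _).2 ⟨v, rfl⟩)
    ⟨fun v w hvw => h.1 (congrArg Subtype.val hvw), fun ⟨x, hx⟩ => by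
      obtain ⟨v, hv⟩ := (h.2 x).1 hx
      exact ⟨v, Subtype.ext hv⟩⟩

lemma IsBasisMat.finrank_eq {M : Matrix ι k ℤ} {N : Submodule ℤ (ι → ℤ)} (h : IsBasisMat M N) :
    Module.finrank ℤ N = Fintype.card k := by
  rw [← h.equiv.finrank_eq, Module.finrank_fintype_fun_eq_card]

/-- A chosen basis matrix of a submodule of `ℤ^ι`. -/
def basisMat (N : Submodule ℤ (ι → ℤ)) : Matrix ι (Fin (Module.finrank ℤ N)) ℤ :=
  fun i j => (Module.finBasis ℤ N j : ι → ℤ) i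

lemma basisMat_mulVec (N : Submodule ℤ (ι → ℤ)) (v : Fin (Module.finrank ℤ N) → ℤ) :
    basisMat N *ᵥ v = (((Module.finBasis ℤ N).equivFun.symm v : N) : ι → ℤ) := by
  ext i
  rw [Module.Basis.equivFun_symm_apply]
  simp [Matrix.mulVec, dotProduct, basisMat, Finset.sum_apply, mul_comm]

lemma isBasisMat_basisMat (N : Submodule ℤ (ι → ℤ)) : IsBasisMat (basisMat N) N := by
  refine ⟨fun v w h => ?_, fun x => ⟨fun hx => ?_, ?_⟩⟩
  · simp only [basisMat_mulVec] at h
    exact (Module.finBasis ℤ N).equivFun.symm.injective (Subtype.ext h)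
  · refine ⟨(Module.finBasis ℤ N).equivFun ⟨x, hx⟩, ?_⟩
    rw [basisMat_mulVec, LinearEquiv.symm_apply_apply]
  · rintro ⟨v, rfl⟩
    rw [basisMat_mulVec]
    exact Subtype.prop _

lemma exists_mul_of_col_mem {M : Matrix ι k ℤ} {N : Submodule ℤ (ι → ℤ)} (h : IsBasisMat M N)
    (X : Matrix ι l ℤ) (hX : ∀ j, (fun i => X i j) ∈ N) : ∃ U : Matrix k l ℤ, X = M * U := by
  choose u hu using fun j => (h.2 _).1 (hX j)
  refine ⟨fun i j => u j i, ?_⟩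
  ext i j
  exact (congrFun (hu j) i).symm

lemma IsBasisMat.gramDet_eq {M : Matrix ι k ℤ} {M' : Matrix ι l ℤ} {N : Submodule ℤ (ι → ℤ)}
    (h : IsBasisMat M N) (h' : IsBasisMat M' N) {ρ : Type*} [Fintype ρ] (g : Matrix ρ ι ℝ) :
    gramDet (g * castM M) = gramDet (g * castM M') := by
  have hcard : Fintype.card k = Fintype.card l := h.finrank_eq.symm.trans h'.finrank_eq
  let e : k ≃ l := Fintype.equivOfCardEq hcard
  set M2 : Matrix ι k ℤ := M'.submatrix id e
  have e1 : gramDet (g * castM M') = gramDet (g * castM M2) := by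
    rw [← gramDet_submatrix_col (g * castM M') e]
    congr 1
  have h2 : IsBasisMat M2 N := by
    have hmv : ∀ v, M2 *ᵥ v = M' *ᵥ (v ∘ e.symm) := by
      intro v
      ext i
      simp only [Matrix.mulVec, dotProduct, M2, Matrix.submatrix_apply, id, Function.comp]
      rw [← e.sum_comp]
      simp
    refine ⟨fun v w hvw => ?_, fun x => ?_⟩
    · simp only [hmv] at hvw
      have := h'.1 hvw
      ext i
      simpa using congrFun this (e i)
    · rw [h'.2 x]
      constructor
      · rintro ⟨v, hv⟩
        exact ⟨v ∘ e, by rw [hmv, ← hv]; congr 1; ext; simp⟩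
      · rintro ⟨v, hv⟩
        exact ⟨_, (hmv v).symm.trans hv⟩
  rw [e1]
  obtain ⟨U, hU⟩ := exists_mul_of_col_mem h2 M h.col_mem
  obtain ⟨U', hU'⟩ := exists_mul_of_col_mem h M2 h2.col_mem
  have hUU : U' * U = 1 := by
    have h3 : M * (U' * U) = M := by rw [← Matrix.mul_assoc, ← hU', ← hU]
    apply Matrix.ext_of_mulVec_single
    intro i
    apply h.1
    rw [Matrix.mulVec_mulVec, h3, Matrix.one_mulVec]
  have hdet : U.det ^ 2 = 1 := by
    have h4 := congrArg Matrix.det hUU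
    rw [Matrix.det_mul, Matrix.det_one] at h4
    rcases Int.isUnit_iff.1 (IsUnit.of_mul_eq_one_right _ h4) with h5 | h5 <;> rw [h5] <;> norm_num
  rw [hU, castM_mul, ← Matrix.mul_assoc, gramDet_mul, castM_det]
  have : ((U.det : ℝ)) ^ 2 = 1 := by exact_mod_cast hdet
  rw [this, mul_one]

/-- Squared covolume of `g N`. -/
def covolSq {ρ : Type*} [Fintype ρ] (g : Matrix ρ ι ℝ) (N : Submodule ℤ (ι → ℤ)) : ℝ :=
  gramDet (g * castM (basisMat N))

lemma IsBasisMat.covolSq_eq {M : Matrix ι k ℤ} {N : Submodule ℤ (ι → ℤ)} (h : IsBasisMat M N)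
    {ρ : Type*} [Fintype ρ] (g : Matrix ρ ι ℝ) : covolSq g N = gramDet (g * castM M) :=
  (isBasisMat_basisMat N).gramDet_eq h g

lemma covolSq_nonneg (g : Matrix ι ι ℝ) (N : Submodule ℤ (ι → ℤ)) : 0 ≤ covolSq g N :=
  gramDet_nonneg _

lemma covolSq_pos {g : Matrix ι ι ℝ} (hg : g.det ≠ 0) (N : Submodule ℤ (ι → ℤ)) :
    0 < covolSq g N := by
  refine lt_of_le_of_ne (covolSq_nonneg g N) (Ne.symm ?_)
  rw [covolSq, Ne, gramDet_mul_left_eq_zero_iff hg]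
  exact (isBasisMat_basisMat N).gramDet_ne_zero

/-- The integer points of a real subspace. -/
def intPart (V : Submodule ℝ (ι → ℝ)) : Submodule ℤ (ι → ℤ) where
  carrier := {v | castV v ∈ V}
  zero_mem' := by
    have : castV (0 : ι → ℤ) = 0 := by ext; simp [castV]
    change castV (0 : ι → ℤ) ∈ V
    rw [this]; exact V.zero_mem
  add_mem' := by
    intro a b ha hb
    have : castV (a + b) = castV a + castV b := by ext; simp [castV]
    change castV (a + b) ∈ V
    rw [this]; exact V.add_mem ha hb
  smul_mem' := by
    intro c a ha
    have : castV (c • a) = (c : ℝ) • castV a := by ext; simp [castV]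
    change castV (c • a) ∈ V
    rw [this]; exact V.smul_mem _ ha

lemma mem_intPart {V : Submodule ℝ (ι → ℝ)} {v : ι → ℤ} : v ∈ intPart V ↔ castV v ∈ V := Iff.rfl

/-- The real span of a submodule of `ℤ^ι`. -/
def realSpan (N : Submodule ℤ (ι → ℤ)) : Submodule ℝ (ι → ℝ) :=
  Submodule.span ℝ (castV '' (N : Set (ι → ℤ)))

/-- Saturated (primitive) submodules of `ℤ^ι`. -/
def Saturated (N : Submodule ℤ (ι → ℤ)) : Prop := ∀ (a : ℤ) (v : ι → ℤ), a ≠ 0 → a • v ∈ N → v ∈ N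

lemma saturated_intPart (V : Submodule ℝ (ι → ℝ)) : Saturated (intPart V) := by
  intro a v ha hv
  rw [mem_intPart] at hv ⊢
  have h : castV (a • v) = (a : ℝ) • castV v := by ext; simp [castV]
  rw [h] at hv
  exact (V.smul_mem_iff (by exact_mod_cast ha)).1 hv

lemma IsBasisMat.realSpan_eq {M : Matrix ι k ℤ} {N : Submodule ℤ (ι → ℤ)} (h : IsBasisMat M N) :
    realSpan N = LinearMap.range (castM M).mulVecLin := by
  apply le_antisymm
  · rw [realSpan, Submodule.span_le]
    rintro _ ⟨x, hx, rfl⟩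
    obtain ⟨v, rfl⟩ := (h.2 x).1 hx
    exact ⟨castV v, castM_mulVec M v⟩
  · rintro _ ⟨v, rfl⟩
    rw [Matrix.mulVecLin_apply, Matrix.mulVec_eq_sum]
    refine Submodule.sum_mem _ fun j _ => ?_
    rw [op_smul_eq_smul]
    refine Submodule.smul_mem _ _ (Submodule.subset_span ⟨_, h.col_mem j, ?_⟩)
    ext i; rfl

lemma IsBasisMat.mulVec_injective {M : Matrix ι k ℤ} {N : Submodule ℤ (ι → ℤ)}
    (h : IsBasisMat M N) : Function.Injective (castM M).mulVec :=
  Matrix.mulVec_injective_iff.2 ((gramDet_ne_zero_iff_linearIndependent _).1 h.gramDet_ne_zero)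

lemma finrank_realSpan (N : Submodule ℤ (ι → ℤ)) :
    Module.finrank ℝ (realSpan N) = Module.finrank ℤ N := by
  rw [(isBasisMat_basisMat N).realSpan_eq, LinearMap.finrank_range_of_inj]
  · simp
  · exact (isBasisMat_basisMat N).mulVec_injective

lemma le_intPart_realSpan (N : Submodule ℤ (ι → ℤ)) : N ≤ intPart (realSpan N) :=
  fun v hv => Submodule.subset_span ⟨v, hv, rfl⟩

lemma realSpan_mono {N N' : Submodule ℤ (ι → ℤ)} (h : N ≤ N') : realSpan N ≤ realSpan N' :=
  Submodule.span_mono (Set.image_mono h)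

lemma realSpan_intPart_le (V : Submodule ℝ (ι → ℝ)) : realSpan (intPart V) ≤ V := by
  rw [realSpan, Submodule.span_le]
  rintro _ ⟨x, hx, rfl⟩
  exact hx

/-- Saturation of a submodule. -/
def sat (N : Submodule ℤ (ι → ℤ)) : Submodule ℤ (ι → ℤ) := intPart (realSpan N)

lemma saturated_sat (N : Submodule ℤ (ι → ℤ)) : Saturated (sat N) := saturated_intPart _

lemma le_sat (N : Submodule ℤ (ι → ℤ)) : N ≤ sat N := le_intPart_realSpan N

lemma realSpan_sat (N : Submodule ℤ (ι → ℤ)) : realSpan (sat N) = realSpan N :=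
  le_antisymm (realSpan_intPart_le _) (realSpan_mono (le_sat N))

lemma finrank_sat (N : Submodule ℤ (ι → ℤ)) :
    Module.finrank ℤ (sat N) = Module.finrank ℤ N := by
  rw [← finrank_realSpan, realSpan_sat, finrank_realSpan]

lemma Saturated.sat_eq {N : Submodule ℤ (ι → ℤ)} (hN : Saturated N) : sat N = N := by
  refine le_antisymm (fun x hx => ?_) (le_sat N)
  set M := basisMat N
  have hM : IsBasisMat M N := isBasisMat_basisMat N
  have hx' : castV x ∈ realSpan N := hx
  rw [hM.realSpan_eq] at hx'
  obtain ⟨w, hw⟩ := hx'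
  set X : Matrix ι (Fin (Module.finrank ℤ N) ⊕ Unit) ℤ := Matrix.fromCols M (Matrix.of fun i _ => x i)
  have h0 : gramDet (castM X) = 0 := by
    rw [gramDet_eq_zero_iff]
    refine ⟨Sum.elim w (fun _ => -1), fun h => ?_, ?_⟩
    · simpa using congrFun h (Sum.inr ())
    · have : castM X = Matrix.fromCols (castM M) (Matrix.of fun i (_ : Unit) => (x i : ℝ)) := by
        ext i (j | j) <;> rfl
      rw [this, Matrix.fromCols_mulVec]
      simp only [Matrix.mulVecLin_apply] at hw
      simp only [Function.comp_def, Sum.elim_inl, Sum.elim_inr]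
      rw [hw]
      ext i
      simp [Matrix.mulVec, dotProduct]
  rw [gramDet_castM_eq_zero_iff] at h0
  obtain ⟨v, hv, hv0⟩ := h0
  simp only [X] at hv0
  rw [Matrix.fromCols_mulVec] at hv0
  have h1 : v (Sum.inr ()) • x = M *ᵥ (-(v ∘ Sum.inl)) := by
    rw [Matrix.mulVec_neg]
    rw [eq_neg_iff_add_eq_zero, add_comm]
    rw [← hv0]
    congr 1
    ext i
    simp [Matrix.mulVec, dotProduct, mul_comm]
  refine hN (v (Sum.inr ())) x (fun h2 => hv ?_) ((hM.2 _).2 ⟨_, h1.symm⟩)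
  rw [h2, zero_smul] at h1
  have h3 : -(v ∘ Sum.inl) = 0 := hM.1 (by rw [← h1, Matrix.mulVec_zero])
  ext (j | j)
  · simpa using congrFun h3 j
  · exact h2

lemma Saturated.eq_of_le_of_finrank_le {N N' : Submodule ℤ (ι → ℤ)} (hN : Saturated N)
    (hN' : Saturated N') (hle : N ≤ N') (h : Module.finrank ℤ N' ≤ Module.finrank ℤ N) : N = N' := by
  rw [← finrank_realSpan, ← finrank_realSpan] at h
  have := Submodule.eq_of_le_of_finrank_le (realSpan_mono hle) h
  rw [← hN.sat_eq, ← hN'.sat_eq, sat, sat, this]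

lemma Saturated.inf {N N' : Submodule ℤ (ι → ℤ)} (hN : Saturated N)
    (hN' : Saturated N') : Saturated (N ⊓ N') :=
  fun a v ha hv => ⟨hN a v ha hv.1, hN' a v ha hv.2⟩

/-- Passing to a submodule of full rank can only increase the covolume. -/
lemma covolSq_le_of_le (g : Matrix ι ι ℝ) {N N' : Submodule ℤ (ι → ℤ)} (hle : N ≤ N')
    (h : Module.finrank ℤ N = Module.finrank ℤ N') : covolSq g N' ≤ covolSq g N := by
  set e : Fin (Module.finrank ℤ N) ≃ Fin (Module.finrank ℤ N') := finCongr h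
  set X : Matrix ι (Fin (Module.finrank ℤ N')) ℤ := (basisMat N).submatrix id e.symm
  obtain ⟨U, hU⟩ := exists_mul_of_col_mem (isBasisMat_basisMat N') X
    (fun j => hle ((isBasisMat_basisMat N).col_mem _))
  have h1 : ∀ g : Matrix ι ι ℝ, covolSq g N = gramDet (g * castM X) := fun g => by
    rw [covolSq, ← gramDet_submatrix_col _ e.symm]
    congr 1
  have h2 : ∀ g : Matrix ι ι ℝ, covolSq g N = covolSq g N' * (U.det : ℝ) ^ 2 := fun g => by
    rw [h1, hU, castM_mul, ← Matrix.mul_assoc, gramDet_mul, castM_det, covolSq]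
  rw [h2 g]
  refine le_mul_of_one_le_right (covolSq_nonneg _ _) ?_
  have hU0 : U.det ≠ 0 := fun h0 => by
    have := covolSq_pos (g := (1 : Matrix ι ι ℝ)) (by simp) N
    rw [h2, h0] at this
    simp at this
  have : 1 ≤ U.det ^ 2 := by
    have := sq_abs U.det
    have := Int.one_le_abs hU0
    nlinarith
  exact_mod_cast this

lemma covolSq_sat_le (g : Matrix ι ι ℝ) (N : Submodule ℤ (ι → ℤ)) :
    covolSq g (sat N) ≤ covolSq g N :=
  covolSq_le_of_le g (le_sat N) (finrank_sat N).symm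

lemma Saturated.exists_isCompl {W : Submodule ℤ (ι → ℤ)} (hW : Saturated W) :
    ∃ C : Submodule ℤ (ι → ℤ), IsCompl W C := by
  have : Module.IsTorsionFree ℤ ((ι → ℤ) ⧸ W) := by
    refine ⟨fun a ha => ?_⟩
    have ha0 : a ≠ 0 := ha.ne_zero
    intro x y hxy
    obtain ⟨x, rfl⟩ := W.mkQ_surjective x
    obtain ⟨y, rfl⟩ := W.mkQ_surjective y
    simp only [← map_smul] at hxy
    rw [Submodule.mkQ_apply, Submodule.mkQ_apply, Submodule.Quotient.eq, ← smul_sub] at hxy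
    rw [Submodule.mkQ_apply, Submodule.mkQ_apply, Submodule.Quotient.eq]
    exact hW a _ ha0 hxy
  have hfree : Module.Free ℤ ((ι → ℤ) ⧸ W) := Module.free_of_finite_type_torsion_free'
  obtain ⟨s, hs⟩ := W.mkQ.exists_rightInverse_of_surjective (LinearMap.range_eq_top.2 W.mkQ_surjective)
  refine ⟨LinearMap.range s, ?_⟩
  have := LinearMap.isCompl_of_proj (p := LinearMap.range s) (f := (s.comp W.mkQ).codRestrict _
    fun x => LinearMap.mem_range_self s _) ?_
  · have hk : LinearMap.ker ((s.comp W.mkQ).codRestrict (LinearMap.range s)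
        fun x => LinearMap.mem_range_self s _) = W := by
      rw [LinearMap.ker_codRestrict, LinearMap.ker_comp, LinearMap.ker_eq_bot_of_inverse hs]
      simp
    rw [hk] at this
    exact this.symm
  · rintro ⟨_, x, rfl⟩
    apply Subtype.ext
    change s (W.mkQ (s x)) = s x
    rw [← LinearMap.comp_apply W.mkQ, hs]
    rfl

lemma IsBasisMat.fromCols {M : Matrix ι k ℤ} {M' : Matrix ι l ℤ} {N N' : Submodule ℤ (ι → ℤ)}
    (h : IsBasisMat M N) (h' : IsBasisMat M' N') (hd : Disjoint N N') :
    IsBasisMat (Matrix.fromCols M M') (N ⊔ N') := by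
  refine ⟨?_, fun x => ?_⟩
  · have : Function.Injective (Matrix.fromCols M M').mulVecLin := by
      rw [← LinearMap.ker_eq_bot, LinearMap.ker_eq_bot']
      intro v hv
      rw [Matrix.mulVecLin_apply, Matrix.fromCols_mulVec] at hv
      have h1 : M *ᵥ (v ∘ Sum.inl) ∈ N := (h.2 _).2 ⟨_, rfl⟩
      have h2 : M' *ᵥ (v ∘ Sum.inr) ∈ N' := (h'.2 _).2 ⟨_, rfl⟩
      have h3 : M *ᵥ (v ∘ Sum.inl) = -(M' *ᵥ (v ∘ Sum.inr)) := eq_neg_of_add_eq_zero_left hv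
      have h4 : M *ᵥ (v ∘ Sum.inl) = 0 :=
        Submodule.disjoint_def.1 hd _ h1 (h3 ▸ N'.neg_mem h2)
      have h5 : M' *ᵥ (v ∘ Sum.inr) = 0 := by rw [h4, zero_add] at hv; exact hv
      have h6 := h.1 (h4.trans (Matrix.mulVec_zero M).symm)
      have h7 := h'.1 (h5.trans (Matrix.mulVec_zero M').symm)
      ext (j | j)
      · exact congrFun h6 j
      · exact congrFun h7 j
    exact this
  · rw [Submodule.mem_sup]
    constructor
    · rintro ⟨y, hy, z, hz, rfl⟩
      obtain ⟨v, rfl⟩ := (h.2 _).1 hy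
      obtain ⟨w, rfl⟩ := (h'.2 _).1 hz
      exact ⟨Sum.elim v w, by rw [Matrix.fromCols_mulVec]; rfl⟩
    · rintro ⟨v, rfl⟩
      exact ⟨_, (h.2 _).2 ⟨_, rfl⟩, _, (h'.2 _).2 ⟨_, rfl⟩, by rw [Matrix.fromCols_mulVec]⟩

lemma castM_fromCols (M : Matrix ι k ℤ) (M' : Matrix ι l ℤ) :
    castM (Matrix.fromCols M M') = Matrix.fromCols (castM M) (castM M') := by
  ext i (j | j) <;> rfl

/-- Submodularity of the covolume. -/
lemma covolSq_submodular (g : Matrix ι ι ℝ) {N N' : Submodule ℤ (ι → ℤ)} (hN : Saturated N)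
    (hN' : Saturated N') :
    covolSq g (N ⊓ N') * covolSq g (N ⊔ N') ≤ covolSq g N * covolSq g N' := by
  obtain ⟨C, hC⟩ := (hN.inf hN').exists_isCompl
  set W := N ⊓ N'
  have hsup : ∀ P : Submodule ℤ (ι → ℤ), W ≤ P → W ⊔ C ⊓ P = P := fun P hP => by
    rw [← sup_inf_assoc_of_le C hP, hC.sup_eq_top, top_inf_eq]
  have hA := hsup N inf_le_left
  have hB := hsup N' inf_le_right
  have hdA : Disjoint W (C ⊓ N) := hC.disjoint.mono_right inf_le_left
  have hdB : Disjoint W (C ⊓ N') := hC.disjoint.mono_right inf_le_left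
  have hdAB : Disjoint (C ⊓ N) (C ⊓ N') := by
    rw [disjoint_iff_inf_le, ← inf_inf_distrib_left]
    exact hC.symm.disjoint.le_bot
  have hdWAB : Disjoint W (C ⊓ N ⊔ C ⊓ N') :=
    hC.disjoint.mono_right (sup_le inf_le_left inf_le_left)
  have bW := isBasisMat_basisMat W
  have bA := isBasisMat_basisMat (C ⊓ N)
  have bB := isBasisMat_basisMat (C ⊓ N')
  have b1 := bW.fromCols bA hdA
  have b2 := bW.fromCols bB hdB
  have b3 := bW.fromCols (bA.fromCols bB hdAB) hdWAB
  rw [hA] at b1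
  rw [hB] at b2
  have h3 : W ⊔ (C ⊓ N ⊔ C ⊓ N') = N ⊔ N' := by
    rw [← sup_assoc, hA]
    nth_rewrite 2 [← hB]
    rw [← sup_assoc, sup_eq_left.2 (show W ≤ N from inf_le_left)]
  rw [h3] at b3
  rw [b1.covolSq_eq, b2.covolSq_eq, b3.covolSq_eq, bW.covolSq_eq]
  simp only [castM_fromCols, Matrix.mul_fromCols]
  exact gramDet_submodular _ _ _

lemma covolSq_submodular_sat (g : Matrix ι ι ℝ) {N N' : Submodule ℤ (ι → ℤ)} (hN : Saturated N)
    (hN' : Saturated N') :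
    covolSq g (N ⊓ N') * covolSq g (sat (N ⊔ N')) ≤ covolSq g N * covolSq g N' :=
  (mul_le_mul_of_nonneg_left (covolSq_sat_le g _) (covolSq_nonneg _ _)).trans
    (covolSq_submodular g hN hN')

lemma exists_mul_eq_of_minor {k : Type*} [Fintype k] [DecidableEq k] (M : Matrix ι k ℤ) (J : k → ι) :
    (Matrix.of fun i j => minor M (Function.update J j i)) = M * (M.submatrix J id).adjugate := by
  ext i j
  rw [Matrix.mul_apply, Matrix.of_apply]
  have h1 : (M.submatrix (Function.update J j i) id)
      = (M.submatrix J id).updateRow j (M i) := by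
    ext a b
    by_cases h : a = j
    · subst h; simp
    · simp [h]
  rw [minor, h1, ← Matrix.cramer_transpose_apply, Matrix.cramer_eq_adjugate_mulVec,
    ← Matrix.adjugate_transpose]
  simp [Matrix.mulVec, dotProduct, mul_comm]

lemma abs_minor_mul_le {k : Type*} [Fintype k] [DecidableEq k] (h : Matrix ι ι ℝ) (Y : Matrix ι k ℝ)
    {C H : ℝ} (hC : ∀ i j, |h i j| ≤ C) (hH : ∀ f, |minor Y f| ≤ H) (J : k → ι) :
    |minor (h * Y) J| ≤ Fintype.card (k → ι) * (C ^ Fintype.card k * H) := by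
  rw [minor_mul_expand]
  refine (Finset.abs_sum_le_sum_abs _ _).trans ((Finset.sum_le_card_nsmul _ _
    (C ^ Fintype.card k * H) fun f _ => ?_).trans (by simp))
  rw [abs_mul, Finset.abs_prod]
  have h1 : ∏ i, |h (J i) (f i)| ≤ C ^ Fintype.card k := by
    refine (Finset.prod_le_prod (fun _ _ => abs_nonneg _) fun i _ => hC _ _).trans ?_
    simp
  exact mul_le_mul h1 (hH f) (abs_nonneg _)
    ((Finset.prod_nonneg fun _ _ => abs_nonneg _).trans h1)

/-- Only finitely many saturated submodules have bounded Plücker coordinates. -/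
lemma finite_saturated (C H : ℝ) : {N : Submodule ℤ (ι → ℤ) | Saturated N ∧
    ∃ g h : Matrix ι ι ℝ, h * g = 1 ∧ (∀ i j, |h i j| ≤ C) ∧
      ∀ f, |minor (g * castM (basisMat N)) f| ≤ H}.Finite := by
  classical
  set n := Fintype.card ι
  obtain ⟨K, hK⟩ : ∃ K : ℕ, ∀ k ∈ Finset.range (n + 1),
      (Fintype.card (Fin k → ι) * (C ^ Fintype.card (Fin k) * H) : ℝ) ≤ K := by
    obtain ⟨K, hK⟩ := exists_nat_ge (∑ k ∈ Finset.range (n + 1),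
      |(Fintype.card (Fin k → ι) * (C ^ Fintype.card (Fin k) * H) : ℝ)|)
    refine ⟨K, fun k hk => ((le_abs_self _).trans ?_).trans hK⟩
    exact Finset.single_le_sum (f := fun k : ℕ =>
      |(Fintype.card (Fin k → ι) * (C ^ Fintype.card (Fin k) * H) : ℝ)|)
      (fun _ _ => abs_nonneg _) hk
  refine Set.Finite.subset (s := ⋃ k ∈ Finset.range (n + 1),
    (fun D : ι → Fin k → ℤ => intPart (LinearMap.range (castM (Matrix.of D)).mulVecLin)) ''
      Set.Icc (fun _ _ => -(K : ℤ)) (fun _ _ => (K : ℤ))) ?_ ?_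
  · exact Set.Finite.biUnion (Finset.finite_toSet _) fun k _ => (Set.finite_Icc _ _).image _
  · rintro N ⟨hN, g, h, hgh, hC, hH⟩
    set k := Module.finrank ℤ N
    set M := basisMat N
    have hM : IsBasisMat M N := isBasisMat_basisMat N
    have hk : k ∈ Finset.range (n + 1) := by
      rw [Finset.mem_range, Nat.lt_succ_iff]
      have := Submodule.finrank_le N
      rwa [Module.finrank_fintype_fun_eq_card] at this
    simp only [Set.mem_iUnion]
    have hb : ∀ J, |minor M J| ≤ (K : ℤ) := fun J => by
      have h1 := abs_minor_mul_le h (g * castM M) hC hH J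
      rw [← Matrix.mul_assoc, hgh, Matrix.one_mul, castM_minor] at h1
      have h2 := h1.trans (hK k hk)
      exact_mod_cast h2
    obtain ⟨J, hJ⟩ : ∃ J, minor M J ≠ 0 := by
      obtain ⟨J, hJ⟩ := exists_minor_ne_zero hM.gramDet_ne_zero
      refine ⟨J, fun h0 => hJ ?_⟩
      rw [castM_minor, h0, Int.cast_zero]
    refine ⟨k, hk, fun i j => minor M (Function.update J j i), ⟨fun i j => ?_, fun i j => ?_⟩, ?_⟩
    · exact (abs_le.1 (hb _)).1
    · exact (abs_le.1 (hb _)).2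
    · beta_reduce
      rw [exists_mul_eq_of_minor]
      conv_rhs => rw [← hN.sat_eq, sat, hM.realSpan_eq]
      congr 1
      rw [castM_mul, Matrix.mulVecLin_mul]
      apply LinearMap.range_comp_of_range_eq_top
      have hdet : (castM (M.submatrix J id).adjugate).det ≠ 0 := by
        rw [castM_det, Matrix.det_adjugate]
        exact_mod_cast pow_ne_zero _ hJ
      rw [LinearMap.range_eq_top, ]
      exact Matrix.mulVec_surjective_iff_isUnit.2
        ((Matrix.isUnit_iff_isUnit_det _).2 hdet.isUnit)

end Integer

section Covering
variable {E : Type*} [NormedAddCommGroup E] [InnerProductSpace ℝ E] [FiniteDimensional ℝ E]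
  {S : Type*} {ψ : S → E → ℝ} {z : S → E} {β : S → ℝ} {c : S → S → Prop} {δ C : ℝ}

open scoped InnerProductSpace

/-- On every sphere there is a convex combination of the labels of near-minimizers that points
outwards. -/
lemma exists_outward_combination (hψ : ∀ N, Continuous (ψ N))
    (hβ : ∀ N t, ψ N t ≤ 0 → ⟪z N, t⟫_ℝ ≤ -β N) (hfin : ∀ H, {N | β N ≤ H}.Finite)
    (hz : ∀ N, ‖z N‖ ≤ C) (hδ : 0 < δ) (hneg : ∀ t, ∃ N, ψ N t ≤ -δ)
    (hind : ∀ (T : Finset S) (w : S → ℝ), (∀ N ∈ T, ∀ N' ∈ T, c N N') → (∀ N ∈ T, 0 ≤ w N) →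
      ∑ N ∈ T, w N • z N = 0 → ∀ N ∈ T, w N = 0)
    (hchain : ∀ t N N', (∀ K, ψ N t < ψ K t + δ) → (∀ K, ψ N' t < ψ K t + δ) → c N N')
    {M : ℝ} (hM : ∀ N, -M ≤ β N) {R : ℝ} (hR : 0 < R) :
    ∃ (A : Finset S) (u : S → ℝ), (∀ N, 0 ≤ u N) ∧ (∀ N, u N ≠ 0 → N ∈ A) ∧
      ∑ N ∈ A, u N = 1 ∧ ‖∑ N ∈ A, u N • z N‖ ≤ M / R ∧ ∑ N ∈ A, u N * (β N + M) ≤ M ∧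
      ∀ N N', u N ≠ 0 → u N' ≠ 0 → c N N' := by
  classical
  set A : Finset S := (hfin (C * R)).toFinset with hA
  have hmemA : ∀ N t, ‖t‖ ≤ R → ψ N t ≤ 0 → N ∈ A := fun N t ht h0 => by
    rw [hA, Set.Finite.mem_toFinset, Set.mem_ofPred_eq]
    have h1 := hβ N t h0
    have h2 := abs_real_inner_le_norm (z N) t
    have h3 : ‖z N‖ * ‖t‖ ≤ C * R :=
      mul_le_mul (hz N) ht (norm_nonneg _) ((norm_nonneg _).trans (hz N))
    have := (abs_le.1 h2).1
    linarith
  have hne : A.Nonempty := by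
    obtain ⟨N, hN⟩ := hneg 0
    exact ⟨N, hmemA N 0 (by simpa using hR.le) (by linarith)⟩
  set m : E → ℝ := fun t => A.inf' hne fun N => ψ N t
  have hm : Continuous m := Continuous.finset_inf'_apply hne fun N _ => hψ N
  set w : S → E → ℝ := fun N t => max 0 (m t + δ - ψ N t)
  have hw : ∀ N, Continuous (w N) := fun N =>
    continuous_const.max ((hm.add continuous_const).sub (hψ N))
  have hw0 : ∀ N t, 0 ≤ w N t := fun N t => le_max_left _ _
  obtain ⟨x, hx, hcase⟩ := Brouwer.exists_zero_or_inward hR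
    (fun t => -∑ N ∈ A, w N t • z N)
    (continuous_finsetSum _ fun N _ => (hw N).smul continuous_const).neg
  have hmle : ∀ N ∈ A, m x ≤ ψ N x := fun N hN => Finset.inf'_le _ hN
  have hmδ : m x ≤ -δ := by
    obtain ⟨N, hN⟩ := hneg x
    exact (hmle N (hmemA N x hx (by linarith))).trans hN
  have hnear : ∀ N, w N x ≠ 0 → ψ N x < m x + δ := fun N hN => by
    by_contra hcon
    exact hN (max_eq_left (by linarith))
  have hnear' : ∀ N, w N x ≠ 0 → ∀ K, ψ N x < ψ K x + δ := fun N hN K => by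
    have h1 := hnear N hN
    by_cases hK : K ∈ A
    · have := hmle K hK
      linarith
    · have : ¬ ψ K x ≤ 0 := fun h => hK (hmemA K x hx h)
      linarith
  have hc : ∀ N N', w N x ≠ 0 → w N' x ≠ 0 → c N N' := fun N N' h h' =>
    hchain x N N' (hnear' N h) (hnear' N' h')
  obtain ⟨N0, hN0, hN0m⟩ := Finset.exists_mem_eq_inf' hne fun N => ψ N x
  have hwN0 : w N0 x = δ := by
    have : m x = ψ N0 x := hN0m
    simp only [w, this]
    rw [max_eq_right] <;> linarith
  have hW : 0 < ∑ N ∈ A, w N x := by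
    have := Finset.single_le_sum (f := fun N => w N x) (fun N _ => hw0 N x) hN0
    simp only [hwN0] at this
    linarith
  rcases hcase with h0 | ⟨hxR, κ, hκ, hfx⟩
  · exfalso
    have h1 : ∑ N ∈ A.filter (fun N => w N x ≠ 0), w N x • z N = 0 := by
      rw [Finset.sum_filter_of_ne, ← neg_eq_zero]
      · exact h0
      · intro N _ h h'
        rw [h', zero_smul] at h
        exact h rfl
    have h2 := hind _ (fun N => w N x) (fun N hN N' hN' => hc N N' (Finset.mem_filter.1 hN).2
      (Finset.mem_filter.1 hN').2) (fun N _ => hw0 N x) h1 N0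
      (Finset.mem_filter.2 ⟨hN0, by rw [hwN0]; exact hδ.ne'⟩)
    simp only [hwN0] at h2
    exact hδ.ne' h2
  · rw [neg_smul, neg_inj] at hfx
    set W := ∑ N ∈ A, w N x
    refine ⟨A, fun N => w N x / W, fun N => div_nonneg (hw0 N x) hW.le, fun N hN => ?_, ?_, ?_⟩
    · have : w N x ≠ 0 := fun h => hN (by simp only [h, zero_div])
      refine hmemA N x hx ?_
      have := hnear N this
      linarith
    · rw [← Finset.sum_div, div_self hW.ne']
    have hsum : ∑ N ∈ A, (w N x / W) • z N = (κ / W) • x := by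
      have : ∀ N, (w N x / W) • z N = W⁻¹ • (w N x • z N) := fun N => by
        rw [smul_smul, div_eq_inv_mul]
      simp only [this]
      rw [← Finset.smul_sum, hfx, smul_smul, div_eq_inv_mul]
    have hkey : κ / W * R ^ 2 ≤ -∑ N ∈ A, (w N x / W) * β N := by
      have h1 : κ / W * R ^ 2 = ∑ N ∈ A, (w N x / W) * ⟪z N, x⟫_ℝ := by
        rw [← hxR, ← real_inner_self_eq_norm_sq, ← real_inner_smul_left, ← hsum, sum_inner]
        simp only [real_inner_smul_left]
      rw [h1, ← Finset.sum_neg_distrib]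
      refine Finset.sum_le_sum fun N _ => ?_
      rw [← mul_neg]
      by_cases hN : w N x = 0
      · rw [hN]; simp
      · refine mul_le_mul_of_nonneg_left (hβ N x ?_) (div_nonneg (hw0 N x) hW.le)
        have := hnear N hN
        linarith
    have hone : ∑ N ∈ A, w N x / W = 1 := by rw [← Finset.sum_div, div_self hW.ne']
    have hκW : 0 ≤ κ / W := div_nonneg hκ hW.le
    have hβM : ∑ N ∈ A, w N x / W * (β N + M) = ∑ N ∈ A, w N x / W * β N + M := by
      simp only [mul_add]
      rw [Finset.sum_add_distrib, ← Finset.sum_mul, hone, one_mul]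
    have hβM0 : 0 ≤ ∑ N ∈ A, w N x / W * (β N + M) := Finset.sum_nonneg fun N _ =>
      mul_nonneg (div_nonneg (hw0 N x) hW.le) (by linarith [hM N])
    have hR2 : 0 ≤ κ / W * R ^ 2 := by positivity
    refine ⟨?_, ?_, fun N N' hN hN' => hc N N' (fun h => hN (by simp only [h, zero_div]))
      (fun h => hN' (by simp only [h, zero_div]))⟩
    · rw [hsum, norm_smul, hxR, Real.norm_of_nonneg hκW, le_div_iff₀ hR]
      nlinarith
    · rw [hβM]
      linarith

lemma sum_smul_eq_add_sdiff {S G : Type*} [DecidableEq S] [AddCommGroup G] [Module ℝ G]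
    (A F : Finset S) (u : S → ℝ) (y : S → G) (hu : ∀ N, u N ≠ 0 → N ∈ A) :
    ∑ N ∈ A, u N • y N = ∑ N ∈ F, u N • y N + ∑ N ∈ A \ F, u N • y N := by
  rw [← Finset.sum_inter_add_sum_sdiff A F]
  congr 1
  refine Finset.sum_subset Finset.inter_subset_right fun N hN hN' => ?_
  have : u N = 0 := by
    by_contra h
    exact hN' (Finset.mem_inter.2 ⟨hu N h, hN⟩)
  rw [this, zero_smul]

/-- A covering argument: a family of functions `ψ N` that takes values at most `-δ` everywhere
cannot have near-minimizers that are labelled independently. -/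
lemma covering_contradiction (hψ : ∀ N, Continuous (ψ N))
    (hβ : ∀ N t, ψ N t ≤ 0 → ⟪z N, t⟫_ℝ ≤ -β N) (hfin : ∀ H, {N | β N ≤ H}.Finite)
    (hz : ∀ N, ‖z N‖ ≤ C) (hδ : 0 < δ) (hneg : ∀ t, ∃ N, ψ N t ≤ -δ)
    (hind : ∀ (T : Finset S) (w : S → ℝ), (∀ N ∈ T, ∀ N' ∈ T, c N N') → (∀ N ∈ T, 0 ≤ w N) →
      ∑ N ∈ T, w N • z N = 0 → ∀ N ∈ T, w N = 0)
    (hchain : ∀ t N N', (∀ K, ψ N t < ψ K t + δ) → (∀ K, ψ N' t < ψ K t + δ) → c N N')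
    {n : ℕ} (hcard : ∀ T : Finset S, (∀ N ∈ T, ∀ N' ∈ T, c N N') → T.card ≤ n) : False := by
  classical
  have hC : 0 ≤ C := by
    obtain ⟨N, -⟩ := hneg 0
    exact (norm_nonneg _).trans (hz N)
  obtain ⟨M, hM0, hM⟩ : ∃ M : ℝ, 0 < M ∧ ∀ N, -M ≤ β N := by
    obtain ⟨b, hb⟩ := ((hfin 0).image β).bddBelow
    refine ⟨max 1 (-b), lt_of_lt_of_le one_pos (le_max_left _ _), fun N => ?_⟩
    by_cases hN : β N ≤ 0
    · have := hb ⟨N, hN, rfl⟩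
      have := le_max_right 1 (-b)
      linarith
    · have := le_max_left 1 (-b)
      linarith
  choose A u hu0 huA hu1 huz huβ huc using fun j : ℕ =>
    exists_outward_combination hψ hβ hfin hz hδ hneg hind hchain hM
      (R := (j : ℝ) + 1) (by positivity)
  set F : ℝ → Finset S := fun H => (hfin H).toFinset
  have hF : ∀ H N, N ∈ F H ↔ β N ≤ H := fun H N => by simp [F]
  have htail : ∀ H, 0 ≤ H → ∀ j, ∑ N ∈ A j \ F H, u j N ≤ M / (H + M) := fun H hH j => by
    rw [le_div_iff₀ (by linarith), Finset.sum_mul]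
    refine le_trans (Finset.sum_le_sum fun N hN => ?_) ((Finset.sum_le_sum_of_subset_of_nonneg
      (Finset.sdiff_subset (s := A j) (t := F H)) fun N _ _ => ?_).trans (huβ j))
    · refine mul_le_mul_of_nonneg_left ?_ (hu0 j N)
      have : ¬ β N ≤ H := fun h => (Finset.mem_sdiff.1 hN).2 ((hF H N).2 h)
      linarith
    · exact mul_nonneg (hu0 j N) (by linarith [hM N])
  have hsum1 : ∀ H, 0 ≤ H → ∀ j, 1 ≤ ∑ N ∈ F H, u j N + M / (H + M) := fun H hH j => by
    have := sum_smul_eq_add_sdiff (A j) (F H) (u j) (fun _ => (1 : ℝ)) (huA j)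
    simp only [smul_eq_mul, mul_one] at this
    rw [hu1] at this
    have := htail H hH j
    linarith
  have hsum2 : ∀ H, 0 ≤ H → ∀ j : ℕ, ‖∑ N ∈ F H, u j N • z N‖
      ≤ M / ((j : ℝ) + 1) + C * (M / (H + M)) := fun H hH j => by
    have h1 : ∑ N ∈ F H, u j N • z N = ∑ N ∈ A j, u j N • z N
        - ∑ N ∈ A j \ F H, u j N • z N := by rw [sum_smul_eq_add_sdiff (A j) (F H) (u j) z (huA j), add_sub_cancel_right]
    rw [h1]
    refine (norm_sub_le _ _).trans (add_le_add (huz j) ((norm_sum_le _ _).trans ?_))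
    refine le_trans ?_ (mul_le_mul_of_nonneg_left (htail H hH j) hC)
    rw [Finset.mul_sum]
    refine Finset.sum_le_sum fun N _ => ?_
    rw [norm_smul, Real.norm_of_nonneg (hu0 j N), mul_comm]
    exact mul_le_mul_of_nonneg_right (hz N) (hu0 j N)
  have hule : ∀ j N, u j N ≤ 1 := fun j N => by
    by_cases h : u j N = 0
    · rw [h]; exact zero_le_one
    · rw [← hu1 j]
      exact Finset.single_le_sum (f := u j) (fun N _ => hu0 j N) (huA j N h)
  have hlim : ∀ N, ∃ y : ℝ, Tendsto (fun j : ℕ => u j N) (hyperfilter ℕ : Filter ℕ) (𝓝 y) := fun N => by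
    obtain ⟨y, -, hy⟩ := (isCompact_Icc (a := (0 : ℝ)) (b := 1)).ultrafilter_le_nhds
      ((hyperfilter ℕ).map fun j : ℕ => u j N) (by
        rw [le_principal_iff, Ultrafilter.coe_map, Filter.mem_map]
        exact Filter.univ_mem' fun j => ⟨hu0 j N, hule j N⟩)
    exact ⟨y, hy⟩
  choose w hw using hlim
  have hw0 : ∀ N, 0 ≤ w N := fun N => ge_of_tendsto' (hw N) fun j => hu0 j N
  have hwc : ∀ N N', w N ≠ 0 → w N' ≠ 0 → c N N' := fun N N' h h' => by
    have e1 := (hw N).eventually_ne h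
    have e2 := (hw N').eventually_ne h'
    obtain ⟨j, h1, h2⟩ := (e1.and e2).exists
    exact huc j N N' h1 h2
  have hws1 : ∀ H, 0 ≤ H → 1 ≤ ∑ N ∈ F H, w N + M / (H + M) := fun H hH =>
    ge_of_tendsto' ((tendsto_finsetSum _ fun N _ => hw N).add_const _) (hsum1 H hH)
  have hws2 : ∀ H, 0 ≤ H → ‖∑ N ∈ F H, w N • z N‖ ≤ C * (M / (H + M)) := fun H hH => by
    have h3 : Tendsto (fun j : ℕ => M / ((j : ℝ) + 1)) atTop (𝓝 0) := by
      have := (tendsto_one_div_add_atTop_nhds_zero_nat (𝕜 := ℝ)).const_mul M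
      simpa [div_eq_mul_inv] using this
    have h1 : Tendsto (fun j : ℕ => M / ((j : ℝ) + 1) + C * (M / (H + M)))
        (hyperfilter ℕ : Filter ℕ) (𝓝 (0 + C * (M / (H + M)))) :=
      (h3.mono_left Nat.hyperfilter_le_atTop).add_const _
    rw [zero_add] at h1
    exact le_of_tendsto_of_tendsto'
      (tendsto_finsetSum _ fun N _ => (hw N).smul_const _).norm h1 (hsum2 H hH)
  have hsupp : {N | w N ≠ 0}.Finite := by
    by_contra hinf
    obtain ⟨T, hT, hTc⟩ := Set.Infinite.exists_subset_card_eq hinf (n + 1)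
    have := hcard T fun N hN N' hN' => hwc N N' (hT hN) (hT hN')
    omega
  obtain ⟨H0, hH0⟩ := (hsupp.image β).bddAbove
  set T := hsupp.toFinset
  have hT : ∀ N, N ∈ T ↔ w N ≠ 0 := fun N => by simp [T]
  have hTF : ∀ H, H0 ≤ H → T ⊆ F H := fun H hH N hN =>
    (hF H N).2 ((hH0 ⟨N, (hT N).1 hN, rfl⟩).trans hH)
  have hz0 : ∑ N ∈ T, w N • z N = 0 := by
    rw [← norm_le_zero_iff]
    have h1 : Tendsto (fun H : ℝ => C * (M / (H + M))) atTop (𝓝 (C * 0)) :=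
      (tendsto_const_nhds.div_atTop (tendsto_atTop_add_const_right _ _ tendsto_id)).const_mul _
    rw [mul_zero] at h1
    refine ge_of_tendsto h1 ?_
    filter_upwards [eventually_ge_atTop H0, eventually_ge_atTop 0] with H hH hH'
    have := hws2 H hH'
    rwa [← Finset.sum_subset (hTF H hH)] at this
    intro N _ hN
    rw [hT, not_not] at hN
    rw [hN, zero_smul]
  have hall := hind T w (fun N hN N' hN' => hwc N N' ((hT N).1 hN) ((hT N').1 hN'))
    (fun N _ => hw0 N) hz0
  have hzero : ∀ N, w N = 0 := fun N => by
    by_contra h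
    exact h (hall N ((hT N).2 h))
  have := hws1 1 zero_le_one
  simp only [hzero, Finset.sum_const_zero, zero_add] at this
  rw [le_div_iff₀ (by linarith)] at this
  linarith

end Covering

section Pivots
variable {n : ℕ}

open Classical in
/-- The positions of the leading nonzero coordinates of the elements of a subspace. -/
def pivots (V : Submodule ℝ (Fin n → ℝ)) : Finset (Fin n) :=
  Finset.univ.filter fun i => ∃ v ∈ V, v i ≠ 0 ∧ ∀ j < i, v j = 0

lemma mem_pivots {V : Submodule ℝ (Fin n → ℝ)} {i : Fin n} :
    i ∈ pivots V ↔ ∃ v ∈ V, v i ≠ 0 ∧ ∀ j < i, v j = 0 := by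
  simp [pivots]

lemma pivots_mono {V W : Submodule ℝ (Fin n → ℝ)} (h : V ≤ W) : pivots V ⊆ pivots W := fun i hi => by
  rw [mem_pivots] at hi ⊢
  obtain ⟨v, hv, h2⟩ := hi
  exact ⟨v, h hv, h2⟩

lemma exists_first_ne_zero {R : Type*} [Zero R] {s : Finset (Fin n)} {v : Fin n → R}
    (h : ∃ i ∈ s, v i ≠ 0) : ∃ i ∈ s, v i ≠ 0 ∧ ∀ j ∈ s, j < i → v j = 0 := by
  classical
  obtain ⟨i, hi, hv⟩ := h
  have hne : (s.filter fun i => v i ≠ 0).Nonempty := ⟨i, Finset.mem_filter.2 ⟨hi, hv⟩⟩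
  have hm := Finset.mem_filter.1 (Finset.min'_mem _ hne)
  refine ⟨_, hm.1, hm.2, fun j hj hlt => ?_⟩
  by_contra hcon
  exact absurd (Finset.min'_le _ j (Finset.mem_filter.2 ⟨hj, hcon⟩)) (not_le.2 hlt)

lemma eq_zero_of_pivots {V : Submodule ℝ (Fin n → ℝ)} {v : Fin n → ℝ} (hv : v ∈ V)
    (h : ∀ i ∈ pivots V, v i = 0) : v = 0 := by
  by_contra hne
  obtain ⟨i, hi⟩ := Function.ne_iff.1 hne
  obtain ⟨i, -, hi, hlt⟩ := exists_first_ne_zero ⟨i, Finset.mem_univ _, hi⟩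
  exact hi (h i (mem_pivots.2 ⟨v, hv, hi, fun j hj => hlt j (Finset.mem_univ _) hj⟩))

lemma card_pivots (V : Submodule ℝ (Fin n → ℝ)) : (pivots V).card = Module.finrank ℝ V := by
  apply le_antisymm
  · choose v hv hvi hvj using fun i : pivots V => mem_pivots.1 i.2
    have hli : LinearIndependent ℝ (fun i => (⟨v i, hv i⟩ : V)) := by
      rw [Fintype.linearIndependent_iff]
      intro c hc
      by_contra! hcon
      obtain ⟨i, hi⟩ := hcon
      obtain ⟨i, hip, hi, hlt⟩ := exists_first_ne_zero (s := pivots V)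
        (v := fun i => if h : i ∈ pivots V then c ⟨i, h⟩ else 0) ⟨i, i.2, by simpa using hi⟩
      simp only [hip, dite_true] at hi
      have h1 := congrFun (congrArg Subtype.val hc) i
      simp only [AddSubmonoidClass.coe_finsetSum, SetLike.val_smul, Finset.sum_apply, Pi.smul_apply,
        smul_eq_mul, ZeroMemClass.coe_zero, Pi.zero_apply] at h1
      rw [Finset.sum_eq_single_of_mem ⟨i, hip⟩ (Finset.mem_univ _)] at h1
      · exact (mul_ne_zero hi (hvi ⟨i, hip⟩)) h1
      · intro j _ hj
        rcases lt_trichotomy j.1 i with h | h | h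
        · have := hlt j j.2 h
          simp only [j.2, dite_true] at this
          rw [this, zero_mul]
        · exact absurd (Subtype.ext h) hj
        · rw [hvj j i h, mul_zero]
    have := hli.fintype_card_le_finrank
    simpa using this
  · have hinj : Function.Injective
        ((LinearMap.funLeft ℝ ℝ (Subtype.val : pivots V → Fin n)).comp V.subtype) := by
      rw [← LinearMap.ker_eq_bot, LinearMap.ker_eq_bot']
      rintro ⟨v, hv⟩ h
      exact Subtype.ext (eq_zero_of_pivots hv fun i hi => congrFun h ⟨i, hi⟩)
    have := LinearMap.finrank_le_finrank_of_injective hinj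
    simpa using this

lemma minor_pivots_ne_zero {k : Type*} [Fintype k] [DecidableEq k] {X : Matrix (Fin n) k ℝ}
    {V : Submodule ℝ (Fin n → ℝ)} (hX : ∀ w, X *ᵥ w ∈ V) (hX0 : gramDet X ≠ 0)
    (e : k ≃ pivots V) : minor X (fun i => e i) ≠ 0 := by
  intro h
  obtain ⟨w, hw, h0⟩ := Matrix.exists_mulVec_eq_zero_iff.2 h
  refine hX0 ((gramDet_eq_zero_iff X).2 ⟨w, hw, eq_zero_of_pivots (hX w) fun i hi => ?_⟩)
  have := congrFun h0 (e.symm ⟨i, hi⟩)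
  simpa [Matrix.mulVec, dotProduct] using this

end Pivots

section Independence
variable {S ι : Type*} [PartialOrder S] [Fintype ι] [DecidableEq ι]

lemma exists_separating {T : Finset S} (hT : ∀ N ∈ T, ∀ N' ∈ T, N ≤ N' ∨ N' ≤ N)
    {B : S → Finset ι} (hB : StrictMono B) (hB0 : ∀ N, (B N).Nonempty) (N : S) :
    ∃ a ∈ B N, ∀ N' ∈ T, N' < N → a ∉ B N' := by
  classical
  by_cases hne : (T.filter (· < N)).Nonempty
  · obtain ⟨P, hP⟩ := Finset.exists_maximal hne
    have hP1 := Finset.mem_filter.1 hP.1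
    obtain ⟨a, ha, ha'⟩ := Finset.exists_of_ssubset (hB hP1.2)
    refine ⟨a, ha, fun N' hN' hlt h => ha' ?_⟩
    have hle : N' ≤ P := by
      rcases hT N' hN' P hP1.1 with h | h
      · exact h
      · exact hP.2 (Finset.mem_filter.2 ⟨hN', hlt⟩) h
    exact hB.monotone hle h
  · obtain ⟨a, ha⟩ := hB0 N
    exact ⟨a, ha, fun N' hN' hlt => absurd ⟨N', Finset.mem_filter.2 ⟨hN', hlt⟩⟩ hne⟩

lemma exists_separating' {T : Finset S} (hT : ∀ N ∈ T, ∀ N' ∈ T, N ≤ N' ∨ N' ≤ N)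
    {B : S → Finset ι} (hB : StrictMono B) (hB1 : ∀ N, B N ≠ Finset.univ) (N : S) :
    ∃ b ∉ B N, ∀ N' ∈ T, N < N' → b ∈ B N' := by
  obtain ⟨b, hb, h⟩ := exists_separating (S := Sᵒᵈ) (T := T) (B := fun N => (B N)ᶜ)
    (fun N hN N' hN' => (hT N hN N' hN').symm)
    (fun N N' h => Finset.compl_ssubset_compl.2 (hB h))
    (fun N => by
      rw [Finset.nonempty_iff_ne_empty, Ne, Finset.compl_eq_empty_iff]
      exact hB1 N) N
  exact ⟨b, Finset.mem_compl.1 hb, fun N' hN' hlt => by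
    have := h N' hN' hlt
    rwa [Finset.mem_compl, not_not] at this⟩

lemma finite_dependent (T : Finset S) (hT : ∀ N ∈ T, ∀ N' ∈ T, N ≤ N' ∨ N' ≤ N)
    {B : S → Finset ι} (hB : StrictMono B) (hB0 : ∀ N, (B N).Nonempty)
    (hB1 : ∀ N, B N ≠ Finset.univ) (ε : S → ℝ) (hε : ∀ N, 0 < ε N) (y : S → ι → ℝ) :
    {θ : ℝ | ∃ (w : S → ℝ) (a : ℝ), (∀ i, ∑ N ∈ T, w N * (y N i + θ * (ε N * if i ∈ B N then 1 else 0)) = a)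
      ∧ ∃ N ∈ T, w N ≠ 0}.Finite := by
  classical
  choose a ha ha' using fun N : T => exists_separating hT hB hB0 N.1
  choose b hb hb' using fun N : T => exists_separating' hT hB hB1 N.1
  set A : Matrix T T ℝ := Matrix.of fun N N' => -((y N' (a N) - y N' (b N)) / ε N')
  refine Set.Finite.subset (Polynomial.finite_setOfPred_isRoot (p := A.charpoly) A.charpoly_monic.ne_zero) ?_
  rintro θ ⟨w, c, hw, N0, hN0, hwN0⟩
  rw [Set.mem_ofPred_eq, Polynomial.IsRoot, Matrix.eval_charpoly]
  refine Matrix.exists_mulVec_eq_zero_iff.1 ⟨fun N => ε N * w N, fun h => ?_, ?_⟩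
  · have := congrFun h ⟨N0, hN0⟩
    exact (mul_ne_zero (hε N0).ne' hwN0) this
  · have hind : ∀ N N' : T, ((if a N ∈ B N' then (1 : ℝ) else 0) - if b N ∈ B N' then 1 else 0)
        = if N = N' then 1 else 0 := by
      intro N N'
      by_cases h : N = N'
      · subst h
        simp [ha N, hb N]
      · have hne : (N : S) ≠ N' := fun h' => h (Subtype.ext h')
        rcases hT N N.2 N' N'.2 with hle | hle
        · have hlt := lt_of_le_of_ne hle hne
          rw [if_pos (hB.monotone hle (ha N)), if_pos (hb' N N' N'.2 hlt), if_neg h, sub_self]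
        · have hlt := lt_of_le_of_ne hle hne.symm
          rw [if_neg (ha' N N' N'.2 hlt), if_neg (fun h' => hb N (hB.monotone hle h')), if_neg h,
            sub_self]
    ext N
    have h1 : ∑ N' ∈ T, w N' * (y N' (a N) + θ * (ε N' * if a N ∈ B N' then 1 else 0))
      - ∑ N' ∈ T, w N' * (y N' (b N) + θ * (ε N' * if b N ∈ B N' then 1 else 0)) = 0 := by
      rw [hw, hw, sub_self]
    rw [← Finset.sum_sub_distrib, ← Finset.sum_coe_sort] at h1
    rw [Pi.zero_apply, ← h1]
    simp only [Matrix.mulVec, dotProduct]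
    refine Finset.sum_congr rfl fun N' _ => ?_
    have h2 : w N' * (y N' (a N) + θ * (ε N' * if a N ∈ B N' then 1 else 0))
      - w N' * (y N' (b N) + θ * (ε N' * if b N ∈ B N' then 1 else 0))
      = w N' * (y N' (a N) - y N' (b N)) + w N' * θ * ε N' *
        ((if a N ∈ B N' then (1 : ℝ) else 0) - if b N ∈ B N' then 1 else 0) := by ring
    rw [h2, hind]
    have h3 := (hε N').ne'
    simp only [Matrix.sub_apply, Matrix.scalar_apply, Matrix.diagonal_apply, A, Matrix.of_apply]
    field_simp
    by_cases h : N = N'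
    · simp [h]; ring
    · simp [h, mul_comm]

end Independence

section Hyperplane

lemma covering_hyperplane {n : ℕ} {S : Type*} {ψ : S → (Fin n → ℝ) → ℝ} {x : S → Fin n → ℝ}
    {β : S → ℝ} {c : S → S → Prop} {δ C : ℝ} (hψ : ∀ N, Continuous (ψ N))
    (hβ : ∀ N t, ∑ i, t i = 0 → ψ N t ≤ 0 → ∑ i, x N i * t i ≤ -β N)
    (hfin : ∀ H, {N | β N ≤ H}.Finite) (hx : ∀ N i, |x N i| ≤ C) (hδ : 0 < δ)
    (hneg : ∀ t, ∑ i, t i = 0 → ∃ N, ψ N t ≤ -δ)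
    (hind : ∀ (T : Finset S) (w : S → ℝ) (a : ℝ), (∀ N ∈ T, ∀ N' ∈ T, c N N') →
      (∀ i, ∑ N ∈ T, w N * x N i = a) → ∀ N ∈ T, w N = 0)
    (hchain : ∀ t N N', ∑ i, t i = 0 → (∀ K, ψ N t < ψ K t + δ) → (∀ K, ψ N' t < ψ K t + δ) →
      c N N') (hcard : ∀ T : Finset S, (∀ N ∈ T, ∀ N' ∈ T, c N N') → T.card ≤ n) : False := by
  set o : EuclideanSpace ℝ (Fin n) := WithLp.toLp 2 fun _ => 1
  set V : Submodule ℝ (EuclideanSpace ℝ (Fin n)) := (Submodule.span ℝ {o})ᗮ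
  have hV : ∀ t : V, ∑ i, (t : EuclideanSpace ℝ (Fin n)) i = 0 := fun t => by
    have := Submodule.mem_orthogonal_singleton_iff_inner_right.1 t.2
    rw [PiLp.inner_apply] at this
    simpa [o] using this
  set X : S → EuclideanSpace ℝ (Fin n) := fun N => WithLp.toLp 2 (x N)
  have hcont : Continuous fun t : V => (t : EuclideanSpace ℝ (Fin n)).ofLp :=
    (PiLp.continuous_ofLp 2 _).comp continuous_subtype_val
  refine covering_contradiction (E := V) (ψ := fun N t => ψ N (t : EuclideanSpace ℝ (Fin n)).ofLp)
    (z := fun N => V.orthogonalProjectionOnto (X N)) (β := β) (c := c) (δ := δ)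
    (C := √(∑ _i : Fin n, C ^ 2)) (n := n)
    (fun N => (hψ N).comp hcont) (fun N t ht => ?_) hfin (fun N => ?_) hδ
    (fun t => hneg _ (hV t)) (fun T w hT _ h0 => ?_) (fun t N N' => hchain _ N N' (hV t)) hcard
  · rw [real_inner_comm, Submodule.inner_orthogonalProjectionOnto_eq_of_mem_left, PiLp.inner_apply]
    exact hβ N _ (hV t) ht
  · refine (Submodule.norm_orthogonalProjectionOnto_apply_le V _).trans ?_
    rw [EuclideanSpace.norm_eq]
    refine Real.sqrt_le_sqrt (Finset.sum_le_sum fun i _ => ?_)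
    exact pow_le_pow_left₀ (norm_nonneg _) (hx N i) 2
  · have h1 : V.orthogonalProjectionOnto (∑ N ∈ T, w N • X N) = 0 := by
      rw [map_sum, ← h0]
      simp only [map_smul]
    rw [Submodule.orthogonalProjectionOnto_eq_zero_iff, Submodule.orthogonal_orthogonal,
      Submodule.mem_span_singleton] at h1
    obtain ⟨a, ha⟩ := h1
    refine hind T w a hT fun i => ?_
    have := congrArg (fun v : EuclideanSpace ℝ (Fin n) => v i) ha
    simp only [o, X, PiLp.smul_apply, smul_eq_mul, mul_one, WithLp.ofLp_sum, WithLp.ofLp_smul,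
      Finset.sum_apply, Pi.smul_apply] at this
    exact this.symm

end Hyperplane

section Concave
variable {n : ℕ}

/-- The diagonal matrix `exp t`. -/
def expDiag (t : Fin n → ℝ) : Matrix (Fin n) (Fin n) ℝ := Matrix.diagonal fun i => Real.exp (t i)

lemma det_expDiag {t : Fin n → ℝ} (ht : ∑ i, t i = 0) : (expDiag t).det = 1 := by
  rw [expDiag, Matrix.det_diagonal, ← Real.exp_sum, ht, Real.exp_zero]

lemma det_expDiag_mul {t : Fin n → ℝ} (ht : ∑ i, t i = 0) {g : Matrix (Fin n) (Fin n) ℝ}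
    (hg : g.det = 1) : (expDiag t * g).det = 1 := by
  rw [Matrix.det_mul, det_expDiag ht, hg, one_mul]

lemma det_expDiag_pos (t : Fin n → ℝ) : 0 < (expDiag t).det := by
  rw [expDiag, Matrix.det_diagonal]
  exact Finset.prod_pos fun i _ => Real.exp_pos _

lemma continuous_covolSq (N : Submodule ℤ (Fin n → ℤ)) :
    Continuous fun g : Matrix (Fin n) (Fin n) ℝ => covolSq g N := by
  unfold covolSq gramDet
  fun_prop

lemma continuous_expDiag : Continuous (expDiag : (Fin n → ℝ) → Matrix (Fin n) (Fin n) ℝ) := by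
  unfold expDiag
  fun_prop

/-- Perturbed logarithmic covolume. -/
def psi (g : Matrix (Fin n) (Fin n) ℝ) (ε : ℝ) (N : Submodule ℤ (Fin n → ℤ)) : ℝ :=
  Real.log (covolSq g N) / 2 + ε * (Module.finrank ℤ N * (n - Module.finrank ℤ N))

lemma covolSq_of_finrank_eq_zero (g : Matrix (Fin n) (Fin n) ℝ) {N : Submodule ℤ (Fin n → ℤ)}
    (h : Module.finrank ℤ N = 0) : covolSq g N = 1 := by
  have : IsEmpty (Fin (Module.finrank ℤ N)) := by rw [h]; infer_instance
  rw [covolSq, gramDet, Matrix.det_isEmpty]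

lemma saturated_top {ι : Type*} : Saturated (⊤ : Submodule ℤ (ι → ℤ)) := fun _ _ _ _ => trivial

lemma isBasisMat_one_top {ι : Type*} [Fintype ι] [DecidableEq ι] :
    IsBasisMat (1 : Matrix ι ι ℤ) ⊤ :=
  ⟨fun v w h => by simpa using h, fun x => ⟨fun _ => ⟨x, Matrix.one_mulVec x⟩, fun _ => trivial⟩⟩

lemma covolSq_of_finrank_eq {g : Matrix (Fin n) (Fin n) ℝ} {N : Submodule ℤ (Fin n → ℤ)}
    (hN : Saturated N) (h : Module.finrank ℤ N = n) : covolSq g N = g.det ^ 2 := by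
  have h1 : N = ⊤ := hN.eq_of_le_of_finrank_le saturated_top le_top (by
    rw [isBasisMat_one_top.finrank_eq, h, Fintype.card_fin])
  rw [h1, isBasisMat_one_top.covolSq_eq, ← gramDet_square]
  congr 1
  rw [castM, Matrix.map_one _ Int.cast_zero Int.cast_one, Matrix.mul_one]

lemma finrank_le (N : Submodule ℤ (Fin n → ℤ)) : Module.finrank ℤ N ≤ n := by
  have := Submodule.finrank_le N
  rwa [Module.finrank_fintype_fun_eq_card, Fintype.card_fin] at this

lemma psi_trivial {g : Matrix (Fin n) (Fin n) ℝ} (hg : g.det = 1) (ε : ℝ)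
    {N : Submodule ℤ (Fin n → ℤ)} (hN : Saturated N)
    (h : ¬ (0 < Module.finrank ℤ N ∧ Module.finrank ℤ N < n)) : psi g ε N = 0 := by
  have hle := finrank_le N
  rcases Nat.eq_zero_or_pos (Module.finrank ℤ N) with h0 | h0
  · rw [psi, covolSq_of_finrank_eq_zero g h0, h0]; simp
  · have h1 : Module.finrank ℤ N = n := by
      by_contra h2
      exact h ⟨h0, by omega⟩
    rw [psi, covolSq_of_finrank_eq hN h1, h1, hg]; simp

lemma finrank_inf_add_finrank_sup (N N' : Submodule ℤ (Fin n → ℤ)) :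
    Module.finrank ℤ ↥(N ⊓ N') + Module.finrank ℤ ↥(N ⊔ N')
      = Module.finrank ℤ N + Module.finrank ℤ N' := by
  have := Submodule.rank_sup_add_rank_inf_eq N N'
  rw [← Module.finrank_eq_rank, ← Module.finrank_eq_rank, ← Module.finrank_eq_rank,
    ← Module.finrank_eq_rank] at this
  have h : Module.finrank ℤ ↥(N ⊔ N') + Module.finrank ℤ ↥(N ⊓ N')
      = Module.finrank ℤ N + Module.finrank ℤ N' := by exact_mod_cast this
  omega

/-- Strict submodularity of the perturbed covolume on incomparable pairs. -/
lemma psi_submodular {g : Matrix (Fin n) (Fin n) ℝ} (hg : g.det ≠ 0) {ε : ℝ} (hε : 0 < ε)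
    {N N' : Submodule ℤ (Fin n → ℤ)} (hN : Saturated N) (hN' : Saturated N')
    (h : ¬ (N ≤ N' ∨ N' ≤ N)) :
    psi g ε (N ⊓ N') + psi g ε (sat (N ⊔ N')) + 2 * ε ≤ psi g ε N + psi g ε N' := by
  have hr := finrank_inf_add_finrank_sup N N'
  have hlt : ∀ P : Submodule ℤ (Fin n → ℤ), Saturated P → N ⊓ N' ≤ P → ¬ P ≤ N ⊓ N' →
      Module.finrank ℤ ↥(N ⊓ N') < Module.finrank ℤ P := fun P hP h1 h2 => by
    by_contra hcon
    have := (hN.inf hN').eq_of_le_of_finrank_le hP h1 (by omega)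
    exact h2 this.ge
  have ha := hlt N hN inf_le_left fun h1 => h (Or.inl (le_inf_iff.1 h1).2)
  have hb := hlt N' hN' inf_le_right fun h1 => h (Or.inr (le_inf_iff.1 h1).1)
  have hq := covolSq_submodular_sat g hN hN'
  have hlog := Real.log_le_log (mul_pos (covolSq_pos hg _) (covolSq_pos hg _)) hq
  rw [Real.log_mul (covolSq_pos hg _).ne' (covolSq_pos hg _).ne',
    Real.log_mul (covolSq_pos hg _).ne' (covolSq_pos hg _).ne'] at hlog
  unfold psi
  rw [finrank_sat]
  have ha' : (Module.finrank ℤ ↥(N ⊓ N') : ℝ) + 1 ≤ Module.finrank ℤ N := by exact_mod_cast ha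
  have hb' : (Module.finrank ℤ ↥(N ⊓ N') : ℝ) + 1 ≤ Module.finrank ℤ N' := by exact_mod_cast hb
  have hr' : (Module.finrank ℤ ↥(N ⊔ N') : ℝ)
      = Module.finrank ℤ N + Module.finrank ℤ N' - Module.finrank ℤ ↥(N ⊓ N') := by
    rw [eq_sub_iff_add_eq, add_comm]; exact_mod_cast hr
  rw [hr']
  generalize (Module.finrank ℤ ↥(N ⊓ N') : ℝ) = a at *
  generalize (Module.finrank ℤ ↥N : ℝ) = b at *
  generalize (Module.finrank ℤ ↥N' : ℝ) = b' at *
  have h1 : ε * 1 ≤ ε * ((b - a) * (b' - a)) := by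
    refine mul_le_mul_of_nonneg_left ?_ hε.le
    nlinarith
  nlinarith

end Concave

section NearStable
variable {n : ℕ}

/-- The counting vector of a tuple of indices. -/
def label {k : Type*} [Fintype k] (f : k → Fin n) (a : Fin n) : ℝ := ∑ i, if f i = a then 1 else 0

lemma sum_label_mul {k : Type*} [Fintype k] (f : k → Fin n) (t : Fin n → ℝ) :
    ∑ a, label f a * t a = ∑ i, t (f i) := by
  simp only [label, Finset.sum_mul]
  rw [Finset.sum_comm]
  simp

lemma label_nonneg {k : Type*} [Fintype k] (f : k → Fin n) (a : Fin n) : 0 ≤ label f a :=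
  Finset.sum_nonneg fun _ _ => by split_ifs <;> norm_num

lemma label_le {k : Type*} [Fintype k] (f : k → Fin n) (a : Fin n) :
    label f a ≤ Fintype.card k := by
  refine (Finset.sum_le_sum (g := fun _ => (1 : ℝ)) fun _ _ => ?_).trans (by simp)
  split_ifs <;> norm_num

lemma label_equiv {k : Type*} [Fintype k] {B : Finset (Fin n)} (e : k ≃ B) (a : Fin n) :
    label (fun i => (e i : Fin n)) a = if a ∈ B then 1 else 0 := by
  unfold label
  rw [e.sum_comp fun b : B => if (b : Fin n) = a then (1 : ℝ) else 0,
    Finset.sum_coe_sort B fun b => if b = a then (1 : ℝ) else 0]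
  simp

lemma sum_add_log_minor_nonpos {g : Matrix (Fin n) (Fin n) ℝ} {N : Submodule ℤ (Fin n → ℤ)}
    {t : Fin n → ℝ} (h : covolSq (expDiag t * g) N ≤ 1)
    (f : Fin (Module.finrank ℤ N) → Fin n) (hf : minor (g * castM (basisMat N)) f ≠ 0) :
    ∑ i, t (f i) + Real.log |minor (g * castM (basisMat N)) f| ≤ 0 := by
  have h1 := (minor_sq_le (expDiag t * g * castM (basisMat N)) f).trans h
  rw [Matrix.mul_assoc, expDiag, minor_diagonal_mul, ← Real.exp_sum] at h1
  have h2 := (sq_le_one_iff_abs_le_one _).1 h1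
  rw [abs_mul, abs_of_pos (Real.exp_pos _)] at h2
  have h3 := Real.log_le_log (mul_pos (Real.exp_pos _) (abs_pos.2 hf)) h2
  rwa [Real.log_mul (Real.exp_pos _).ne' (abs_pos.2 hf).ne', Real.log_exp, Real.log_one] at h3

/-- In every diagonal orbit there are lattices that are arbitrarily close to being stable. -/
theorem exists_nearStable {g : Matrix (Fin n) (Fin n) ℝ} (hg : g.det = 1) {c : ℝ} (hc0 : 0 < c)
    (hc : c < 1) : ∃ t : Fin n → ℝ, ∑ i, t i = 0 ∧
      ∀ N, Saturated N → c ≤ covolSq (expDiag t * g) N := by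
  classical
  by_contra hcon
  push Not at hcon
  have hg0 : ∀ {t : Fin n → ℝ}, (expDiag t * g).det ≠ 0 := fun {t} => by
    rw [Matrix.det_mul, hg, mul_one]
    exact (det_expDiag_pos t).ne'
  have hlogc : Real.log c < 0 := Real.log_neg hc0 hc
  set ε : ℝ := -Real.log c / (4 * (n ^ 2 + 1)) with hε_def
  have hε : 0 < ε := div_pos (by linarith) (by positivity)
  have hεn : ε * (n ^ 2 + 1) = -Real.log c / 4 := by rw [hε_def]; field_simp
  let S := {N : Submodule ℤ (Fin n → ℤ) //
    Saturated N ∧ 0 < Module.finrank ℤ N ∧ Module.finrank ℤ N < n}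
  let k : S → ℕ := fun N => Module.finrank ℤ N.1
  let X : ∀ N : S, Matrix (Fin n) (Fin (k N)) ℝ := fun N => g * castM (basisMat N.1)
  have hX0 : ∀ N, gramDet (X N) ≠ 0 := fun N =>
    (covolSq_pos (by rw [hg]; exact one_ne_zero) N.1).ne'
  have hI : ∀ N : S, ∃ f : Fin (k N) → Fin n, ∀ f', |minor (X N) f'| ≤ |minor (X N) f| := fun N => by
    have : Nonempty (Fin n) := ⟨⟨0, N.2.2.1.trans N.2.2.2⟩⟩
    exact Finite.exists_max fun f => |minor (X N) f|
  choose I hI using hI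
  have hI0 : ∀ N, minor (X N) (I N) ≠ 0 := fun N h => by
    obtain ⟨f, hf⟩ := exists_minor_ne_zero (hX0 N)
    have := hI N f
    rw [h, abs_zero, abs_nonpos_iff] at this
    exact hf this
  let V : Submodule ℤ (Fin n → ℤ) → Submodule ℝ (Fin n → ℝ) := fun N => (realSpan N).map g.mulVecLin
  have hVinj : Function.Injective g.mulVecLin := by
    rw [← LinearMap.ker_eq_bot, LinearMap.ker_eq_bot']
    exact fun v hv => Matrix.eq_zero_of_mulVec_eq_zero (by rw [hg]; exact one_ne_zero) hv
  have hVrank : ∀ N, (pivots (V N)).card = Module.finrank ℤ N := fun N => by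
    rw [card_pivots, ← finrank_realSpan N]
    exact LinearEquiv.finrank_map_eq (LinearEquiv.ofInjectiveEndo g.mulVecLin hVinj) _
  have hXV : ∀ (N : S) w, X N *ᵥ w ∈ V N.1 := fun N w => by
    refine ⟨castM (basisMat N.1) *ᵥ w, ?_, ?_⟩
    · rw [(isBasisMat_basisMat N.1).realSpan_eq]
      exact ⟨w, rfl⟩
    · rw [Matrix.mulVecLin_apply, Matrix.mulVec_mulVec]
  let B : S → Finset (Fin n) := fun N => pivots (V N.1)
  have hBmono : StrictMono B := fun N N' h => by
    refine Finset.ssubset_iff_subset_ne.2 ⟨pivots_mono (Submodule.map_mono (realSpan_mono h.le)), fun he => ?_⟩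
    have h1 : Module.finrank ℤ N.1 = Module.finrank ℤ N'.1 := by
      rw [← hVrank, ← hVrank]
      exact congrArg Finset.card he
    exact h.ne (Subtype.ext (N.2.1.eq_of_le_of_finrank_le N'.2.1 h.le h1.ge))
  have hB0 : ∀ N, (B N).Nonempty := fun N => by
    rw [← Finset.card_pos]
    exact (hVrank N.1).symm ▸ N.2.2.1
  have hB1 : ∀ N, B N ≠ Finset.univ := fun N h => by
    have h1 := hVrank N.1
    have h2 : (B N).card = n := by rw [h, Finset.card_univ, Fintype.card_fin]
    have h3 := N.2.2.2
    change (B N).card = _ at h1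
    omega
  have e : ∀ N : S, Nonempty (Fin (k N) ≃ B N) := fun N =>
    ⟨Fintype.equivOfCardEq (by rw [Fintype.card_fin, Fintype.card_coe]; exact (hVrank N.1).symm)⟩
  let p : S → ℝ := fun N => Real.log |minor (X N) fun i => (e N).some i|
  have hp0 : ∀ N, minor (X N) (fun i => (e N).some i) ≠ 0 := fun N =>
    minor_pivots_ne_zero (hXV N) (hX0 N) (e N).some
  let η : S → ℝ := fun N => 1 / (1 + |p N|)
  have hη : ∀ N, 0 < η N := fun N => by positivity
  have hη1 : ∀ N, η N ≤ 1 := fun N => by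
    rw [div_le_one (by positivity)]
    linarith [abs_nonneg (p N)]
  have hηp : ∀ N, η N * |p N| ≤ 1 := fun N => by
    rw [one_div_mul_eq_div, div_le_one (by positivity)]
    linarith
  let β : S → ℝ := fun N => Real.log |minor (X N) (I N)| - 1
  have hinv : g⁻¹ * g = 1 := Matrix.nonsing_inv_mul g (by rw [hg]; exact isUnit_one)
  have hfin : ∀ H, {N | β N ≤ H}.Finite := fun H => by
    have h1 := finite_saturated (ι := Fin n) (∑ i, ∑ j, |g⁻¹ i j|) (Real.exp (H + 1))
    refine Set.Finite.of_finite_image (f := Subtype.val) (h1.subset ?_) Subtype.val_injective.injOn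
    rintro _ ⟨N, hN, rfl⟩
    refine ⟨N.2.1, g, g⁻¹, hinv, fun i j => ?_, fun f => ?_⟩
    · exact (Finset.single_le_sum (f := fun j => |g⁻¹ i j|) (fun _ _ => abs_nonneg _)
        (Finset.mem_univ j)).trans (Finset.single_le_sum (f := fun i => ∑ j, |g⁻¹ i j|)
        (fun _ _ => Finset.sum_nonneg fun _ _ => abs_nonneg _) (Finset.mem_univ i))
    · refine (hI N f).trans ?_
      rw [← Real.log_le_iff_le_exp (abs_pos.2 (hI0 N))]
      have : Real.log |minor (X N) (I N)| - 1 ≤ H := hN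
      linarith
  have hcount : Countable S := by
    have h1 : (⋃ j : ℕ, {N : S | β N ≤ j}) = Set.univ := by
      refine Set.eq_univ_of_forall fun N => ?_
      obtain ⟨j, hj⟩ := exists_nat_ge (β N)
      exact Set.mem_iUnion.2 ⟨j, hj⟩
    rw [← Set.countable_univ_iff, ← h1]
    exact Set.countable_iUnion fun j => (hfin j).countable
  obtain ⟨θ, hθ, hθbad⟩ : ∃ θ ∈ Set.Ioo (0 : ℝ) 1, ∀ T : Finset S,
      (∀ N ∈ T, ∀ N' ∈ T, N ≤ N' ∨ N' ≤ N) → ∀ (w : S → ℝ) (a : ℝ),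
      (∀ i, ∑ N ∈ T, w N * (label (I N) i + θ * (η N * if i ∈ B N then 1 else 0)) = a) →
      ∀ N ∈ T, w N = 0 := by
    have h1 : (⋃ T : {T : Finset S // ∀ N ∈ T, ∀ N' ∈ T, N ≤ N' ∨ N' ≤ N},
      {θ : ℝ | ∃ (w : S → ℝ) (a : ℝ),
        (∀ i, ∑ N ∈ T.1, w N * (label (I N) i + θ * (η N * if i ∈ B N then 1 else 0)) = a)
          ∧ ∃ N ∈ T.1, w N ≠ 0}).Countable := Set.countable_iUnion fun T =>
      (finite_dependent T.1 T.2 hBmono hB0 hB1 η hη fun N => label (I N)).countable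
    obtain ⟨θ, hθ, hθ'⟩ : ∃ θ ∈ Set.Ioo (0 : ℝ) 1, θ ∉ ⋃ T : {T : Finset S // ∀ N ∈ T, ∀ N' ∈ T, N ≤ N' ∨ N' ≤ N},
      {θ : ℝ | ∃ (w : S → ℝ) (a : ℝ),
        (∀ i, ∑ N ∈ T.1, w N * (label (I N) i + θ * (η N * if i ∈ B N then 1 else 0)) = a)
          ∧ ∃ N ∈ T.1, w N ≠ 0} := by
      by_contra! hsub
      exact absurd (Cardinal.Real.Ioo_countable_iff.1 (h1.mono hsub)) (by norm_num)
    refine ⟨θ, hθ, fun T hT w a hw N hN => ?_⟩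
    by_contra hne
    exact hθ' (Set.mem_iUnion.2 ⟨⟨T, hT⟩, w, a, hw, N, hN, hne⟩)
  let x : S → Fin n → ℝ := fun N i => label (I N) i + θ * (η N * if i ∈ B N then 1 else 0)
  have hlogneg : ∀ (N : S) t, psi (expDiag t * g) ε N.1 ≤ 0 → covolSq (expDiag t * g) N.1 ≤ 1 := by
    intro N t h
    rw [psi] at h
    have h1 : 0 ≤ ε * ((Module.finrank ℤ N.1 : ℝ) * (n - Module.finrank ℤ N.1)) := by
      have : (Module.finrank ℤ N.1 : ℝ) ≤ n := by exact_mod_cast N.2.2.2.le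
      exact mul_nonneg hε.le (mul_nonneg (Nat.cast_nonneg _) (by linarith))
    exact (Real.log_nonpos_iff (covolSq_nonneg _ _)).1 (by linarith)
  have hneg : ∀ t : Fin n → ℝ, ∑ i, t i = 0 → ∃ K : S, psi (expDiag t * g) ε K.1 ≤ -ε := by
    intro t ht
    obtain ⟨N, hN, hlt⟩ := hcon t ht
    have hpr : 0 < Module.finrank ℤ N ∧ Module.finrank ℤ N < n := by
      by_contra hnp
      have hle := finrank_le N
      have h1 : covolSq (expDiag t * g) N = 1 := by
        rcases Nat.eq_zero_or_pos (Module.finrank ℤ N) with h0 | h0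
        · exact covolSq_of_finrank_eq_zero _ h0
        · rw [covolSq_of_finrank_eq hN (by by_contra h2; exact hnp ⟨h0, by omega⟩),
            det_expDiag_mul ht hg, one_pow]
      linarith
    refine ⟨⟨N, hN, hpr⟩, ?_⟩
    simp only [psi]
    have h1 : Real.log (covolSq (expDiag t * g) N) < Real.log c :=
      Real.log_lt_log (covolSq_pos hg0 N) hlt
    have h2 : (Module.finrank ℤ N : ℝ) * (n - Module.finrank ℤ N) ≤ n ^ 2 := by
      have : (Module.finrank ℤ N : ℝ) ≤ n := by exact_mod_cast hpr.2.le
      have : (0 : ℝ) ≤ Module.finrank ℤ N := Nat.cast_nonneg _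
      nlinarith
    have h3 := mul_le_mul_of_nonneg_left h2 hε.le
    have h4 : (0 : ℝ) ≤ n ^ 2 := by positivity
    nlinarith
  refine covering_hyperplane (S := S) (ψ := fun N t => psi (expDiag t * g) ε N.1) (x := x) (β := β)
    (c := fun N N' => N ≤ N' ∨ N' ≤ N) (δ := ε) (C := n + 1) (fun N => ?_) (fun N t ht hN => ?_) hfin
    (fun N i => ?_) hε hneg (fun T w a hT hw => hθbad T hT w a hw)
    (fun t N N' ht h h' => ?_) (fun T hT => ?_)
  · unfold psi
    refine Continuous.add (Continuous.div_const (Continuous.log ?_ fun t => ?_) _) continuous_const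
    · exact (continuous_covolSq N.1).comp (continuous_expDiag.matrix_mul continuous_const)
    · exact (covolSq_pos hg0 N.1).ne'
  · have hq := hlogneg N t hN
    have h1 := sum_add_log_minor_nonpos hq (I N) (hI0 N)
    have h2 := sum_add_log_minor_nonpos hq _ (hp0 N)
    rw [← sum_label_mul] at h1 h2
    have h3 : ∑ i, x N i * t i = ∑ i, label (I N) i * t i
        + θ * η N * ∑ i, label (fun i => ((e N).some i : Fin n)) i * t i := by
      rw [Finset.mul_sum, ← Finset.sum_add_distrib]
      refine Finset.sum_congr rfl fun i _ => ?_
      rw [label_equiv]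
      simp only [x]
      ring
    rw [h3]
    have h4 : θ * η N * ∑ i, label (fun i => ((e N).some i : Fin n)) i * t i ≤ θ * η N * |p N| := by
      refine mul_le_mul_of_nonneg_left ?_ (mul_nonneg hθ.1.le (hη N).le)
      have := neg_abs_le (p N)
      change _ + p N ≤ 0 at h2
      linarith
    have h5 : θ * η N * |p N| ≤ 1 := by
      rw [mul_assoc]
      exact mul_le_one₀ hθ.2.le (mul_nonneg (hη N).le (abs_nonneg _)) (hηp N)
    change _ ≤ -(Real.log |minor (X N) (I N)| - 1)
    have h1' : ∑ i, label (I N) i * t i + Real.log |minor (X N) (I N)| ≤ 0 := h1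
    linarith
  · have h1 := label_nonneg (I N) i
    have h2 := label_le (I N) i
    have h3 : (Fintype.card (Fin (k N)) : ℝ) ≤ n := by
      rw [Fintype.card_fin]
      exact_mod_cast N.2.2.2.le
    have h4 : 0 ≤ θ * (η N * if i ∈ B N then 1 else 0) := by
      have := hθ.1.le
      have := (hη N).le
      split_ifs <;> positivity
    have h5 : θ * (η N * if i ∈ B N then 1 else 0) ≤ 1 := by
      have h6 : η N * (if i ∈ B N then 1 else 0) ≤ 1 := by
        have := hη1 N
        split_ifs <;> simp [this]
      have h7 : 0 ≤ η N * (if i ∈ B N then 1 else 0) := by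
        have := (hη N).le
        split_ifs <;> simp [this]
      exact mul_le_one₀ hθ.2.le h7 h6
    rw [abs_le]
    constructor <;> simp only [x] <;> linarith
  · by_contra hnc
    have hs := psi_submodular (hg0 (t := t)) hε N.2.1 N'.2.1 (fun h => hnc h)
    have hmin : ∀ P, Saturated P → psi (expDiag t * g) ε N.1 < psi (expDiag t * g) ε P + ε ∧
        psi (expDiag t * g) ε N'.1 < psi (expDiag t * g) ε P + ε := fun P hP => by
      by_cases hpr : 0 < Module.finrank ℤ P ∧ Module.finrank ℤ P < n
      · exact ⟨h ⟨P, hP, hpr⟩, h' ⟨P, hP, hpr⟩⟩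
      · rw [psi_trivial (det_expDiag_mul ht hg) ε hP hpr]
        obtain ⟨K, hK⟩ := hneg t ht
        have h1 := h K
        have h2 := h' K
        exact ⟨by linarith, by linarith⟩
    have h1 := hmin _ (N.2.1.inf N'.2.1)
    have h2 := hmin _ (saturated_sat (N.1 ⊔ N'.1))
    linarith [h1.1, h2.2]
  · have h1 : T.card ≤ (Finset.range n).card := by
      refine Finset.card_le_card_of_injOn k (fun N _ => Finset.mem_coe.2 (Finset.mem_range.2 N.2.2.2))
        fun N hN N' hN' hk => ?_
      rcases hT N hN N' hN' with h | h
      · exact Subtype.ext (N.2.1.eq_of_le_of_finrank_le N'.2.1 h hk.ge)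
      · exact (Subtype.ext (N'.2.1.eq_of_le_of_finrank_le N.2.1 h hk.le)).symm
    rwa [Finset.card_range] at h1

end NearStable

section Unimodular
variable {ι k l m : Type*} [Fintype ι] [DecidableEq ι] [Fintype k] [DecidableEq k] [Fintype l]
  [DecidableEq l] [Fintype m] [DecidableEq m]

/-- Integer matrices with an integer inverse. -/
def UniM (γ : Matrix ι k ℤ) : Prop := ∃ δ : Matrix k ι ℤ, γ * δ = 1 ∧ δ * γ = 1

lemma UniM.mul {γ : Matrix ι k ℤ} {γ' : Matrix k l ℤ} (h : UniM γ) (h' : UniM γ') :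
    UniM (γ * γ') := by
  obtain ⟨δ, h1, h2⟩ := h
  obtain ⟨δ', h1', h2'⟩ := h'
  refine ⟨δ' * δ, ?_, ?_⟩
  · rw [Matrix.mul_assoc, ← Matrix.mul_assoc γ', h1', Matrix.one_mul, h1]
  · rw [Matrix.mul_assoc, ← Matrix.mul_assoc δ, h2, Matrix.one_mul, h2']

lemma uniM_one : UniM (1 : Matrix ι ι ℤ) := ⟨1, by simp, by simp⟩

lemma UniM.submatrix {γ : Matrix ι k ℤ} (h : UniM γ) (e : l ≃ k) : UniM (γ.submatrix id e) := by
  obtain ⟨δ, h1, h2⟩ := h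
  refine ⟨δ.submatrix e id, ?_, ?_⟩
  · rw [Matrix.submatrix_mul_equiv, h1, Matrix.submatrix_id_id]
  · rw [← Matrix.submatrix_mul _ _ _ _ _ Function.bijective_id, h2, Matrix.submatrix_one_equiv]

lemma UniM.fromBlocks {γ : Matrix k l ℤ} (h : UniM γ) (u : Matrix ι l ℤ) :
    UniM (fromBlocks (1 : Matrix ι ι ℤ) u 0 γ) := by
  obtain ⟨δ, h1, h2⟩ := h
  refine ⟨Matrix.fromBlocks 1 (-(u * δ)) 0 δ, ?_, ?_⟩
  · simp [Matrix.fromBlocks_multiply, h1]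
  · simp [Matrix.fromBlocks_multiply, h2, Matrix.mul_assoc]

lemma UniM.det_sq {γ : Matrix ι ι ℤ} (h : UniM γ) : (castM γ).det ^ 2 = 1 := by
  obtain ⟨δ, h1, -⟩ := h
  have h2 : γ.det * δ.det = 1 := by rw [← Matrix.det_mul, h1, Matrix.det_one]
  rw [castM_det]
  rcases Int.isUnit_iff.1 (IsUnit.of_mul_eq_one _ h2) with h | h <;> simp [h]

lemma UniM.gramDet_mul {γ : Matrix ι k ℤ} (h : UniM γ) (e : ι ≃ k) (g : Matrix m ι ℝ) :
    gramDet (g * castM γ) = gramDet g := by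
  rw [← gramDet_submatrix_col (g * castM γ) e]
  have : (g * castM γ).submatrix id e = g * castM (γ.submatrix id e) := by
    ext i j; simp [Matrix.mul_apply]
  rw [this, SW.gramDet_mul, (h.submatrix e).det_sq, mul_one]

lemma castM_one : castM (1 : Matrix ι ι ℤ) = 1 := by
  ext i j
  by_cases h : i = j <;> simp [h, Matrix.one_apply]

lemma gramDet_fromRows_zero (X : Matrix m k ℝ) : gramDet (fromRows X (0 : Matrix l k ℝ)) = gramDet X := by
  rw [gramDet, Matrix.transpose_fromRows, Matrix.fromCols_mul_fromRows]
  simp [gramDet]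

lemma gramDet_fromBlocks (A : Matrix m m ℝ) (hA : A.det ≠ 0) (X : Matrix m l ℝ) (Y : Matrix k l ℝ) :
    gramDet (fromBlocks A X 0 Y) = A.det ^ 2 * gramDet Y := by
  have h1 : fromBlocks A X 0 Y = (fromBlocks A 0 0 Y : Matrix (m ⊕ k) (m ⊕ l) ℝ) *
      (fromBlocks 1 (A⁻¹ * X) 0 1 : Matrix (m ⊕ l) (m ⊕ l) ℝ) := by
    rw [Matrix.fromBlocks_multiply]
    simp [← Matrix.mul_assoc, Matrix.mul_nonsing_inv A hA.isUnit]
  rw [h1, gramDet_mul, Matrix.det_fromBlocks_zero₂₁]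
  rw [gramDet, Matrix.fromBlocks_transpose, Matrix.fromBlocks_multiply]
  simp [gramDet, sq]

lemma gramDet_mul_castM_submatrix (X : Matrix m ι ℝ) (M : Matrix ι k ℤ) (e : l ≃ k) :
    gramDet (X * castM (M.submatrix id e)) = gramDet (X * castM M) := by
  rw [← gramDet_submatrix_col (X * castM M) e]
  congr 1

/-- All sublattices have squared covolume at least `c`. -/
def NearStab (c : ℝ) (g : Matrix m ι ℝ) : Prop :=
  ∀ (r : ℕ) (M : Matrix ι (Fin r) ℤ), gramDet (castM M) ≠ 0 → c ≤ gramDet (g * castM M)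

lemma NearStab.le {c : ℝ} {g : Matrix m ι ℝ} (h : NearStab c g) (M : Matrix ι k ℤ)
    (hM : gramDet (castM M) ≠ 0) : c ≤ gramDet (g * castM M) := by
  have e := (Fintype.equivFin k).symm
  rw [← gramDet_mul_castM_submatrix g M e]
  refine h _ _ ?_
  rwa [← Matrix.one_mul (castM _), gramDet_mul_castM_submatrix, Matrix.one_mul]

lemma NearStab.mul_uniM {c : ℝ} {g : Matrix m ι ℝ} (h : NearStab c g) {γ : Matrix ι k ℤ}
    (hγ : UniM γ) : NearStab c (g * castM γ) := by
  intro r M hM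
  rw [Matrix.mul_assoc, ← castM_mul]
  refine h _ _ fun h0 => hM ?_
  rw [gramDet_castM_eq_zero_iff] at h0 ⊢
  obtain ⟨δ, -, h2⟩ := hγ
  obtain ⟨v, hv, h0⟩ := h0
  refine ⟨v, hv, ?_⟩
  rw [← Matrix.one_mulVec (M *ᵥ v), ← h2, ← Matrix.mulVec_mulVec, Matrix.mulVec_mulVec v, h0,
    Matrix.mulVec_zero]

lemma NearStab.orth {c : ℝ} {g : Matrix m ι ℝ} (h : NearStab c g) {O : Matrix l m ℝ}
    (hO : Oᵀ * O = 1) : NearStab c (O * g) := by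
  intro r M hM
  rw [Matrix.mul_assoc, gramDet_mul_left_of_orthogonal hO]
  exact h _ _ hM

lemma NearStab.mono {c c' : ℝ} {g : Matrix m ι ℝ} (h : NearStab c g) (hc : c' ≤ c) :
    NearStab c' g := fun r M hM => hc.trans (h r M hM)

lemma NearStab.covolSq_le {c : ℝ} {g : Matrix m ι ℝ} (h : NearStab c g) (N : Submodule ℤ (ι → ℤ)) :
    c ≤ covolSq g N := h _ _ (isBasisMat_basisMat N).gramDet_ne_zero

lemma isBasisMat_range {M : Matrix ι k ℤ} (hM : gramDet (castM M) ≠ 0) :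
    IsBasisMat M (LinearMap.range M.mulVecLin) := by
  refine ⟨?_, fun x => Iff.rfl⟩
  have : Function.Injective M.mulVecLin := by
    rw [← LinearMap.ker_eq_bot, LinearMap.ker_eq_bot']
    intro v hv
    by_contra hne
    exact hM ((gramDet_castM_eq_zero_iff M).2 ⟨v, hne, hv⟩)
  exact this

lemma nearStab_of_saturated {c : ℝ} {g : Matrix ι ι ℝ}
    (h : ∀ N, Saturated N → c ≤ covolSq g N) : NearStab c g := by
  intro r M hM
  have hb := isBasisMat_range hM
  rw [← hb.covolSq_eq]
  exact (h _ (saturated_sat _)).trans (covolSq_sat_le g _)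

lemma NearStab.block₁₁ {c : ℝ} {A : Matrix m ι ℝ} {B : Matrix m k ℝ} {D : Matrix l k ℝ}
    (h : NearStab c (fromBlocks A B 0 D)) : NearStab c A := by
  intro r M hM
  have h1 := h.le (fromRows M (0 : Matrix k (Fin r) ℤ)) (by
    have : castM (fromRows M (0 : Matrix k (Fin r) ℤ)) = fromRows (castM M) 0 := by
      ext (i | i) j <;> simp
    rwa [this, gramDet_fromRows_zero])
  have : fromBlocks A B 0 D * castM (fromRows M (0 : Matrix k (Fin r) ℤ))
      = fromRows (A * castM M) 0 := by
    ext (i | i) j <;> simp [Matrix.mul_apply]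
  rwa [this, gramDet_fromRows_zero] at h1

lemma NearStab.block₂₂ {c : ℝ} {A : Matrix m m ℝ} {B : Matrix m k ℝ} {D : Matrix l k ℝ}
    (h : NearStab c (fromBlocks A B 0 D)) (hA : A.det ≠ 0) : NearStab (c / A.det ^ 2) D := by
  intro r M hM
  have h1 := h.le (fromBlocks (1 : Matrix m m ℤ) 0 0 M) (by
    have : castM (fromBlocks (1 : Matrix m m ℤ) 0 0 M) = fromBlocks 1 0 0 (castM M) := by
      rw [castM, Matrix.fromBlocks_map, ← castM_one]
      congr 1 <;> ext <;> simp
    rw [this, gramDet_fromBlocks _ (by simp)]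
    simpa using hM)
  have : fromBlocks A B 0 D * castM (fromBlocks (1 : Matrix m m ℤ) 0 0 M)
      = fromBlocks A (B * castM M) 0 (D * castM M) := by
    have : castM (fromBlocks (1 : Matrix m m ℤ) 0 0 M) = fromBlocks 1 0 0 (castM M) := by
      rw [castM, Matrix.fromBlocks_map, ← castM_one]
      congr 1 <;> ext <;> simp
    rw [this, Matrix.fromBlocks_multiply]
    simp
  rw [this, gramDet_fromBlocks _ hA] at h1
  rwa [div_le_iff₀ (by positivity), mul_comm]

end Unimodular

section Block
variable {d r s : ℕ}

lemma exists_orthogonal_block (hs : r + s = d) (X : Matrix (Fin d) (Fin r ⊕ Fin s) ℝ)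
    (hX : LinearIndependent ℝ fun j : Fin r => X.col (Sum.inl j)) :
    ∃ O : Matrix (Fin r ⊕ Fin s) (Fin d) ℝ, Oᵀ * O = 1 ∧ O * Oᵀ = 1 ∧ (O * X).toBlocks₂₁ = 0 := by
  let v : Fin r → EuclideanSpace ℝ (Fin d) := fun j => WithLp.toLp 2 (X.col (Sum.inl j))
  have hv : LinearIndependent ℝ v :=
    hX.map' (WithLp.linearEquiv 2 ℝ (Fin d → ℝ)).symm.toLinearMap (LinearEquiv.ker _)
  let W : Submodule ℝ (EuclideanSpace ℝ (Fin d)) := Submodule.span ℝ (Set.range v)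
  have h1 : Module.finrank ℝ W = r := by
    rw [finrank_span_eq_card hv, Fintype.card_fin]
  have h2 : Module.finrank ℝ Wᗮ = s := by
    have := Submodule.finrank_add_finrank_orthogonal W
    rw [h1, finrank_euclideanSpace_fin] at this
    omega
  let b1 := (stdOrthonormalBasis ℝ W).reindex (finCongr h1)
  let b2 := (stdOrthonormalBasis ℝ Wᗮ).reindex (finCongr h2)
  let O : Matrix (Fin r ⊕ Fin s) (Fin d) ℝ := fun i j =>
    Sum.elim (fun a => (b1 a : EuclideanSpace ℝ (Fin d)) j) (fun a => (b2 a : EuclideanSpace ℝ (Fin d)) j) i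
  have hin : ∀ x y : EuclideanSpace ℝ (Fin d), ∑ j, x j * y j = inner ℝ x y := fun x y => by
    simp [PiLp.inner_apply, mul_comm]
  have hO : O * Oᵀ = 1 := by
    ext i j
    rcases i with a | a <;> rcases j with b | b
    · have h := (orthonormal_iff_ite.1 b1.orthonormal) a b
      rw [Submodule.coe_inner, ← hin] at h
      refine Eq.trans h ?_
      simp [Matrix.one_apply]
    · have h : inner ℝ (b1 a : EuclideanSpace ℝ (Fin d)) (b2 b) = 0 := (b2 b).2 _ (b1 a).2
      rw [← hin] at h
      refine Eq.trans h ?_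
      simp
    · have h := Submodule.inner_left_of_mem_orthogonal (b1 b).2 (b2 a).2
      rw [← hin] at h
      refine Eq.trans h ?_
      simp
    · have h := (orthonormal_iff_ite.1 b2.orthonormal) a b
      rw [Submodule.coe_inner, ← hin] at h
      refine Eq.trans h ?_
      simp [Matrix.one_apply]
  refine ⟨O, ?_, hO, ?_⟩
  · rwa [Matrix.mul_eq_one_comm_of_card_eq]
    simp [hs]
  · ext a b
    have h := Submodule.inner_left_of_mem_orthogonal
      (Submodule.subset_span ⟨b, rfl⟩ : v b ∈ W) (b2 a).2
    rw [← hin] at h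
    exact h

/-- Block triangular form adapted to a saturated sublattice. -/
theorem exists_block {g : Matrix (Fin d) (Fin d) ℝ} (hg : g.det ≠ 0) {N : Submodule ℤ (Fin d → ℤ)}
    (hN : Saturated N) (hr : Module.finrank ℤ N = r) (hs : r + s = d) :
    ∃ (γ : Matrix (Fin d) (Fin r ⊕ Fin s) ℤ) (O : Matrix (Fin r ⊕ Fin s) (Fin d) ℝ)
      (A : Matrix (Fin r) (Fin r) ℝ) (B : Matrix (Fin r) (Fin s) ℝ) (D : Matrix (Fin s) (Fin s) ℝ),
      UniM γ ∧ Oᵀ * O = 1 ∧ O * Oᵀ = 1 ∧ O * (g * castM γ) = fromBlocks A B 0 D ∧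
      covolSq g N = A.det ^ 2 ∧ A.det ^ 2 * D.det ^ 2 = g.det ^ 2 := by
  obtain ⟨C, hC⟩ := hN.exists_isCompl
  have hC2 : Module.finrank ℤ C = s := by
    have := ((isBasisMat_basisMat N).fromCols (isBasisMat_basisMat C) hC.disjoint).finrank_eq
    rw [hC.sup_eq_top, finrank_top, Module.finrank_fintype_fun_eq_card, Fintype.card_fin,
      Fintype.card_sum, Fintype.card_fin, Fintype.card_fin, hr] at this
    omega
  let M1 : Matrix (Fin d) (Fin r) ℤ := (basisMat N).submatrix id (finCongr hr.symm)
  let M2 : Matrix (Fin d) (Fin s) ℤ := (basisMat C).submatrix id (finCongr hC2.symm)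
  have hsub : ∀ {P : Submodule ℤ (Fin d → ℤ)} {k : ℕ} (h : Module.finrank ℤ P = k),
      IsBasisMat ((basisMat P).submatrix id (finCongr h.symm)) P := by
    rintro P k rfl
    exact isBasisMat_basisMat P
  have hM1 : IsBasisMat M1 N := hsub hr
  have hγ := hM1.fromCols (hsub hC2 : IsBasisMat M2 C) hC.disjoint
  rw [hC.sup_eq_top] at hγ
  set γ := Matrix.fromCols M1 M2
  have hU : UniM γ := by
    obtain ⟨δ, hδ⟩ := exists_mul_of_col_mem hγ (1 : Matrix (Fin d) (Fin d) ℤ) (fun j => trivial)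
    refine ⟨δ, hδ.symm, ?_⟩
    rw [Matrix.mul_eq_one_comm_of_card_eq, ← hδ]
    simp [hs]
  have hgX : gramDet (g * castM M1) ≠ 0 := by
    rw [Ne, gramDet_mul_left_eq_zero_iff hg]
    exact hM1.gramDet_ne_zero
  obtain ⟨O, hO1, hO2, hO3⟩ := exists_orthogonal_block hs (g * castM γ)
    ((gramDet_ne_zero_iff_linearIndependent _).1 hgX)
  set Z := O * (g * castM γ)
  have hZ : Z = fromBlocks Z.toBlocks₁₁ Z.toBlocks₁₂ 0 Z.toBlocks₂₂ := by
    rw [← hO3, Matrix.fromBlocks_toBlocks]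
  refine ⟨γ, O, Z.toBlocks₁₁, Z.toBlocks₁₂, Z.toBlocks₂₂, hU, hO1, hO2, hZ, ?_, ?_⟩
  · rw [hM1.covolSq_eq, ← gramDet_mul_left_of_orthogonal hO1]
    have : O * (g * castM M1) = fromRows Z.toBlocks₁₁ 0 := by
      rw [← hO3]
      ext (i | i) j <;> rfl
    rw [this, gramDet_fromRows_zero, gramDet_square]
  · have h1 : gramDet Z = g.det ^ 2 := by
      rw [gramDet_mul_left_of_orthogonal hO1,
        hU.gramDet_mul ((finCongr hs.symm).trans finSumFinEquiv.symm), gramDet_square]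
    rw [← h1, hZ, gramDet_square, Matrix.det_fromBlocks_zero₂₁]
    simp
    ring

end Block

section Mahler

/-- The squared Euclidean norm. -/
def nsq {ι : Type*} [Fintype ι] (v : ι → ℝ) : ℝ := ∑ i, v i ^ 2

lemma nsq_eq_dotProduct {ι : Type*} [Fintype ι] (v : ι → ℝ) : nsq v = v ⬝ᵥ v := by
  simp [nsq, dotProduct, sq]

lemma nsq_nonneg {ι : Type*} [Fintype ι] (v : ι → ℝ) : 0 ≤ nsq v :=
  Finset.sum_nonneg fun _ _ => sq_nonneg _

lemma nsq_mulVec_of_orthogonal {ι κ : Type*} [Fintype ι] [Fintype κ] [DecidableEq κ]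
    {O : Matrix ι κ ℝ} (hO : Oᵀ * O = 1) (v : κ → ℝ) : nsq (O *ᵥ v) = nsq v := by
  rw [nsq_eq_dotProduct, nsq_eq_dotProduct, Matrix.dotProduct_mulVec, Matrix.vecMul_mulVec, hO,
    Matrix.vecMul_one]

/-- Minkowski's theorem: short integral vectors. -/
lemma exists_short {n : ℕ} {g : Matrix (Fin n) (Fin n) ℝ} (hg : g.det ≠ 0) {a : ℝ} (ha : 0 < a)
    (h : |g.det| < a ^ n) : ∃ m : Fin n → ℤ, m ≠ 0 ∧ ∀ i, |(g *ᵥ castV m) i| < a := by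
  let b := Pi.basisFun ℝ (Fin n)
  have hfund := ZSpan.isAddFundamentalDomain' b MeasureTheory.volume
  set s : Set (Fin n → ℝ) := g.mulVecLin ⁻¹' Metric.ball 0 a
  have hdet : LinearMap.det g.mulVecLin = g.det := LinearMap.det_toLin' g
  have hs : MeasureTheory.volume s = ENNReal.ofReal (|g.det|⁻¹ * (2 * a) ^ n) := by
    rw [MeasureTheory.Measure.addHaar_preimage_linearMap _ (by rwa [hdet]), hdet,
      Real.volume_pi_ball _ ha, Fintype.card_fin, ← ENNReal.ofReal_mul (abs_nonneg _), abs_inv]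
  have hF : MeasureTheory.volume (ZSpan.fundamentalDomain b) = 1 := by
    rw [ZSpan.fundamentalDomain_pi_basisFun, MeasureTheory.volume_pi_pi]
    simp
  have : Countable (Submodule.span ℤ (Set.range b)).toAddSubgroup :=
    inferInstanceAs (Countable (Submodule.span ℤ (Set.range b)))
  have hsym : ∀ x ∈ s, -x ∈ s := fun x hx => by
    change g.mulVecLin (-x) ∈ Metric.ball 0 a
    rw [map_neg, mem_ball_zero_iff, norm_neg, ← mem_ball_zero_iff]
    exact hx
  have hconv : Convex ℝ s := (convex_ball (0 : Fin n → ℝ) a).linear_preimage _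
  have hvol : MeasureTheory.volume (ZSpan.fundamentalDomain b) * 2 ^ Module.finrank ℝ (Fin n → ℝ)
      < MeasureTheory.volume s := by
    rw [hF, hs, one_mul, Module.finrank_fin_fun]
    have h2 : (2 : ENNReal) ^ n = ENNReal.ofReal (2 ^ n) := by
      rw [ENNReal.ofReal_pow (by norm_num)]
      simp
    rw [h2, ENNReal.ofReal_lt_ofReal_iff_of_nonneg (by positivity), inv_mul_eq_div,
      lt_div_iff₀ (abs_pos.2 hg), mul_pow]
    gcongr
  obtain ⟨⟨x, hxL⟩, hx0, hx⟩ :=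
    MeasureTheory.exists_ne_zero_mem_lattice_of_measure_mul_two_pow_lt_measure hfund hsym hconv hvol
  have hx' : x ∈ Submodule.span ℤ (Set.range b) := hxL
  rw [Module.Basis.mem_span_iff_repr_mem] at hx'
  choose m hm using hx'
  have hxm : x = castV m := by
    ext i
    simpa [b] using (hm i).symm
  refine ⟨m, ?_, fun i => ?_⟩
  · rintro rfl
    refine hx0 (Subtype.ext ?_)
    change x = 0
    rw [hxm]
    ext i
    simp
  · have h1 : g *ᵥ castV m ∈ Metric.ball (0 : Fin n → ℝ) a := by rw [← hxm]; exact hx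
    rw [mem_ball_zero_iff] at h1
    exact (norm_le_pi_norm (g *ᵥ castV m) i).trans_lt h1
/-- Mahler's compactness criterion, in terms of reduced bases. -/
theorem mahler (n : ℕ) : ∀ c H : ℝ, 0 < c → 0 ≤ H → ∃ C : ℝ, ∀ g : Matrix (Fin n) (Fin n) ℝ,
    g.det ≠ 0 → |g.det| ≤ H → NearStab c g →
      ∃ γ : Matrix (Fin n) (Fin n) ℤ, UniM γ ∧ ∀ j, nsq ((g * castM γ).col j) ≤ C := by
  induction n with
  | zero => exact fun c H _ _ => ⟨0, fun g _ _ _ => ⟨1, uniM_one, fun j => j.elim0⟩⟩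
  | succ n ih =>
    intro c H hc hH
    set a := H + 1
    have ha : 0 < a := by positivity
    set A : ℝ := (n + 1) * a ^ 2
    have hA : 0 < A := by positivity
    obtain ⟨C2, hC2⟩ := ih (c / A) (H / √c) (by positivity) (by positivity)
    refine ⟨A + |C2|, fun g hg hgH hs => ?_⟩
    obtain ⟨m, hm, hma⟩ := exists_short hg ha (by
      calc |g.det| ≤ H := hgH
        _ < a := by simp [a]
        _ ≤ a ^ (n + 1) := le_self_pow₀ (by simp [a, hH]) (by simp))
    let M : Matrix (Fin (n + 1)) (Fin 1) ℤ := fun i _ => m i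
    have hM : gramDet (castM M) ≠ 0 := by
      rw [Ne, gramDet_castM_eq_zero_iff]
      rintro ⟨v, hv, h0⟩
      refine hm (funext fun i => ?_)
      have h1 := congrFun h0 i
      simp only [Matrix.mulVec, dotProduct, Finset.univ_unique, Fin.default_eq_zero, Finset.sum_singleton,
        Pi.zero_apply, M, mul_eq_zero] at h1
      refine h1.resolve_right fun h2 => hv (funext fun j => ?_)
      rw [Subsingleton.elim j 0, h2]; rfl
    have hb := isBasisMat_range hM
    set N := sat (LinearMap.range M.mulVecLin)
    have hNA : covolSq g N ≤ A := by
      refine (covolSq_sat_le g _).trans ?_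
      rw [hb.covolSq_eq, gramDet, Matrix.det_unique]
      have h1 : ((g * castM M)ᵀ * (g * castM M)) default default = ∑ i, (g *ᵥ castV m) i ^ 2 := by
        simp only [Matrix.mul_apply, Matrix.transpose_apply, sq]
        rfl
      rw [h1]
      refine (Finset.sum_le_card_nsmul _ _ (a ^ 2) fun i _ => ?_).trans_eq (by simp [A])
      rw [← sq_abs]
      exact pow_le_pow_left₀ (abs_nonneg _) (hma i).le 2
    have hNr : Module.finrank ℤ N = 1 := by rw [finrank_sat, hb.finrank_eq, Fintype.card_fin]
    obtain ⟨γ, O, G, B, D, hγ, hO1, hO2, hblock, hcov, hdet⟩ :=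
      exists_block hg (saturated_sat _) hNr (add_comm 1 n)
    have hGc : c ≤ G.det ^ 2 := hcov ▸ hs.covolSq_le N
    have hGA : G.det ^ 2 ≤ A := hcov ▸ hNA
    have hG0 : G.det ≠ 0 := fun h => by rw [h] at hGc; norm_num at hGc; linarith
    have hstab := (hs.mul_uniM hγ).orth hO1
    rw [hblock] at hstab
    obtain ⟨γ2, hγ2, hcol⟩ := hC2 D (fun h => by
        rw [h] at hdet
        exact hg (by simpa using hdet.symm)) (by
        rw [le_div_iff₀ (by positivity)]
        refine le_of_sq_le_sq ?_ hH
        rw [mul_pow, Real.sq_sqrt hc.le, sq_abs]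
        calc D.det ^ 2 * c ≤ D.det ^ 2 * G.det ^ 2 := by gcongr
          _ = |g.det| ^ 2 := by rw [mul_comm, hdet, sq_abs]
          _ ≤ H ^ 2 := by gcongr)
      ((hstab.block₂₂ hG0).mono (by gcongr))
    have hGdet : G.det = G 0 0 := by rw [Matrix.det_unique]; rfl
    let u : Matrix (Fin 1) (Fin n) ℤ := fun _ j => round (-(B * castM γ2) 0 j / G.det)
    have hprod : O * (g * castM (γ * (fromBlocks 1 u 0 γ2 : Matrix (Fin 1 ⊕ Fin n) (Fin 1 ⊕ Fin n) ℤ))) =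
        fromBlocks G (G * castM u + B * castM γ2) 0 (D * castM γ2) := by
      have h1 : castM (fromBlocks (1 : Matrix (Fin 1) (Fin 1) ℤ) u 0 γ2)
          = fromBlocks 1 (castM u) 0 (castM γ2) := by
        rw [castM, Matrix.fromBlocks_map, ← castM_one]
        congr 1; ext; simp
      rw [castM_mul, ← Matrix.mul_assoc g, ← Matrix.mul_assoc O, hblock, h1,
        Matrix.fromBlocks_multiply]
      simp
    have hbound : ∀ j, nsq ((g * castM (γ * (fromBlocks 1 u 0 γ2 : Matrix (Fin 1 ⊕ Fin n) (Fin 1 ⊕ Fin n) ℤ))).col j) ≤ A + |C2| := by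
      intro j
      rw [← nsq_mulVec_of_orthogonal hO1]
      have h1 : O *ᵥ (g * castM (γ * (fromBlocks 1 u 0 γ2 : Matrix (Fin 1 ⊕ Fin n) (Fin 1 ⊕ Fin n) ℤ))).col j =
          (fromBlocks G (G * castM u + B * castM γ2) 0 (D * castM γ2)).col j := by
        rw [← hprod]; rfl
      rw [h1, nsq, Fintype.sum_sum_type]
      rcases j with j | j
      · have : ∑ i, (fromBlocks G (G * castM u + B * castM γ2) 0 (D * castM γ2)).col (Sum.inl j) (Sum.inl i) ^ 2
            = G.det ^ 2 := by
          simp [Subsingleton.elim j 0]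
        rw [this]
        simp only [Matrix.col_apply, Matrix.fromBlocks_apply₂₁, Matrix.zero_apply]
        simp only [ne_eq, OfNat.ofNat_ne_zero, not_false_eq_true, zero_pow, Finset.sum_const_zero]
        linarith [abs_nonneg C2]
      · refine add_le_add ?_ ((hcol j).trans (le_abs_self _))
        have h2 : (G * castM u + B * castM γ2) 0 j =
            G.det * (round (-(B * castM γ2) 0 j / G.det) - (-(B * castM γ2) 0 j / G.det)) := by
          rw [mul_sub, mul_div_cancel₀ _ hG0, sub_neg_eq_add, hGdet, Matrix.add_apply]
          have h3 : (G * castM u) 0 j = G 0 0 * (u 0 j : ℝ) := by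
            simp [Matrix.mul_apply]
          rw [h3, hGdet.symm]
        simp only [Finset.univ_unique, Fin.default_eq_zero, Finset.sum_singleton, Matrix.col_apply,
          Matrix.fromBlocks_apply₁₂]
        rw [h2, mul_pow]
        have h3 := abs_sub_round (-(B * castM γ2) 0 j / G.det)
        rw [abs_sub_comm] at h3
        have h4 := pow_le_pow_left₀ (abs_nonneg _) h3 2
        rw [sq_abs] at h4
        nlinarith [sq_nonneg (G.det)]
    let e : Fin (n + 1) ≃ Fin 1 ⊕ Fin n := (finCongr (add_comm n 1)).trans finSumFinEquiv.symm
    exact ⟨_, (hγ.mul (hγ2.fromBlocks u)).submatrix e, fun j => hbound (e j)⟩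

end Mahler

section Covering
variable {ι κ m l : Type*} [Fintype ι] [DecidableEq ι] [Fintype κ] [DecidableEq κ] [Fintype m]
  [DecidableEq m] [Fintype l] [DecidableEq l]

/-- The squared covering radius of `g·ℤ^ι` is at most `q`. -/
def CovSq (g : Matrix m ι ℝ) (q : ℝ) : Prop :=
  ∀ q' > q, ∀ u : m → ℝ, ∃ z : ι → ℤ, nsq (u - g *ᵥ castV z) < q'

lemma CovSq.mono {g : Matrix m ι ℝ} {q q' : ℝ} (h : CovSq g q) (hq : q ≤ q') : CovSq g q' :=
  fun r hr => h r (hq.trans_lt hr)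

lemma CovSq.of_orth {g : Matrix m ι ℝ} {O : Matrix l m ℝ} {q : ℝ} (hO : Oᵀ * O = 1)
    (h : CovSq (O * g) q) : CovSq g q := fun r hr u => by
  obtain ⟨z, hz⟩ := h r hr (O *ᵥ u)
  refine ⟨z, ?_⟩
  rwa [← Matrix.mulVec_mulVec, ← Matrix.mulVec_sub, nsq_mulVec_of_orthogonal hO] at hz

lemma CovSq.of_mul {g : Matrix m ι ℝ} {γ : Matrix ι κ ℤ} {q : ℝ} (h : CovSq (g * castM γ) q) :
    CovSq g q := fun r hr u => by
  obtain ⟨z, hz⟩ := h r hr u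
  exact ⟨γ *ᵥ z, by rwa [← castM_mulVec, Matrix.mulVec_mulVec]⟩

lemma CovSq.fromBlocks {A : Matrix m ι ℝ} {B : Matrix m κ ℝ} {D : Matrix l κ ℝ} {p q : ℝ}
    (hA : CovSq A p) (hD : CovSq D q) : CovSq (fromBlocks A B 0 D) (p + q) := fun r hr u => by
  obtain ⟨y, hy⟩ := hD (q + (r - (p + q)) / 2) (by linarith) (u ∘ Sum.inr)
  obtain ⟨x, hx⟩ := hA (p + (r - (p + q)) / 2) (by linarith) (u ∘ Sum.inl - B *ᵥ castV y)
  refine ⟨Sum.elim x y, ?_⟩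
  have h1 : (castV (Sum.elim x y) : ι ⊕ κ → ℝ) = Sum.elim (castV x) (castV y) := by
    ext (i | i) <;> rfl
  have h2 : nsq (u - (Matrix.fromBlocks A B 0 D) *ᵥ Sum.elim (castV x) (castV y))
      = nsq (u ∘ Sum.inl - B *ᵥ castV y - A *ᵥ castV x) + nsq (u ∘ Sum.inr - D *ᵥ castV y) := by
    rw [Matrix.fromBlocks_mulVec, nsq, Fintype.sum_sum_type, nsq, nsq]
    simp only [Pi.sub_apply, Sum.elim_inl, Sum.elim_inr, Pi.add_apply, Function.comp_apply,
      Sum.elim_comp_inl, Sum.elim_comp_inr, Matrix.zero_mulVec, zero_add]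
    congr 1
    exact Finset.sum_congr rfl fun i _ => by ring
  rw [h1, h2]
  linarith

lemma CovSq.mul_left {g : Matrix m ι ℝ} {h h' : Matrix m m ℝ} {K q : ℝ} (hg : CovSq g q)
    (hK : 0 < K) (hh : ∀ v, nsq (h *ᵥ v) ≤ K * nsq v) (hinv : h * h' = 1) :
    CovSq (h * g) (K * q) := fun r hr u => by
  obtain ⟨z, hz⟩ := hg (r / K) (by rwa [gt_iff_lt, lt_div_iff₀ hK, mul_comm]) (h' *ᵥ u)
  refine ⟨z, ?_⟩
  have h1 : u - (h * g) *ᵥ castV z = h *ᵥ (h' *ᵥ u - g *ᵥ castV z) := by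
    rw [Matrix.mulVec_sub, Matrix.mulVec_mulVec, hinv, Matrix.one_mulVec, Matrix.mulVec_mulVec]
  rw [h1]
  refine (hh _).trans_lt ?_
  rwa [lt_div_iff₀ hK, mul_comm] at hz

/-- The squared Frobenius norm. -/
def frob (X : Matrix m ι ℝ) : ℝ := ∑ i, ∑ j, X i j ^ 2

lemma frob_nonneg (X : Matrix m ι ℝ) : 0 ≤ frob X :=
  Finset.sum_nonneg fun _ _ => Finset.sum_nonneg fun _ _ => sq_nonneg _

lemma continuous_frob : Continuous (frob : Matrix m ι ℝ → ℝ) := by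
  unfold frob
  fun_prop

lemma nsq_mulVec_le (X : Matrix m ι ℝ) (v : ι → ℝ) : nsq (X *ᵥ v) ≤ frob X * nsq v := by
  rw [frob, Finset.sum_mul]
  exact Finset.sum_le_sum fun i _ => Finset.sum_mul_sq_le_sq_mul_sq _ _ _

lemma nsq_eq_norm_sq (v : ι → ℝ) : nsq v = ‖WithLp.toLp 2 v‖ ^ 2 := by
  rw [EuclideanSpace.norm_sq_eq, nsq]
  simp

lemma nsq_mulVec_le_of_near_one (h : Matrix m m ℝ) (v : m → ℝ) :
    nsq (h *ᵥ v) ≤ (1 + √(frob (h - 1))) ^ 2 * nsq v := by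
  have h1 : h *ᵥ v = v + (h - 1) *ᵥ v := by rw [Matrix.sub_mulVec, Matrix.one_mulVec]; abel
  have h2 : ‖WithLp.toLp 2 ((h - 1) *ᵥ v)‖ ≤ √(frob (h - 1)) * ‖WithLp.toLp 2 v‖ := by
    refine le_of_sq_le_sq ?_ (by positivity)
    rw [mul_pow, Real.sq_sqrt (frob_nonneg _), ← nsq_eq_norm_sq, ← nsq_eq_norm_sq]
    exact nsq_mulVec_le _ _
  rw [nsq_eq_norm_sq, nsq_eq_norm_sq, ← mul_pow]
  refine pow_le_pow_left₀ (norm_nonneg _) ?_ 2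
  rw [h1, WithLp.toLp_add]
  refine (norm_add_le _ _).trans ?_
  linarith

lemma covSq_frob {g : Matrix ι ι ℝ} (hg : g.det ≠ 0) : CovSq g (frob g * Fintype.card ι) := by
  intro r hr u
  refine ⟨fun i => round ((g⁻¹ *ᵥ u) i), lt_of_le_of_lt ?_ hr⟩
  have h1 : u - g *ᵥ castV (fun i => round ((g⁻¹ *ᵥ u) i))
      = g *ᵥ (g⁻¹ *ᵥ u - castV fun i => round ((g⁻¹ *ᵥ u) i)) := by
    rw [Matrix.mulVec_sub, Matrix.mulVec_mulVec, Matrix.mul_nonsing_inv _ hg.isUnit, Matrix.one_mulVec]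
  rw [h1]
  refine (nsq_mulVec_le _ _).trans (mul_le_mul_of_nonneg_left ?_ (frob_nonneg _))
  refine (Finset.sum_le_card_nsmul _ _ 1 fun i _ => ?_).trans_eq (by simp)
  rw [← sq_abs, sq_le_one_iff₀ (abs_nonneg _)]
  exact (abs_sub_round _).trans (by norm_num)

end Covering

section CoveringRadius
variable {n : ℕ}

lemma mem_latticeOf {g : Matrix (Fin n) (Fin n) ℝ} {v : Fin n → ℝ} :
    v ∈ latticeOf g ↔ ∃ z : Fin n → ℤ, g *ᵥ castV z = v := by
  constructor
  · intro h
    induction h using AddSubgroup.closure_induction with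
    | mem x hx => exact hx
    | zero => exact ⟨0, by rw [show castV (0 : Fin n → ℤ) = 0 by ext; simp [castV], Matrix.mulVec_zero]⟩
    | add x y _ _ hx hy =>
      obtain ⟨a, rfl⟩ := hx
      obtain ⟨b, rfl⟩ := hy
      exact ⟨a + b, by rw [← Matrix.mulVec_add]; congr 1; ext; simp [castV]⟩
    | neg x _ hx =>
      obtain ⟨a, rfl⟩ := hx
      exact ⟨-a, by rw [← Matrix.mulVec_neg]; congr 1; ext; simp [castV]⟩
  · rintro ⟨z, rfl⟩
    exact AddSubgroup.subset_closure ⟨z, rfl⟩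

lemma latticeOf_mul_uniM (g : Matrix (Fin n) (Fin n) ℝ) {γ : Matrix (Fin n) (Fin n) ℤ}
    (hγ : UniM γ) : latticeOf (g * castM γ) = latticeOf g := by
  obtain ⟨δ, h1, -⟩ := hγ
  ext v
  rw [mem_latticeOf, mem_latticeOf]
  constructor
  · rintro ⟨z, rfl⟩
    exact ⟨γ *ᵥ z, by rw [← castM_mulVec, Matrix.mulVec_mulVec]⟩
  · rintro ⟨z, rfl⟩
    exact ⟨δ *ᵥ z, by rw [← Matrix.mulVec_mulVec, castM_mulVec, Matrix.mulVec_mulVec, h1,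
      Matrix.one_mulVec]⟩

lemma bddBelow_enorm (L : AddSubgroup (Fin n → ℝ)) (u : Fin n → ℝ) :
    BddBelow (Set.range fun v : L => enorm (u - (v : Fin n → ℝ))) :=
  ⟨0, by rintro _ ⟨v, rfl⟩; exact Real.sqrt_nonneg _⟩

lemma CovSq.iInf_le {g : Matrix (Fin n) (Fin n) ℝ} {q : ℝ} (h : CovSq g q)
    (u : Fin n → ℝ) : ⨅ v : latticeOf g, enorm (u - (v : Fin n → ℝ)) ≤ √q := by
  refine le_of_forall_gt_imp_ge_of_dense fun r hr => ?_
  have hr0 : 0 < r := (Real.sqrt_nonneg q).trans_lt hr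
  obtain ⟨z, hz⟩ := h (r ^ 2) ((Real.sqrt_lt' hr0).1 hr) u
  refine ciInf_le_of_le (bddBelow_enorm _ u) ⟨_, mem_latticeOf.2 ⟨z, rfl⟩⟩ ?_
  exact ((Real.sqrt_lt' hr0).2 hz).le

lemma CovSq.covrad_le {g : Matrix (Fin n) (Fin n) ℝ} {q : ℝ} (h : CovSq g q) :
    covrad (latticeOf g) ≤ √q := ciSup_le h.iInf_le

lemma covrad_nonneg (L : AddSubgroup (Fin n → ℝ)) : 0 ≤ covrad L :=
  Real.iSup_nonneg fun _ => Real.iInf_nonneg fun _ => Real.sqrt_nonneg _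

lemma covSq_of_covrad_le {g : Matrix (Fin n) (Fin n) ℝ} (hg : g.det ≠ 0) {R : ℝ}
    (h : covrad (latticeOf g) ≤ R) : CovSq g (R ^ 2) := by
  intro r hr u
  have hR := (covrad_nonneg (latticeOf g)).trans h
  have h1 : ⨅ v : latticeOf g, enorm (u - (v : Fin n → ℝ)) < √r := by
    refine lt_of_le_of_lt (le_trans (le_ciSup (f := fun u : Fin n → ℝ =>
      ⨅ v : latticeOf g, enorm (u - (v : Fin n → ℝ))) ⟨√(frob g * Fintype.card (Fin n)), ?_⟩ u) h) ((Real.lt_sqrt hR).2 hr)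
    rintro _ ⟨u, rfl⟩
    exact (covSq_frob hg).iInf_le u
  obtain ⟨⟨v, hv⟩, hlt⟩ := exists_lt_of_ciInf_lt h1
  obtain ⟨z, rfl⟩ := mem_latticeOf.1 hv
  exact ⟨z, (Real.sqrt_lt_sqrt_iff (nsq_nonneg _)).1 hlt⟩

lemma covrad_mul_le {g h : Matrix (Fin n) (Fin n) ℝ} (hg : g.det ≠ 0) (hh : h.det ≠ 0) :
    covrad (latticeOf (h * g)) ≤ (1 + √(frob (h - 1))) * covrad (latticeOf g) := by
  have h1 := (covSq_of_covrad_le hg le_rfl).mul_left (h := h) (h' := h⁻¹)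
    (K := (1 + √(frob (h - 1))) ^ 2) (by positivity) (nsq_mulVec_le_of_near_one h)
    (Matrix.mul_nonsing_inv _ hh.isUnit)
  have h2 := h1.covrad_le
  rwa [← mul_pow, Real.sqrt_sq (mul_nonneg (by positivity) (covrad_nonneg _))] at h2

lemma continuousAt_covrad {g : Matrix (Fin n) (Fin n) ℝ} (hg : g.det ≠ 0) :
    ContinuousAt (fun x : Matrix (Fin n) (Fin n) ℝ => covrad (latticeOf x)) g := by
  have hdet : ∀ᶠ x : Matrix (Fin n) (Fin n) ℝ in 𝓝 g, x.det ≠ 0 :=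
    (Continuous.matrix_det continuous_id).continuousAt.eventually_ne hg
  have hinv : ContinuousAt (fun x : Matrix (Fin n) (Fin n) ℝ => x⁻¹) g := by
    simp only [Matrix.inv_def, Ring.inverse_eq_inv']
    exact (ContinuousAt.inv₀ (Continuous.matrix_det continuous_id).continuousAt hg).smul
      (Continuous.matrix_adjugate continuous_id).continuousAt
  have hgg : g * g⁻¹ = 1 := Matrix.mul_nonsing_inv _ hg.isUnit
  have lim1 : Tendsto (fun x : Matrix (Fin n) (Fin n) ℝ => 1 + √(frob (x * g⁻¹ - 1))) (𝓝 g) (𝓝 1) := by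
    have : ContinuousAt (fun x : Matrix (Fin n) (Fin n) ℝ => 1 + √(frob (x * g⁻¹ - 1))) g := by
      refine continuousAt_const.add (Real.continuous_sqrt.continuousAt.comp
        (continuous_frob.continuousAt.comp ?_))
      exact ((continuous_id.mul continuous_const).sub continuous_const).continuousAt
    have h := this.tendsto
    rw [hgg, sub_self] at h
    simpa [frob] using h
  have lim2 : Tendsto (fun x : Matrix (Fin n) (Fin n) ℝ => 1 + √(frob (g * x⁻¹ - 1))) (𝓝 g) (𝓝 1) := by
    have : ContinuousAt (fun x : Matrix (Fin n) (Fin n) ℝ => 1 + √(frob (g * x⁻¹ - 1))) g := by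
      refine continuousAt_const.add (Real.continuous_sqrt.continuousAt.comp
        (continuous_frob.continuousAt.comp ?_))
      exact (continuousAt_const.mul hinv).sub continuousAt_const
    have h := this.tendsto
    rw [hgg, sub_self] at h
    simpa [frob] using h
  have lim3 := lim1.mul_const (covrad (latticeOf g))
  have lim4 := (lim2.inv₀ one_ne_zero).mul_const (covrad (latticeOf g))
  rw [one_mul] at lim3
  rw [inv_one, one_mul] at lim4
  refine tendsto_of_tendsto_of_tendsto_of_le_of_le' lim4 lim3 ?_ ?_
  · filter_upwards [hdet] with x hx
    rw [inv_mul_le_iff₀ (by positivity)]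
    have h := covrad_mul_le hx (h := g * x⁻¹) (by
      rw [Matrix.det_mul, Matrix.det_nonsing_inv, Ring.inverse_eq_inv']
      exact mul_ne_zero hg (inv_ne_zero hx))
    rwa [Matrix.mul_assoc, Matrix.nonsing_inv_mul _ hx.isUnit, Matrix.mul_one] at h
  · filter_upwards [hdet] with x hx
    have h := covrad_mul_le hg (h := x * g⁻¹) (by
      rw [Matrix.det_mul, Matrix.det_nonsing_inv, Ring.inverse_eq_inv']
      exact mul_ne_zero hx (inv_ne_zero hg))
    rwa [Matrix.mul_assoc, Matrix.nonsing_inv_mul _ hg.isUnit, Matrix.mul_one] at h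

end CoveringRadius

section Stability
variable {n : ℕ}

lemma gvol_col {r : ℕ} (X : Matrix (Fin n) (Fin r) ℝ) : gvol X.col = √(gramDet X) := rfl

lemma mem_closure_range_col {r : ℕ} {X : Matrix (Fin n) (Fin r) ℝ} {v : Fin n → ℝ} :
    v ∈ AddSubgroup.closure (Set.range X.col) ↔ ∃ z : Fin r → ℤ, X *ᵥ castV z = v := by
  rw [← Submodule.span_int_eq_addSubgroupClosure, Submodule.mem_toAddSubgroup,
    Submodule.mem_span_range_iff_exists_fun]
  refine exists_congr fun z => ?_
  have : X *ᵥ castV z = ∑ i, z i • X.col i := by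
    ext j
    simp [Matrix.mulVec, dotProduct, castV, mul_comm]
  rw [this]

lemma latticeOf_eq_closure (g : Matrix (Fin n) (Fin n) ℝ) :
    latticeOf g = AddSubgroup.closure (Set.range g.col) := by
  ext v
  rw [mem_latticeOf, mem_closure_range_col]

lemma covolSpec.exists_matrix {g : Matrix (Fin n) (Fin n) ℝ} (hg : g.det ≠ 0)
    {Λ : AddSubgroup (Fin n → ℝ)} (hΛ : Λ ≤ latticeOf g) {c : ℝ} (hc : covolSpec Λ c) :
    ∃ (r : ℕ) (M : Matrix (Fin n) (Fin r) ℤ), gramDet (castM M) ≠ 0 ∧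
      Λ = AddSubgroup.closure (Set.range (g * castM M).col) ∧ c = √(gramDet (g * castM M)) := by
  obtain ⟨r, v, hv, rfl, rfl⟩ := hc
  have h1 : ∀ j, ∃ z : Fin n → ℤ, g *ᵥ castV z = v j := fun j =>
    mem_latticeOf.1 (hΛ (AddSubgroup.subset_closure ⟨j, rfl⟩))
  choose z hz using h1
  have h2 : v = (g * castM (Matrix.of fun i j => z j i)).col := by
    ext j i
    rw [← hz]
    rfl
  have h3 : gramDet (g * castM (Matrix.of fun i j => z j i)) ≠ 0 := by
    rw [gramDet_ne_zero_iff_linearIndependent, ← h2]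
    exact hv
  refine ⟨r, Matrix.of fun i j => z j i, ?_, by rw [← h2], by rw [← gvol_col, ← h2]⟩
  exact (gramDet_mul_left_eq_zero_iff hg _).not.1 h3

lemma exists_covolSpec {g : Matrix (Fin n) (Fin n) ℝ} (hg : g.det ≠ 0)
    {Λ : AddSubgroup (Fin n → ℝ)} (hΛ : Λ ≤ latticeOf g) : ∃ c, covolSpec Λ c := by
  let N : Submodule ℤ (Fin n → ℤ) := AddSubgroup.toIntSubmodule
    (Λ.comap ((Matrix.mulVecLin g).toAddMonoidHom.comp
      (AddMonoidHom.compLeft (Int.castAddHom ℝ) (Fin n))))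
  have hN : ∀ z, z ∈ N ↔ g *ᵥ castV z ∈ Λ := fun z => Iff.rfl
  refine ⟨_, _, (g * castM (basisMat N)).col, ?_, ?_, rfl⟩
  · rw [← gramDet_ne_zero_iff_linearIndependent, Ne, gramDet_mul_left_eq_zero_iff hg]
    exact (isBasisMat_basisMat N).gramDet_ne_zero
  · ext v
    rw [mem_closure_range_col]
    constructor
    · intro hv
      obtain ⟨z, rfl⟩ := mem_latticeOf.1 (hΛ hv)
      obtain ⟨w, rfl⟩ := ((isBasisMat_basisMat N).2 z).1 ((hN z).2 hv)
      exact ⟨w, by rw [← castM_mulVec, Matrix.mulVec_mulVec]⟩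
    · rintro ⟨w, rfl⟩
      rw [← Matrix.mulVec_mulVec, castM_mulVec, ← hN]
      exact ((isBasisMat_basisMat N).2 _).2 ⟨w, rfl⟩

lemma mulVec_injective_of_det_ne_zero {g : Matrix (Fin n) (Fin n) ℝ} (hg : g.det ≠ 0) :
    Function.Injective g.mulVec :=
  Matrix.mulVec_injective_iff_isUnit.2 ((Matrix.isUnit_iff_isUnit_det g).2 hg.isUnit)

lemma covolSpec_latticeOf {g : Matrix (Fin n) (Fin n) ℝ} (hg : g.det ≠ 0) {c : ℝ}
    (hc : covolSpec (latticeOf g) c) : c = |g.det| := by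
  obtain ⟨r, M, hM, hΛ, rfl⟩ := hc.exists_matrix hg le_rfl
  have h1 : IsBasisMat M ⊤ := by
    refine ⟨(isBasisMat_range hM).1, fun z => ⟨fun _ => ?_, fun _ => trivial⟩⟩
    have hz : g *ᵥ castV z ∈ latticeOf g := mem_latticeOf.2 ⟨z, rfl⟩
    rw [hΛ, mem_closure_range_col] at hz
    obtain ⟨w, hw⟩ := hz
    rw [← Matrix.mulVec_mulVec, castM_mulVec] at hw
    exact ⟨w, castV_injective (mulVec_injective_of_det_ne_zero hg hw)⟩
  rw [h1.gramDet_eq isBasisMat_one_top, castM_one, Matrix.mul_one, gramDet_square, Real.sqrt_sq_eq_abs]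

lemma covol_latticeOf {g : Matrix (Fin n) (Fin n) ℝ} (hg : g.det ≠ 0) :
    covol (latticeOf g) = |g.det| := by
  obtain ⟨c, hc⟩ := exists_covolSpec hg (le_refl (latticeOf g))
  have : {c | covolSpec (latticeOf g) c} = {|g.det|} := by
    ext x
    refine ⟨fun hx => covolSpec_latticeOf hg hx, ?_⟩
    rintro rfl
    rwa [Set.mem_ofPred_eq, ← covolSpec_latticeOf hg hc]
  rw [covol, this, csInf_singleton]

lemma isLattice_latticeOf {g : Matrix (Fin n) (Fin n) ℝ} (hg : g.det ≠ 0) :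
    IsLattice (latticeOf g) := by
  have hli : LinearIndependent ℝ g.col := by
    rw [← gramDet_ne_zero_iff_linearIndependent, gramDet_square]
    exact pow_ne_zero 2 hg
  have hcard : Fintype.card (Fin n) = Module.finrank ℝ (Fin n → ℝ) := by simp
  have hspan : Submodule.span ℝ (Set.range g.col) = ⊤ := hli.span_eq_top_of_card_eq_finrank' hcard
  rw [latticeOf_eq_closure]
  constructor
  · let b : Module.Basis (Fin n) ℝ (Fin n → ℝ) := Module.Basis.mk hli hspan.ge
    have hb : Set.range g.col = Set.range b := by rw [Module.Basis.coe_mk]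
    rw [hb, ← Submodule.span_int_eq_addSubgroupClosure]
    exact inferInstanceAs (DiscreteTopology (Submodule.span ℤ (Set.range b)))
  · rw [eq_top_iff, ← hspan]
    exact Submodule.span_mono AddSubgroup.subset_closure

lemma isStable_latticeOf {g : Matrix (Fin n) (Fin n) ℝ} (hg : g.det = 1) (h : NearStab 1 g) :
    IsStable (latticeOf g) := by
  have hg0 : g.det ≠ 0 := by rw [hg]; exact one_ne_zero
  refine ⟨⟨isLattice_latticeOf hg0, by rw [covol_latticeOf hg0, hg, abs_one]⟩, fun Λ hΛ => ?_⟩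
  refine le_csInf (exists_covolSpec hg0 hΛ) fun c hc => ?_
  obtain ⟨r, M, hM, -, rfl⟩ := covolSpec.exists_matrix hg0 hΛ hc
  exact Real.one_le_sqrt.2 (h.le M hM)

lemma exists_uniM_det_mul_eq_one (hn : 0 < n) {g : Matrix (Fin n) (Fin n) ℝ} (hg : g.det ^ 2 = 1) :
    ∃ γ : Matrix (Fin n) (Fin n) ℤ, UniM γ ∧ (g * castM γ).det = 1 := by
  rcases mul_self_eq_one_iff.1 ((sq g.det).symm.trans hg) with h | h
  · exact ⟨1, uniM_one, by rw [castM_one, Matrix.mul_one, h]⟩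
  · let γ : Matrix (Fin n) (Fin n) ℤ := Matrix.diagonal (Function.update 1 ⟨0, hn⟩ (-1))
    have h1 : γ * γ = 1 := by
      rw [Matrix.diagonal_mul_diagonal, ← Matrix.diagonal_one]
      congr 1
      ext i
      by_cases hi : i = ⟨0, hn⟩
      · subst hi; simp
      · simp [Function.update_of_ne hi]
    refine ⟨γ, ⟨γ, h1, h1⟩, ?_⟩
    have h2 : γ.det = -1 := by
      rw [Matrix.det_diagonal, Finset.prod_update_of_mem (Finset.mem_univ _)]
      simp
    rw [Matrix.det_mul, castM_det, h2, h]
    norm_num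

lemma IsUnimodularLattice.exists_eq_latticeOf (hn : 0 < n) {L : AddSubgroup (Fin n → ℝ)}
    (hL : IsUnimodularLattice L) :
    ∃ g : Matrix (Fin n) (Fin n) ℝ, g.det = 1 ∧ L = latticeOf g := by
  have hne : {c | covolSpec L c}.Nonempty := by
    by_contra! h
    have := hL.2
    rw [covol, h, Real.sInf_empty] at this
    exact zero_ne_one this
  obtain ⟨c, r, v, hv, hLv, -⟩ := hne
  have hspan : Submodule.span ℝ (Set.range v) = ⊤ := by
    rw [eq_top_iff, ← hL.1.2, Submodule.span_le, hLv]
    intro x hx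
    have : AddSubgroup.closure (Set.range v) ≤ (Submodule.span ℝ (Set.range v)).toAddSubgroup :=
      (AddSubgroup.closure_le _).2 Submodule.subset_span
    exact this hx
  have hr : r = n := by
    have h1 := finrank_span_eq_card hv
    rw [hspan, finrank_top] at h1
    simpa using h1.symm
  subst hr
  let g : Matrix (Fin r) (Fin r) ℝ := Matrix.of fun i j => v j i
  have hLg : L = latticeOf g := by rw [latticeOf_eq_closure, hLv]; rfl
  have hg : g.det ≠ 0 := by
    have : gramDet g ≠ 0 := (gramDet_ne_zero_iff_linearIndependent g).2 hv
    rw [gramDet_square] at this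
    exact fun h => this (by rw [h]; norm_num)
  have hd : |g.det| = 1 := by rw [← covol_latticeOf hg, ← hLg]; exact hL.2
  obtain ⟨γ, hγ, h1⟩ := exists_uniM_det_mul_eq_one hn (g := g) (by rw [← sq_abs, hd, one_pow])
  exact ⟨_, h1, by rw [latticeOf_mul_uniM g hγ, hLg]⟩

end Stability

section Bound
variable {n d : ℕ}

lemma isCompact_boundedCols (n : ℕ) (C : ℝ) :
    IsCompact {g : Matrix (Fin n) (Fin n) ℝ | g.det ^ 2 = 1 ∧ ∀ j, nsq (g.col j) ≤ C} := by
  have hK : IsCompact (Set.pi Set.univ fun _ : Fin n => Set.pi Set.univ fun _ : Fin n =>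
      Set.Icc (-√C) (√C)) :=
    isCompact_univ_pi fun _ => isCompact_univ_pi fun _ => isCompact_Icc
  refine IsCompact.of_isClosed_subset (X := Matrix (Fin n) (Fin n) ℝ) hK ?_ ?_
  · refine IsClosed.and (isClosed_eq (by fun_prop) continuous_const) ?_
    simp only [Set.ofPred_forall]
    refine isClosed_iInter fun j => isClosed_le ?_ continuous_const
    unfold nsq Matrix.col Matrix.transpose
    fun_prop
  · rintro g ⟨-, hg⟩ i - j -
    have h1 : g i j ^ 2 ≤ C := (Finset.single_le_sum (f := fun i => (g.col j i) ^ 2)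
      (fun _ _ => sq_nonneg _) (Finset.mem_univ i)).trans (hg j)
    exact abs_le.1 (Real.abs_le_sqrt h1)

lemma isClosed_nearStab (c : ℝ) : IsClosed {g : Matrix (Fin n) (Fin n) ℝ | NearStab c g} := by
  have : {g : Matrix (Fin n) (Fin n) ℝ | NearStab c g}
      = ⋂ N : Submodule ℤ (Fin n → ℤ), {g | c ≤ covolSq g N} := by
    ext g
    rw [Set.mem_iInter]
    exact ⟨fun h N => NearStab.covolSq_le h N, fun h => nearStab_of_saturated fun N _ => h N⟩
  rw [this]
  exact isClosed_iInter fun N => isClosed_le continuous_const (continuous_covolSq N)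

lemma exists_covolSq_eq_one {g : Matrix (Fin d) (Fin d) ℝ} (hg : NearStab 1 g)
    (h : ∃ᶠ x : Matrix (Fin d) (Fin d) ℝ in 𝓝 g, x.det = 1 ∧ ¬ NearStab 1 x) :
    ∃ N : Submodule ℤ (Fin d → ℤ), Saturated N ∧ 0 < Module.finrank ℤ N ∧
      Module.finrank ℤ N < d ∧ covolSq g N = 1 := by
  by_contra! hcon
  set C : ℝ := 1 + ∑ i, ∑ j, |g.adjugate i j| with hC
  have hadj : ∀ᶠ x : Matrix (Fin d) (Fin d) ℝ in 𝓝 g, ∀ i j, |x.adjugate i j| < C := by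
    refine eventually_all.2 fun i => eventually_all.2 fun j => ?_
    have hc : Continuous fun x : Matrix (Fin d) (Fin d) ℝ => |x.adjugate i j| :=
      ((Continuous.matrix_adjugate continuous_id).matrix_elem i j).abs
    refine hc.continuousAt.eventually_lt continuousAt_const ?_
    have h1 : |g.adjugate i j| ≤ ∑ j, |g.adjugate i j| :=
      Finset.single_le_sum (f := fun j => |g.adjugate i j|) (fun _ _ => abs_nonneg _)
        (Finset.mem_univ j)
    have h2 : ∑ j, |g.adjugate i j| ≤ ∑ i, ∑ j, |g.adjugate i j| :=
      Finset.single_le_sum (f := fun i => ∑ j, |g.adjugate i j|)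
        (fun _ _ => Finset.sum_nonneg fun _ _ => abs_nonneg _) (Finset.mem_univ i)
    linarith
  have hfin := finite_saturated (ι := Fin d) C 1
  have hlarge := (eventually_all_finite hfin).2 fun N hN =>
    show ∀ᶠ x : Matrix (Fin d) (Fin d) ℝ in 𝓝 g, 0 < Module.finrank ℤ N →
        Module.finrank ℤ N < d → 1 < covolSq x N from by
      by_cases h0 : 0 < Module.finrank ℤ N ∧ Module.finrank ℤ N < d
      · have h1 : 1 < covolSq g N :=
          lt_of_le_of_ne (NearStab.covolSq_le hg N) (hcon N hN.1 h0.1 h0.2).symm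
        filter_upwards [continuousAt_const.eventually_lt
          (continuous_covolSq N).continuousAt h1] with x hx _ _ using hx
      · exact Eventually.of_forall fun x h1 h2 => absurd ⟨h1, h2⟩ h0
  obtain ⟨x, ⟨hx1, hx2⟩, hxadj, hxl⟩ := (h.and_eventually (hadj.and hlarge)).exists
  apply hx2
  refine nearStab_of_saturated fun N hN => ?_
  by_contra! hlt
  have hpos : 0 < Module.finrank ℤ N := by
    refine Nat.pos_of_ne_zero fun h0 => ?_
    rw [covolSq_of_finrank_eq_zero x h0] at hlt
    exact lt_irrefl _ hlt
  have hd : Module.finrank ℤ N < d := by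
    refine lt_of_le_of_ne (finrank_le N) fun h0 => ?_
    rw [covolSq_of_finrank_eq hN h0, hx1] at hlt
    norm_num at hlt
  refine lt_asymm hlt (hxl N ⟨hN, x, x.adjugate, ?_, fun i j => (hxadj i j).le, fun f => ?_⟩ hpos hd)
  · rw [Matrix.adjugate_mul, hx1, one_smul]
  · rw [← sq_le_one_iff_abs_le_one]
    exact (minor_sq_le _ f).trans hlt.le

lemma covSq_of_covolSq_eq_one {g : Matrix (Fin d) (Fin d) ℝ} (hg : g.det ^ 2 = 1)
    (hst : NearStab 1 g) {N : Submodule ℤ (Fin d → ℤ)} (hN : Saturated N)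
    (hd : Module.finrank ℤ N ≤ d) (h1 : covolSq g N = 1) {p q : ℝ}
    (hp : ∀ A : Matrix (Fin (Module.finrank ℤ N)) (Fin (Module.finrank ℤ N)) ℝ,
      A.det ^ 2 = 1 → NearStab 1 A → CovSq A p)
    (hq : ∀ D : Matrix (Fin (d - Module.finrank ℤ N)) (Fin (d - Module.finrank ℤ N)) ℝ,
      D.det ^ 2 = 1 → NearStab 1 D → CovSq D q) : CovSq g (p + q) := by
  have hg0 : g.det ≠ 0 := fun h => by rw [h] at hg; norm_num at hg
  obtain ⟨γ, O, A, B, D, hγ, hO, -, hblock, hA, hAD⟩ :=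
    exists_block hg0 hN rfl (Nat.add_sub_cancel' hd)
  have hA1 : A.det ^ 2 = 1 := hA.symm.trans h1
  have hD1 : D.det ^ 2 = 1 := by rwa [hA1, one_mul, hg] at hAD
  have hA0 : A.det ≠ 0 := fun h => by rw [h] at hA1; norm_num at hA1
  have hstab : NearStab 1 (fromBlocks A B 0 D) := by
    rw [← hblock]
    exact (hst.mul_uniM hγ).orth hO
  have hDs := hstab.block₂₂ hA0
  rw [hA1, div_one] at hDs
  refine CovSq.of_mul (γ := γ) (CovSq.of_orth hO ?_)
  rw [hblock]
  exact (hp A hA1 hstab.block₁₁).fromBlocks (hq D hD1 hDs)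

theorem covSq_of_nearStab
    (H : ∀ d : ℕ, 0 < d → d ≤ n → ∀ g : Matrix (Fin d) (Fin d) ℝ, g.det = 1 →
      IsStable (latticeOf g) → IsLocalMaxCovrad g → covrad (latticeOf g) ≤ √d / 2)
    (d : ℕ) : 0 < d → d ≤ n → ∀ g : Matrix (Fin d) (Fin d) ℝ, g.det ^ 2 = 1 →
      NearStab 1 g → CovSq g (d / 4) := by
  induction d using Nat.strong_induction_on with
  | _ d ih =>
  intro hd hdn g hg hst
  have hne : ∀ {x : Matrix (Fin d) (Fin d) ℝ}, x.det ^ 2 = 1 → x.det ≠ 0 :=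
    fun hx h => by rw [h] at hx; norm_num at hx
  obtain ⟨C, hC⟩ := mahler d 1 1 one_pos zero_le_one
  set K : Set (Matrix (Fin d) (Fin d) ℝ) :=
    {x | x.det ^ 2 = 1 ∧ ∀ j, nsq (x.col j) ≤ C} ∩ {x | NearStab 1 x} with hKdef
  have hK : IsCompact K := (isCompact_boundedCols d C).inter_right (isClosed_nearStab 1)
  have hred : ∀ x : Matrix (Fin d) (Fin d) ℝ, x.det ^ 2 = 1 → NearStab 1 x →
      ∃ y ∈ K, latticeOf y = latticeOf x := by
    intro x hx hxs
    obtain ⟨γ, hγ, hb⟩ := hC x (hne hx) (by rw [← sq_le_one_iff_abs_le_one, hx]) hxs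
    refine ⟨x * castM γ, ⟨⟨?_, hb⟩, hxs.mul_uniM hγ⟩, latticeOf_mul_uniM x hγ⟩
    rw [Matrix.det_mul, mul_pow, hx, hγ.det_sq, one_mul]
  obtain ⟨y, hyK, -⟩ := hred g hg hst
  obtain ⟨y, hyK, hmax⟩ := hK.exists_isMaxOn ⟨y, hyK⟩
    (f := fun x : Matrix (Fin d) (Fin d) ℝ => covrad (latticeOf x))
    fun x hx => (continuousAt_covrad (hne hx.1.1)).continuousWithinAt
  obtain ⟨γ, hγ, hdet⟩ := exists_uniM_det_mul_eq_one hd hyK.1.1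
  have hle : ∀ x : Matrix (Fin d) (Fin d) ℝ, x.det ^ 2 = 1 → NearStab 1 x →
      covrad (latticeOf x) ≤ covrad (latticeOf (y * castM γ)) := by
    intro x hx hxs
    obtain ⟨z, hz, hzx⟩ := hred x hx hxs
    rw [latticeOf_mul_uniM y hγ, ← hzx]
    exact hmax hz
  have hstab : NearStab 1 (y * castM γ) := NearStab.mul_uniM hyK.2 hγ
  have hdet2 : (y * castM γ).det ^ 2 = 1 := by rw [hdet, one_pow]
  generalize y * castM γ = x at hdet hle hstab hdet2
  have hsq : √(d / 4 : ℝ) = √d / 2 := by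
    rw [Real.sqrt_div (Nat.cast_nonneg d), show (4 : ℝ) = 2 ^ 2 by norm_num,
      Real.sqrt_sq zero_le_two]
  have hfinal : covrad (latticeOf x) ≤ √d / 2 := by
    by_cases hloc : IsLocalMaxCovrad x
    · exact H d hd hdn x hdet (isStable_latticeOf hdet hstab) hloc
    · have hfreq : ∃ᶠ x' : Matrix (Fin d) (Fin d) ℝ in 𝓝 x, x'.det = 1 ∧ ¬ NearStab 1 x' := by
        rw [frequently_iff]
        intro U hU
        by_contra! hcon
        refine hloc ⟨U, hU, fun x' hx' hdx' => hle x' (by rw [hdx', one_pow]) ?_⟩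
        exact hcon x' hx' hdx'
      obtain ⟨N, hN, h0, hlt, h1⟩ := exists_covolSq_eq_one hstab hfreq
      have hcov := covSq_of_covolSq_eq_one hdet2 hstab hN hlt.le h1
        (ih _ hlt h0 (hlt.le.trans hdn))
        (ih (d - Module.finrank ℤ N) (by omega) (by omega) (by omega))
      rw [← hsq]
      refine CovSq.covrad_le (hcov.mono (le_of_eq ?_))
      rw [Nat.cast_sub hlt.le]
      ring
  have hR := covSq_of_covrad_le (hne hg) ((hle g hg hst).trans hfinal)
  refine hR.mono (le_of_eq ?_)
  rw [div_pow, Real.sq_sqrt (Nat.cast_nonneg d)]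
  norm_num

lemma exists_expDiag_covrad_lt
    (h : ∀ g : Matrix (Fin n) (Fin n) ℝ, g.det ^ 2 = 1 → NearStab 1 g → CovSq g (n / 4))
    {g : Matrix (Fin n) (Fin n) ℝ} (hg : g.det = 1) {R : ℝ} (hR : √(n / 4 : ℝ) < R) :
    ∃ t : Fin n → ℝ, ∑ i, t i = 0 ∧ covrad (latticeOf (expDiag t * g)) < R := by
  obtain ⟨C, hC⟩ := mahler n (1 / 2) 1 (by norm_num) zero_le_one
  set c : ℕ → ℝ := fun k => 1 - 1 / ((k : ℝ) + 2) with hc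
  have hc2 : ∀ k, 1 / 2 ≤ c k := fun k => by
    have : 1 / ((k : ℝ) + 2) ≤ 1 / 2 :=
      one_div_le_one_div_of_le two_pos (by linarith [Nat.cast_nonneg (α := ℝ) k])
    simp only [hc]
    linarith
  have hc1 : ∀ k, c k < 1 := fun k => by
    have : 0 < 1 / ((k : ℝ) + 2) := by positivity
    simp only [hc]
    linarith
  have hclim : Tendsto c atTop (𝓝 1) := by
    have : Tendsto (fun k : ℕ => 1 / ((k : ℝ) + 2)) atTop (𝓝 0) := by
      simp only [one_div]
      exact (tendsto_atTop_add_const_right _ _ tendsto_natCast_atTop_atTop).inv_tendsto_atTop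
    have h1 := this.const_sub 1
    rwa [sub_zero] at h1
  have hstep : ∀ k, ∃ t : Fin n → ℝ, ∑ i, t i = 0 ∧
      ∃ γ : Matrix (Fin n) (Fin n) ℤ, UniM γ ∧ NearStab (c k) (expDiag t * g * castM γ) ∧
        ∀ j, nsq ((expDiag t * g * castM γ).col j) ≤ C := by
    intro k
    obtain ⟨t, ht, hN⟩ := exists_nearStable hg (by linarith [hc2 k]) (hc1 k)
    have hst := nearStab_of_saturated hN
    have hdet := det_expDiag_mul ht hg
    obtain ⟨γ, hγ, hb⟩ := hC (expDiag t * g) (by rw [hdet]; exact one_ne_zero)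
      (by rw [hdet, abs_one]) (hst.mono (hc2 k))
    exact ⟨t, ht, γ, hγ, hst.mul_uniM hγ, hb⟩
  choose t ht γ hγ hst hb using hstep
  have hmem : ∀ k, expDiag (t k) * g * castM (γ k) ∈
      {g : Matrix (Fin n) (Fin n) ℝ | g.det ^ 2 = 1 ∧ ∀ j, nsq (g.col j) ≤ C} := fun k =>
    ⟨by rw [Matrix.det_mul, mul_pow, det_expDiag_mul (ht k) hg, (hγ k).det_sq, one_pow, one_mul],
      hb k⟩
  have : FirstCountableTopology (Matrix (Fin n) (Fin n) ℝ) :=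
    inferInstanceAs (FirstCountableTopology (Fin n → Fin n → ℝ))
  obtain ⟨y, hy, φ, hφ, hlim⟩ := (isCompact_boundedCols n C).tendsto_subseq hmem
  have hys : NearStab 1 y := by
    refine nearStab_of_saturated fun N _ => ?_
    refine le_of_tendsto_of_tendsto' (hclim.comp hφ.tendsto_atTop)
      (((continuous_covolSq N).tendsto y).comp hlim) fun k => ?_
    exact NearStab.covolSq_le (hst (φ k)) N
  have hy0 : y.det ≠ 0 := fun h0 => by
    have := hy.1
    rw [h0] at this
    norm_num at this
  have hcov : covrad (latticeOf y) < R := ((h y hy.1 hys).covrad_le).trans_lt hR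
  obtain ⟨k, hk⟩ := (((continuousAt_covrad hy0).tendsto.comp hlim).eventually_lt_const hcov).exists
  refine ⟨t (φ k), ht _, ?_⟩
  rw [← latticeOf_mul_uniM _ (hγ (φ k))]
  exact hk

lemma prod_sq_le_pow_nsq (hn : 0 < n) (w : Fin n → ℝ) : (∏ i, w i) ^ 2 ≤ (nsq w / n) ^ n := by
  have h := Real.geom_mean_le_arith_mean Finset.univ (fun _ : Fin n => (1 : ℝ)) (fun i => w i ^ 2)
    (fun _ _ => zero_le_one) (by simpa using hn) (fun _ _ => sq_nonneg _)
  simp only [Real.rpow_one, one_mul, Finset.sum_const, Finset.card_univ, Fintype.card_fin,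
    nsmul_eq_mul, mul_one] at h
  have h0 : 0 ≤ ∏ i, w i ^ 2 := Finset.prod_nonneg fun _ _ => sq_nonneg _
  have h2 := pow_le_pow_left₀ (Real.rpow_nonneg h0 _) h n
  rw [Real.rpow_inv_natCast_pow h0 hn.ne', Finset.prod_pow] at h2
  exact h2

lemma exists_prod_sq_lt (hn : 0 < n)
    (h : ∀ g : Matrix (Fin n) (Fin n) ℝ, g.det ^ 2 = 1 → NearStab 1 g → CovSq g (n / 4))
    {g : Matrix (Fin n) (Fin n) ℝ} (hg : g.det = 1) (u : Fin n → ℝ) {q : ℝ} (hq : (n / 4 : ℝ) < q) :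
    ∃ v ∈ latticeOf g, (∏ i, (u i - v i)) ^ 2 ≤ (q / n) ^ n := by
  set r : ℝ := (n / 4 + q) / 2 with hr
  have hr0 : 0 ≤ r := by have := Nat.cast_nonneg (α := ℝ) n; linarith
  obtain ⟨t, ht, hcov⟩ := exists_expDiag_covrad_lt h hg (R := √r)
    (Real.sqrt_lt_sqrt (by positivity) (by linarith))
  have hdet := det_expDiag_mul ht hg
  have hsq := covSq_of_covrad_le (by rw [hdet]; exact one_ne_zero) hcov.le
  rw [Real.sq_sqrt hr0] at hsq
  obtain ⟨z, hz⟩ := hsq q (by linarith) (expDiag t *ᵥ u)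
  refine ⟨_, mem_latticeOf.2 ⟨z, rfl⟩, ?_⟩
  rw [← Matrix.mulVec_mulVec, ← Matrix.mulVec_sub] at hz
  have h1 : ∏ i, (expDiag t *ᵥ (u - g *ᵥ castV z)) i = ∏ i, (u i - (g *ᵥ castV z) i) := by
    simp only [expDiag, Matrix.mulVec_diagonal, Finset.prod_mul_distrib, ← Real.exp_sum, ht,
      Real.exp_zero, one_mul, Pi.sub_apply]
  rw [← h1]
  refine (prod_sq_le_pow_nsq hn _).trans (pow_le_pow_left₀ ?_ ?_ n)
  · exact div_nonneg (nsq_nonneg _) (Nat.cast_nonneg n)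
  · exact div_le_div_of_nonneg_right hz.le (Nat.cast_nonneg n)

end Bound

end SW

/-- **Corollary 1.3.** If for every `d ≤ n` every stable lattice in `ℒ_d` which is a local
maximum of `covrad` satisfies `covrad(x) ≤ √d/2`, then Minkowski's conjecture holds in
dimension `n`. -/
theorem SW.minkowski_of_local_maxima_bound (n : ℕ) (hn : 2 ≤ n)
    (H : ∀ d : ℕ, 0 < d → d ≤ n → ∀ g : Matrix (Fin d) (Fin d) ℝ, g.det = 1 →
      SW.IsStable (SW.latticeOf g) → SW.IsLocalMaxCovrad g →
      SW.covrad (SW.latticeOf g) ≤ Real.sqrt d / 2) :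
    ∀ L : AddSubgroup (Fin n → ℝ), SW.IsUnimodularLattice L →
      ∀ u : Fin n → ℝ, (⨅ v : L, |∏ i, (u i - (v : Fin n → ℝ) i)|) ≤ 1 / 2 ^ n := by
  intro L hL u
  have hn0 : 0 < n := by omega
  have hnR : (0 : ℝ) < n := Nat.cast_pos.2 hn0
  obtain ⟨g, hg, rfl⟩ := hL.exists_eq_latticeOf hn0
  have key : ∀ q : ℝ, (n / 4 : ℝ) < q →
      (⨅ v : SW.latticeOf g, |∏ i, (u i - (v : Fin n → ℝ) i)|) ^ 2 ≤ (q / n) ^ n := by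
    intro q hq
    obtain ⟨v, hv, hle⟩ := SW.exists_prod_sq_lt hn0
      (SW.covSq_of_nearStab H n hn0 le_rfl) hg u hq
    refine le_trans ?_ hle
    rw [← sq_abs (∏ i, (u i - v i))]
    refine pow_le_pow_left₀ (Real.iInf_nonneg fun _ => abs_nonneg _) ?_ 2
    exact ciInf_le (f := fun v : SW.latticeOf g => |∏ i, (u i - (v : Fin n → ℝ) i)|)
      ⟨0, by rintro _ ⟨v, rfl⟩; exact abs_nonneg _⟩ ⟨v, hv⟩
  have hlim : Tendsto (fun q : ℝ => (q / n) ^ n) (𝓝[>] (n / 4 : ℝ)) (𝓝 (((n / 4 : ℝ) / n) ^ n)) :=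
    ((continuous_id.div_const _).pow n).continuousWithinAt.tendsto
  have hsq := ge_of_tendsto hlim (eventually_nhdsWithin_of_forall key)
  refine le_of_sq_le_sq (hsq.trans_eq ?_) (by positivity)
  rw [div_div, mul_comm, ← div_div, div_self hnR.ne', div_pow, div_pow, one_pow, one_pow, ← pow_mul,
    mul_comm n 2, pow_mul]
  norm_num
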